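/- Let H and H₁ be Hamiltonians on [0,L] and [0,L₁] respectively, with L, L₁ < ∞, both satisfying condition (L): there is no ε > 0 such that the Hamiltonian equals the constant matrix [[0,0],[0,1]] for a.e. x ∈ (0,ε). Let Θ and Θ¹ be the solutions of the corresponding canonical systems J·Y' = λ·H·Y (resp. J·Y' = λ·H₁·Y) with initial value (1,0)ᵀ. If Θ(L,λ) = Θ¹(L₁,λ) for all λ ∈ ℂ, then L = L₁ and H(x) = H₁(x) for a.e. x ∈ (0,L). -/

import Mathlib

open MeasureTheory Complex
open scoped ENNReal ComplexOrder

noncomputable section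


/-- The matrix `J = [[0,-1],[1,0]]` over `ℂ`. -/
def Jc : Matrix (Fin 2) (Fin 2) ℂ := !![0, -1; 1, 0]

/-- Complexification of a real 2×2 matrix. -/
def cplx (A : Matrix (Fin 2) (Fin 2) ℝ) : Matrix (Fin 2) (Fin 2) ℂ :=
  A.map (fun a => (a : ℂ))

/-- `Y` is a solution of the canonical system `J·Y' = z·H·Y` on the set `S`
with initial value `Y₀`, expressed via the equivalent integral equation. -/
def IsCanSol (H : ℝ → Matrix (Fin 2) (Fin 2) ℝ) (S : Set ℝ) (z : ℂ)
    (Y₀ : Fin 2 → ℂ) (Y : ℝ → Fin 2 → ℂ) : Prop :=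
  ContinuousOn Y S ∧
  ∀ x ∈ S, Jc.mulVec (Y x - Y₀) = z • ∫ t in (0:ℝ)..x, (cplx (H t)).mulVec (Y t)

/-- `H` is a Hamiltonian on the finite interval `[0,L]`. -/
def IsHamiltonian (H : ℝ → Matrix (Fin 2) (Fin 2) ℝ) (L : ℝ) : Prop :=
  (∀ i j, Measurable fun x => H x i j) ∧
  (∀ᵐ x ∂(volume.restrict (Set.Icc 0 L)), (H x).PosSemidef ∧ (H x).trace = 1) ∧
  (∀ i j, IntegrableOn (fun x => H x i j) (Set.Icc 0 L))

namespace CS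

/-- parameter derivative of an integral of a jointly continuous function -/
lemma hasDerivAt_param (a b : ℝ) (F F' : ℝ → ℝ → ℝ)
    (hF : ∀ s, Continuous (F s))
    (hF' : Continuous (fun p : ℝ × ℝ => F' p.1 p.2))
    (hd : ∀ s t, HasDerivAt (fun s => F s t) (F' s t) s) (s : ℝ) :
    HasDerivAt (fun s => ∫ t in a..b, F s t) (∫ t in a..b, F' s t) s := by
  have hc : IsCompact ((Set.Icc (s-1) (s+1)) ×ˢ (Set.uIcc a b)) :=
    isCompact_Icc.prod isCompact_uIcc
  obtain ⟨C, hC⟩ := hc.exists_bound_of_continuousOn hF'.continuousOn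
  refine (intervalIntegral.hasDerivAt_integral_of_dominated_loc_of_deriv_le
    (F := F) (F' := F') (x₀ := s) (s := Set.Icc (s-1) (s+1)) (bound := fun _ => C)
    (Icc_mem_nhds (by linarith) (by linarith)) ?_ ?_ ?_ ?_ ?_ ?_).2
  · exact Filter.Eventually.of_forall fun x => (hF x).aestronglyMeasurable
  · exact (hF s).intervalIntegrable _ _
  · exact (hF'.comp (by fun_prop : Continuous fun t : ℝ => (s, t))).aestronglyMeasurable
  · refine Filter.Eventually.of_forall fun t ht x hx => ?_
    exact hC (x, t) ⟨hx, Set.uIoc_subset_uIcc ht⟩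
  · simp
  · exact Filter.Eventually.of_forall fun t ht x hx => hd x t

/-- Wirtinger type inequality -/
lemma wirtinger (a b : ℝ) (hab : a ≤ b) (u u' : ℝ → ℝ)
    (hd : ∀ x, HasDerivAt u (u' x) x) (hc : Continuous u') (hnn : ∀ x, 0 ≤ u x)
    (ha : u a = 0) (hb : u b = 0) (κ : ℝ) (hκ : 0 < κ)
    (hm : κ * (∫ t in a..b, {x | 0 < u x}.indicator (fun _ => (1:ℝ)) t) < Real.pi) :
    κ ^ 2 * ∫ x in a..b, u x ^ 2 ≤ ∫ x in a..b, u' x ^ 2 := by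
  have hcu : Continuous u := continuous_iff_continuousAt.2 fun x => (hd x).continuousAt
  set S : Set ℝ := {x | 0 < u x} with hS
  have hSo : IsOpen S := isOpen_lt continuous_const hcu
  set m := ∫ t in a..b, S.indicator (fun _ => (1:ℝ)) t with hmdef
  have hii : ∀ c d, IntervalIntegrable (S.indicator (fun _ => (1:ℝ))) volume c d := by
    intro c d
    rw [intervalIntegrable_iff]
    exact (integrableOn_const (by simp)).indicator hSo.measurableSet
  set φ : ℝ → ℝ := fun x => ∫ t in a..x, S.indicator (fun _ => (1:ℝ)) t with hφ
  have hφc : Continuous φ := intervalIntegral.continuous_primitive hii a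
  have hφb : φ b = m := rfl
  have hφmono : Monotone φ := by
    intro x y hxy
    have : φ y - φ x = ∫ t in x..y, S.indicator (fun _ => (1:ℝ)) t :=
      intervalIntegral.integral_interval_sub_left (hii _ _) (hii _ _)
    have h2 : 0 ≤ ∫ t in x..y, S.indicator (fun _ => (1:ℝ)) t :=
      intervalIntegral.integral_nonneg hxy fun t _ => Set.indicator_nonneg (by simp) t
    linarith
  have hφa : φ a = 0 := by simp [hφ]
  have hφd : ∀ x, 0 < u x → HasDerivAt φ 1 x := by
    intro x hx
    have hev : S.indicator (fun _ => (1:ℝ)) =ᶠ[nhds x] fun _ => 1 := by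
      filter_upwards [hSo.mem_nhds hx] with y hy
      simp [hy]
    have := intervalIntegral.integral_hasDerivAt_right (hii a x) (b := x)
      ((measurable_const.indicator hSo.measurableSet).stronglyMeasurable.stronglyMeasurableAtFilter)
      (continuousAt_const.congr hev.symm)
    rwa [hev.eq_of_nhds] at this
  set g : ℝ → ℝ := fun x => κ * (φ x - m / 2) with hg
  have hgc : Continuous g := by fun_prop
  have hgr : ∀ x ∈ Set.Icc a b, g x ∈ Set.Ioo (-(Real.pi/2)) (Real.pi/2) := by
    intro x hx
    have h1 : 0 ≤ φ x := hφa ▸ hφmono hx.1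
    have h2 : φ x ≤ m := hφb ▸ hφmono hx.2
    constructor <;> simp only [hg] <;> nlinarith
  set t : ℝ → ℝ := fun x => Real.tan (g x) with ht
  have htc : ContinuousOn t (Set.Icc a b) :=
    Real.continuousOn_tan_Ioo.comp hgc.continuousOn hgr
  set W : ℝ → ℝ := fun x => κ * t x * u x ^ 2 with hW
  set W' : ℝ → ℝ := fun x => κ ^ 2 * (1 + t x ^ 2) * u x ^ 2 + 2 * κ * t x * u x * u' x with hW'
  have hWc : ContinuousOn W (Set.Icc a b) := by fun_prop
  have hWc' : ContinuousOn W' (Set.Icc a b) := by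
    have := hc.continuousOn (s := Set.Icc a b)
    have := hcu.continuousOn (s := Set.Icc a b)
    fun_prop
  have hWd : ∀ x ∈ Set.Ioo a b, HasDerivAt W (W' x) x := by
    intro x hx
    have hxI := Set.Ioo_subset_Icc_self hx
    rcases (hnn x).eq_or_lt with h0 | hpos
    · have hu0 : u' x = 0 := by
        have hmin : IsLocalMin u x := Filter.Eventually.of_forall fun y => by
          rw [← h0]; exact hnn y
        exact hmin.hasDerivAt_eq_zero (hd x)
      have e1 : W' x = 0 := by simp [hW', ← h0]
      rw [e1]
      have htx : ContinuousAt t x := htc.continuousAt (Icc_mem_nhds hx.1 hx.2)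
      have h2 : HasDerivAt (fun y => u y ^ 2) 0 x := by
        refine ((hd x).pow 2).congr_deriv ?_
        simp [← h0]
      have h3 : (fun y => u y ^ 2) =o[nhds x] fun y => y - x := by
        have := h2.isLittleO
        simpa [← h0] using this
      have h4 : (fun y => κ * t y) =O[nhds x] fun _ => (1:ℝ) :=
        ((continuousAt_const.mul htx).tendsto).isBigO_one ℝ
      have h5 : W =o[nhds x] fun y => y - x := by
        have := h4.mul_isLittleO h3
        simpa [hW] using this
      rw [hasDerivAt_iff_isLittleO]
      have : W x = 0 := by simp [hW, ← h0]
      simpa [this] using h5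
    · have hcos : Real.cos (g x) ≠ 0 := (Real.cos_pos_of_mem_Ioo (hgr x hxI)).ne'
      have hg' : HasDerivAt g (κ * 1) x := ((hφd x hpos).sub_const _).const_mul κ
      have ht' : HasDerivAt t (1 / Real.cos (g x) ^ 2 * (κ * 1)) x :=
        (Real.hasDerivAt_tan hcos).comp x hg'
      have := (ht'.const_mul κ).mul ((hd x).pow 2)
      refine this.congr_deriv ?_
      have hsec : 1 / Real.cos (g x) ^ 2 = 1 + t x ^ 2 := by
        have := Real.inv_one_add_tan_sq hcos
        simp only [ht]
        rw [← this]; simp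
      rw [hsec]
      simp only [hW']
      push_cast
      simp
      ring
  have hintg := intervalIntegral.integral_eq_sub_of_hasDerivAt_of_le hab hWc hWd
    (hWc'.intervalIntegrable_of_Icc hab)
  have hW0 : W b - W a = 0 := by simp [hW, ha, hb]
  rw [hW0] at hintg
  have hi1 : IntervalIntegrable (fun x => u x ^ 2) volume a b :=
    (hcu.pow 2).intervalIntegrable _ _
  have hi2 : IntervalIntegrable (fun x => u' x ^ 2) volume a b :=
    (hc.pow 2).intervalIntegrable _ _
  have hi3 : IntervalIntegrable W' volume a b := hWc'.intervalIntegrable_of_Icc hab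
  have : κ ^ 2 * ∫ x in a..b, u x ^ 2 ≤ ∫ x in a..b, (u' x ^ 2 + W' x) := by
    rw [← intervalIntegral.integral_const_mul]
    refine intervalIntegral.integral_mono_on hab (hi1.const_mul _) (hi2.add hi3) ?_
    intro x hx
    simp only [hW']
    nlinarith [sq_nonneg (u' x + κ * t x * u x)]
  rw [intervalIntegral.integral_add hi2 hi3, hintg] at this
  linarith

/-- smoothed logarithm cut-off -/
def Psi1 (q : ℝ) : ℝ := (max (q - 1) 0) ^ 2 / q ^ 3
def Psi2 (q : ℝ) : ℝ := 2 * max (q - 1) 0 / q ^ 3 - 3 * (max (q - 1) 0) ^ 2 / q ^ 4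
def Psi (q : ℝ) : ℝ := ∫ t in (1:ℝ)..q, Psi1 t

lemma psi1_of_le {q : ℝ} (hq : q ≤ 1) : Psi1 q = 0 := by
  simp [Psi1, max_eq_right (sub_nonpos.2 hq)]
lemma psi2_of_le {q : ℝ} (hq : q ≤ 1) : Psi2 q = 0 := by
  simp [Psi2, max_eq_right (sub_nonpos.2 hq)]
lemma psi_of_le {q : ℝ} (hq : q ≤ 1) : Psi q = 0 := by
  unfold Psi
  rw [intervalIntegral.integral_congr (g := fun _ => 0)]
  · simp
  · intro x hx
    rw [Set.uIcc_of_ge hq] at hx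
    exact psi1_of_le hx.2

lemma hasDerivAt_max_sq (q : ℝ) :
    HasDerivAt (fun q : ℝ => (max (q - 1) 0) ^ 2) (2 * max (q - 1) 0) q := by
  rcases lt_trichotomy q 1 with h | h | h
  · rw [max_eq_right (by linarith)]
    simp only [mul_zero]
    refine (hasDerivAt_const q (0:ℝ)).congr_of_eventuallyEq ?_
    filter_upwards [Iio_mem_nhds h] with y hy
    rw [max_eq_right (by simp at hy; linarith)]; simp
  · subst h
    simp only [sub_self, max_self, mul_zero]
    rw [hasDerivAt_iff_isLittleO]
    simp only [sub_self, max_self]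
    have : (fun x' : ℝ => (max (x' - 1) 0) ^ 2) =O[nhds 1] fun x' => (x' - 1) ^ 2 := by
      refine Asymptotics.IsBigO.of_bound 1 (Filter.Eventually.of_forall fun x => ?_)
      simp only [norm_pow, Real.norm_eq_abs, one_mul]
      refine pow_le_pow_left₀ (abs_nonneg _) ?_ 2
      rw [abs_of_nonneg (le_max_right _ _)]
      exact max_le (le_abs_self _) (abs_nonneg _)
    have h2 : (fun x' : ℝ => (x' - 1) ^ 2) =o[nhds 1] fun x' => x' - 1 := by
      have h := (hasDerivAt_id (1:ℝ)).sub_const 1 |>.pow 2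
      have h := h.isLittleO
      simpa using h
    simpa using this.trans_isLittleO h2
  · rw [max_eq_left (by linarith)]
    have : HasDerivAt (fun q : ℝ => (q - 1) ^ 2) (2 * (q - 1)) q := by
      refine (((hasDerivAt_id q).sub_const 1).pow 2).congr_deriv ?_
      simp
    refine this.congr_of_eventuallyEq ?_
    filter_upwards [Ioi_mem_nhds h] with y hy
    rw [max_eq_left (by simp at hy; linarith)]

lemma psi1_deriv (q : ℝ) : HasDerivAt Psi1 (Psi2 q) q := by
  rcases lt_or_ge q 1 with h | h
  · rw [psi2_of_le h.le]
    refine (hasDerivAt_const q (0:ℝ)).congr_of_eventuallyEq ?_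
    filter_upwards [Iio_mem_nhds h] with y hy
    exact psi1_of_le (le_of_lt hy)
  · have hq : q ≠ 0 := by linarith
    have := (hasDerivAt_max_sq q).div ((hasDerivAt_id q).pow 3) (by simpa using pow_ne_zero 3 hq)
    refine this.congr_deriv ?_
    simp only [Psi2, id, Pi.pow_apply]
    field_simp
    ring

lemma psi1_cont : Continuous Psi1 :=
  continuous_iff_continuousAt.2 fun q => (psi1_deriv q).continuousAt

lemma psi2_cont : Continuous Psi2 := by
  refine continuous_iff_continuousAt.2 fun q => ?_
  rcases lt_or_ge q 1 with h | h
  · refine (continuousAt_const (y := (0:ℝ))).congr ?_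
    filter_upwards [Iio_mem_nhds h] with y hy
    exact (psi2_of_le (le_of_lt hy)).symm
  · have hq : q ≠ 0 := by linarith
    unfold Psi2
    have h3 : q ^ 3 ≠ 0 := pow_ne_zero _ hq
    have h4 : q ^ 4 ≠ 0 := pow_ne_zero _ hq
    refine ContinuousAt.sub (ContinuousAt.div ?_ ?_ h3) (ContinuousAt.div ?_ ?_ h4) <;> fun_prop

lemma psi_deriv (q : ℝ) : HasDerivAt Psi (Psi1 q) q :=
  intervalIntegral.integral_hasDerivAt_right (psi1_cont.intervalIntegrable _ _)
    psi1_cont.stronglyMeasurable.stronglyMeasurableAtFilter psi1_cont.continuousAt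

lemma psi_cont : Continuous Psi :=
  continuous_iff_continuousAt.2 fun q => (psi_deriv q).continuousAt

lemma psi_pos {q : ℝ} (hq : 1 < q) : 0 < Psi q := by
  unfold Psi
  refine intervalIntegral.intervalIntegral_pos_of_pos_on (psi1_cont.intervalIntegrable _ _) ?_ hq
  intro x hx
  unfold Psi1
  have : 0 < max (x - 1) 0 := lt_max_of_lt_left (by linarith [hx.1])
  have : 0 < x := by linarith [hx.1]
  positivity

lemma psi_nonneg (q : ℝ) : 0 ≤ Psi q := by
  rcases le_or_gt q 1 with h | h
  · rw [psi_of_le h]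
  · exact (psi_pos h).le

lemma psi_le_log {q : ℝ} (hq : 1 ≤ q) : Psi q ≤ Real.log q := by
  have h0 : (0:ℝ) ∉ Set.uIcc 1 q := by
    rw [Set.uIcc_of_le hq]; intro h; linarith [h.1]
  have := integral_one_div h0
  simp only [div_one] at this
  rw [← this]
  refine intervalIntegral.integral_mono_on hq (psi1_cont.intervalIntegrable _ _) ?_ ?_
  · exact (intervalIntegral.intervalIntegrable_one_div (fun x hx h => h0 (h ▸ hx)) continuousOn_id)
  · intro x hx
    have hx1 := hx.1
    have hx0 : 0 < x := by linarith
    unfold Psi1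
    rw [max_eq_left (by linarith), div_le_div_iff₀ (by positivity) hx0]
    have : (x - 1) ^ 2 ≤ x ^ 2 := by nlinarith
    nlinarith

lemma psi_comb (q : ℝ) : 0 ≤ q * Psi2 q + Psi1 q := by
  rcases le_or_gt q 1 with h | h
  · simp [psi1_of_le h, psi2_of_le h]
  · have : q * Psi2 q + Psi1 q = 2 * (q - 1) / q ^ 3 := by
      unfold Psi1 Psi2
      rw [max_eq_left (by linarith)]
      have : q ≠ 0 := by linarith
      field_simp
      ring
    rw [this]
    have : 0 < q - 1 := by linarith
    positivity

/-- package of data for a periodic subharmonic function -/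
structure Sub (u us ut uss utt : ℝ → ℝ → ℝ) : Prop where
  nn : ∀ s t, 0 ≤ u s t
  cu : Continuous fun p : ℝ × ℝ => u p.1 p.2
  cus : Continuous fun p : ℝ × ℝ => us p.1 p.2
  cut : Continuous fun p : ℝ × ℝ => ut p.1 p.2
  cuss : Continuous fun p : ℝ × ℝ => uss p.1 p.2
  cutt : Continuous fun p : ℝ × ℝ => utt p.1 p.2
  ds : ∀ s t, HasDerivAt (fun s => u s t) (us s t) s
  dss : ∀ s t, HasDerivAt (fun s => us s t) (uss s t) s
  dt : ∀ s t, HasDerivAt (fun t => u s t) (ut s t) t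
  dtt : ∀ s t, HasDerivAt (fun t => ut s t) (utt s t) t
  pu : ∀ s t, u s (t + 2 * Real.pi) = u s t
  put : ∀ s t, ut s (t + 2 * Real.pi) = ut s t
  lap : ∀ s t, 0 ≤ uss s t + utt s t

lemma exists_sub (f : ℂ → ℂ) (hf : Differentiable ℂ f) :
    ∃ us ut uss utt, Sub (fun s t => Psi (normSq (f (Complex.exp (s + t * I))))) us ut uss utt := by
  set k : ℂ → ℂ := fun w => f (Complex.exp w) with hk
  have hkd : Differentiable ℂ k := hf.comp Complex.differentiable_exp
  have hk1d : Differentiable ℂ (deriv k) := hkd.deriv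
  have hk2c : Continuous (deriv (deriv k)) := hk1d.deriv.continuous
  have hper : ∀ w, k (w + 2 * Real.pi * I) = k w := by
    intro w; simp only [hk, Complex.exp_periodic w]
  have hper1 : ∀ w, deriv k (w + 2 * Real.pi * I) = deriv k w := by
    intro w
    rw [← deriv_comp_add_const]
    simp only [hper]
  have hp1 : ∀ (s t : ℝ), HasDerivAt (fun s : ℝ => (s + t * I : ℂ)) 1 s := fun s t =>
    (Complex.ofRealCLM.hasDerivAt).add_const _
  have hp2 : ∀ (s t : ℝ), HasDerivAt (fun t : ℝ => (s + t * I : ℂ)) I t := fun s t => by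
    simpa using ((Complex.ofRealCLM.hasDerivAt (x := t)).mul_const I).const_add (s:ℂ)
  have key : ∀ g : ℂ → ℂ, Differentiable ℂ g → ∀ s t : ℝ,
      HasDerivAt (fun s : ℝ => (g (s + t * I)).re) (deriv g (s + t * I)).re s ∧
      HasDerivAt (fun s : ℝ => (g (s + t * I)).im) (deriv g (s + t * I)).im s ∧
      HasDerivAt (fun t : ℝ => (g (s + t * I)).re) (-(deriv g (s + t * I)).im) t ∧
      HasDerivAt (fun t : ℝ => (g (s + t * I)).im) (deriv g (s + t * I)).re t := by
    intro g hg s t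
    have h1 : HasDerivAt (fun s : ℝ => g (s + t * I)) (deriv g (s + t * I) * 1) s :=
      ((hg _).hasDerivAt).comp s (hp1 s t)
    have h2 : HasDerivAt (fun t : ℝ => g (s + t * I)) (deriv g (s + t * I) * I) t :=
      ((hg _).hasDerivAt).comp t (hp2 s t)
    refine ⟨?_, ?_, ?_, ?_⟩
    · exact (Complex.reCLM.hasFDerivAt.comp_hasDerivAt s h1).congr_deriv (by simp)
    · exact (Complex.imCLM.hasFDerivAt.comp_hasDerivAt s h1).congr_deriv (by simp)
    · exact (Complex.reCLM.hasFDerivAt.comp_hasDerivAt t h2).congr_deriv (by simp)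
    · exact (Complex.imCLM.hasFDerivAt.comp_hasDerivAt t h2).congr_deriv (by simp)
  obtain ⟨a, ha⟩ : ∃ a : ℝ → ℝ → ℝ, a = fun s t : ℝ => (k (s + t * I)).re := ⟨_, rfl⟩
  obtain ⟨b, hb⟩ : ∃ a : ℝ → ℝ → ℝ, a = fun s t : ℝ => (k (s + t * I)).im := ⟨_, rfl⟩
  obtain ⟨a1, ha1⟩ : ∃ a : ℝ → ℝ → ℝ, a = fun s t : ℝ => (deriv k (s + t * I)).re := ⟨_, rfl⟩
  obtain ⟨b1, hb1⟩ : ∃ a : ℝ → ℝ → ℝ, a = fun s t : ℝ => (deriv k (s + t * I)).im := ⟨_, rfl⟩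
  obtain ⟨a2, ha2⟩ : ∃ a : ℝ → ℝ → ℝ, a = fun s t : ℝ => (deriv (deriv k) (s + t * I)).re := ⟨_, rfl⟩
  obtain ⟨b2, hb2⟩ : ∃ a : ℝ → ℝ → ℝ, a = fun s t : ℝ => (deriv (deriv k) (s + t * I)).im := ⟨_, rfl⟩
  have das : ∀ s t, HasDerivAt (fun s => a s t) (a1 s t) s := by
    intro s t; rw [ha, ha1]; exact (key k hkd s t).1
  have dbs : ∀ s t, HasDerivAt (fun s => b s t) (b1 s t) s := by
    intro s t; rw [hb, hb1]; exact (key k hkd s t).2.1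
  have dat : ∀ s t, HasDerivAt (fun t => a s t) (-b1 s t) t := by
    intro s t; rw [ha, hb1]; exact (key k hkd s t).2.2.1
  have dbt : ∀ s t, HasDerivAt (fun t => b s t) (a1 s t) t := by
    intro s t; rw [hb, ha1]; exact (key k hkd s t).2.2.2
  have da1s : ∀ s t, HasDerivAt (fun s => a1 s t) (a2 s t) s := by
    intro s t; rw [ha1, ha2]; exact (key _ hk1d s t).1
  have db1s : ∀ s t, HasDerivAt (fun s => b1 s t) (b2 s t) s := by
    intro s t; rw [hb1, hb2]; exact (key _ hk1d s t).2.1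
  have da1t : ∀ s t, HasDerivAt (fun t => a1 s t) (-b2 s t) t := by
    intro s t; rw [ha1, hb2]; exact (key _ hk1d s t).2.2.1
  have db1t : ∀ s t, HasDerivAt (fun t => b1 s t) (a2 s t) t := by
    intro s t; rw [hb1, ha2]; exact (key _ hk1d s t).2.2.2
  have hk0c := hkd.continuous
  have hk1c := hk1d.continuous
  have ca : Continuous fun p : ℝ × ℝ => a p.1 p.2 := by rw [ha]; fun_prop
  have cb : Continuous fun p : ℝ × ℝ => b p.1 p.2 := by rw [hb]; fun_prop
  have ca1 : Continuous fun p : ℝ × ℝ => a1 p.1 p.2 := by rw [ha1]; fun_prop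
  have cb1 : Continuous fun p : ℝ × ℝ => b1 p.1 p.2 := by rw [hb1]; fun_prop
  have ca2 : Continuous fun p : ℝ × ℝ => a2 p.1 p.2 := by rw [ha2]; fun_prop
  have cb2 : Continuous fun p : ℝ × ℝ => b2 p.1 p.2 := by rw [hb2]; fun_prop
  have pp : ∀ s t : ℝ, (s + ((t + 2 * Real.pi : ℝ) : ℂ) * I : ℂ) = (s + t * I) + 2 * Real.pi * I := by
    intro s t; push_cast; ring
  have pa : ∀ s t, a s (t + 2 * Real.pi) = a s t := by
    intro s t; rw [ha]; simp only [pp, hper]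
  have pb : ∀ s t, b s (t + 2 * Real.pi) = b s t := by
    intro s t; rw [hb]; simp only [pp, hper]
  have pa1 : ∀ s t, a1 s (t + 2 * Real.pi) = a1 s t := by
    intro s t; rw [ha1]; simp only [pp, hper1]
  have pb1 : ∀ s t, b1 s (t + 2 * Real.pi) = b1 s t := by
    intro s t; rw [hb1]; simp only [pp, hper1]
  have hu : (fun s t : ℝ => Psi (normSq (f (Complex.exp (s + t * I))))) =
      fun s t => Psi (a s t ^ 2 + b s t ^ 2) := by
    funext s t
    rw [ha, hb]
    simp only [hk, normSq_apply]
    ring_nf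
  rw [hu]
  clear_value k
  clear hu pp hp1 hp2 key ha hb ha1 hb1 ha2 hb2 hper hper1 hk2c hk0c hk1c hkd hk1d hk
  have c0 := psi_cont
  have c1 := psi1_cont
  have c2 := psi2_cont
  have dqs : ∀ s t, HasDerivAt (fun s => a s t ^ 2 + b s t ^ 2)
      (2 * (a s t * a1 s t + b s t * b1 s t)) s := fun s t => by
    refine (((das s t).pow 2).add ((dbs s t).pow 2)).congr_deriv ?_
    simp; ring
  have dqt : ∀ s t, HasDerivAt (fun t => a s t ^ 2 + b s t ^ 2)
      (2 * (b s t * a1 s t - a s t * b1 s t)) t := fun s t => by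
    refine (((dat s t).pow 2).add ((dbt s t).pow 2)).congr_deriv ?_
    simp; ring
  refine ⟨fun s t => Psi1 (a s t ^ 2 + b s t ^ 2) * (2 * (a s t * a1 s t + b s t * b1 s t)),
    fun s t => Psi1 (a s t ^ 2 + b s t ^ 2) * (2 * (b s t * a1 s t - a s t * b1 s t)),
    fun s t => Psi2 (a s t ^ 2 + b s t ^ 2) * (2 * (a s t * a1 s t + b s t * b1 s t)) ^ 2 +
      Psi1 (a s t ^ 2 + b s t ^ 2) *
        (2 * (a1 s t ^ 2 + b1 s t ^ 2 + (a s t * a2 s t + b s t * b2 s t))),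
    fun s t => Psi2 (a s t ^ 2 + b s t ^ 2) * (2 * (b s t * a1 s t - a s t * b1 s t)) ^ 2 +
      Psi1 (a s t ^ 2 + b s t ^ 2) *
        (2 * (a1 s t ^ 2 + b1 s t ^ 2 - (a s t * a2 s t + b s t * b2 s t))),
    ?_⟩
  constructor
  · exact fun s t => psi_nonneg _
  · fun_prop
  · fun_prop
  · fun_prop
  · fun_prop
  · fun_prop
  · exact fun s t => (psi_deriv _).comp s (dqs s t)
  · intro s t
    have h := ((psi1_deriv _).comp s (dqs s t)).mul
      ((((das s t).mul (da1s s t)).add ((dbs s t).mul (db1s s t))).const_mul 2)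
    refine h.congr_deriv ?_
    simp only [Function.comp, Pi.add_apply, Pi.sub_apply, Pi.mul_apply]
    ring
  · exact fun s t => (psi_deriv _).comp t (dqt s t)
  · intro s t
    have h := ((psi1_deriv _).comp t (dqt s t)).mul
      ((((dbt s t).mul (da1t s t)).sub ((dat s t).mul (db1t s t))).const_mul 2)
    refine h.congr_deriv ?_
    simp only [Function.comp, Pi.add_apply, Pi.sub_apply, Pi.mul_apply]
    ring
  · intro s t; simp only [pa, pb]
  · intro s t; simp only [pa, pb, pa1, pb1]
  · intro s t
    have h := psi_comb (a s t ^ 2 + b s t ^ 2)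
    have h2 : 0 ≤ 4 * (a1 s t ^ 2 + b1 s t ^ 2) := by positivity
    refine (mul_nonneg h2 h).trans_eq ?_
    ring
end CS

namespace CS

/-- measure of the positivity set on a circle -/
def mPos (u : ℝ → ℝ → ℝ) (s : ℝ) : ℝ :=
  ∫ t in (0:ℝ)..(2 * Real.pi), {x | 0 < u s x}.indicator (fun _ => (1:ℝ)) t

section
variable {u us ut uss utt : ℝ → ℝ → ℝ}

lemma Sub.cs (h : Sub u us ut uss utt) (s : ℝ) : Continuous (u s) ∧ Continuous (us s) ∧
    Continuous (ut s) ∧ Continuous (uss s) ∧ Continuous (utt s) := by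
  have hp : Continuous fun t : ℝ => (s, t) := by fun_prop
  exact ⟨h.cu.comp hp, h.cus.comp hp, h.cut.comp hp, h.cuss.comp hp, h.cutt.comp hp⟩

lemma Sub.derivA (h : Sub u us ut uss utt) (s : ℝ) :
    HasDerivAt (fun s => ∫ t in (0:ℝ)..(2 * Real.pi), u s t ^ 2)
      (∫ t in (0:ℝ)..(2 * Real.pi), 2 * (u s t * us s t)) s := by
  have := h.cu; have := h.cus
  refine hasDerivAt_param 0 (2 * Real.pi) (fun s t => u s t ^ 2) (fun s t => 2 * (u s t * us s t))
    (fun s => (h.cs s).1.pow 2) (by fun_prop) (fun s t => ?_) s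
  refine ((h.ds s t).pow 2).congr_deriv ?_
  simp; ring

lemma Sub.derivI (h : Sub u us ut uss utt) (s : ℝ) :
    HasDerivAt (fun s => ∫ t in (0:ℝ)..(2 * Real.pi), u s t * us s t)
      (∫ t in (0:ℝ)..(2 * Real.pi), (us s t ^ 2 + u s t * uss s t)) s := by
  have := h.cu; have := h.cus; have := h.cuss
  refine hasDerivAt_param 0 (2 * Real.pi) (fun s t => u s t * us s t)
    (fun s t => us s t ^ 2 + u s t * uss s t)
    (fun s => (h.cs s).1.mul (h.cs s).2.1) (by fun_prop) (fun s t => ?_) s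
  refine ((h.ds s t).mul (h.dss s t)).congr_deriv ?_
  ring

lemma Sub.boundD (h : Sub u us ut uss utt) (s : ℝ) :
    (∫ t in (0:ℝ)..(2 * Real.pi), us s t ^ 2) + (∫ t in (0:ℝ)..(2 * Real.pi), ut s t ^ 2) ≤
      ∫ t in (0:ℝ)..(2 * Real.pi), (us s t ^ 2 + u s t * uss s t) := by
  obtain ⟨c0, c1, c2, c3, c4⟩ := h.cs s
  have h2pi : (0:ℝ) ≤ 2 * Real.pi := by positivity
  have e : ∫ t in (0:ℝ)..(2 * Real.pi), (ut s t ^ 2 + u s t * utt s t) = 0 := by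
    rw [intervalIntegral.integral_eq_sub_of_hasDerivAt (f := fun t => u s t * ut s t)]
    · have h1 := h.pu s 0; have h2 := h.put s 0
      simp only [zero_add] at h1 h2
      simp [h1, h2]
    · intro t _
      refine ((h.dt s t).mul (h.dtt s t)).congr_deriv ?_
      ring
    · exact Continuous.intervalIntegrable (by fun_prop) _ _
  have key : ∫ t in (0:ℝ)..(2 * Real.pi), (us s t ^ 2 + ut s t ^ 2) ≤
      ∫ t in (0:ℝ)..(2 * Real.pi),
        ((us s t ^ 2 + u s t * uss s t) + (ut s t ^ 2 + u s t * utt s t)) := by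
    refine intervalIntegral.integral_mono_on h2pi (Continuous.intervalIntegrable (by fun_prop) _ _)
      (Continuous.intervalIntegrable (by fun_prop) _ _) fun t _ => ?_
    nlinarith [mul_nonneg (h.nn s t) (h.lap s t)]
  rw [intervalIntegral.integral_add (Continuous.intervalIntegrable (by fun_prop) _ _)
    (Continuous.intervalIntegrable (by fun_prop) _ _),
    intervalIntegral.integral_add (Continuous.intervalIntegrable (by fun_prop) _ _)
    (Continuous.intervalIntegrable (by fun_prop) _ _), e, add_zero] at key
  exact key

lemma Sub.D_nonneg (h : Sub u us ut uss utt) (s : ℝ) :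
    0 ≤ ∫ t in (0:ℝ)..(2 * Real.pi), (us s t ^ 2 + u s t * uss s t) := by
  have h2pi : (0:ℝ) ≤ 2 * Real.pi := by positivity
  refine le_trans (add_nonneg ?_ ?_) (h.boundD s) <;>
  exact intervalIntegral.integral_nonneg h2pi fun t _ => sq_nonneg _

lemma Sub.I_mono (h : Sub u us ut uss utt) :
    Monotone (fun s => ∫ t in (0:ℝ)..(2 * Real.pi), u s t * us s t) :=
  monotone_of_hasDerivAt_nonneg (fun s => h.derivI s) (fun s => h.D_nonneg s)

lemma Sub.msble (h : Sub u us ut uss utt) (s : ℝ) : MeasurableSet {x | 0 < u s x} :=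
  (isOpen_lt continuous_const (h.cs s).1).measurableSet

lemma ind_ii {S : Set ℝ} (hS : MeasurableSet S) (c d : ℝ) :
    IntervalIntegrable (S.indicator (fun _ => (1:ℝ))) volume c d := by
  rw [intervalIntegrable_iff]
  exact (integrableOn_const (by simp)).indicator hS

lemma mPos_nonneg (s : ℝ) : 0 ≤ mPos u s :=
  intervalIntegral.integral_nonneg (by positivity)
    fun t _ => Set.indicator_nonneg (by simp) t

lemma Sub.mPos_I (h : Sub u us ut uss utt) (s : ℝ) (hz : ∃ t₀, u s t₀ = 0) :
    2 * Real.pi * (∫ t in (0:ℝ)..(2 * Real.pi), u s t * us s t) ≤ mPos u s *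
      ∫ t in (0:ℝ)..(2 * Real.pi), (us s t ^ 2 + u s t * uss s t) := by
  obtain ⟨t₀, ht₀⟩ := hz
  obtain ⟨c0, c1, c2, c3, c4⟩ := h.cs s
  have h2pi : (0:ℝ) ≤ 2 * Real.pi := by positivity
  set m := mPos u s
  set Iu := ∫ t in (0:ℝ)..(2 * Real.pi), u s t * us s t with hI
  set D := ∫ t in (0:ℝ)..(2 * Real.pi), (us s t ^ 2 + u s t * uss s t)
  have per : ∀ g : ℝ → ℝ, Function.Periodic g (2 * Real.pi) →
      ∫ t in t₀..(t₀ + 2 * Real.pi), g t = ∫ t in (0:ℝ)..(2 * Real.pi), g t := by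
    intro g hg
    have := hg.intervalIntegral_add_eq t₀ 0
    simpa using this
  have key : ∀ κ, 0 < κ → κ * m < Real.pi → 2 * κ * Iu ≤ D := by
    intro κ hκ hκm
    have e1 : ∫ t in t₀..(t₀ + 2 * Real.pi), {x | 0 < u s x}.indicator (fun _ => (1:ℝ)) t = m := by
      refine per _ ?_
      intro x
      simp only [Set.indicator, Set.mem_ofPred_eq, h.pu]
    have w := wirtinger t₀ (t₀ + 2 * Real.pi) (by linarith) (u s) (ut s) (h.dt s) c2 (h.nn s) ht₀
      (by rw [h.pu, ht₀]) κ hκ (by rw [e1]; exact hκm)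
    rw [per (fun t => u s t ^ 2) (fun t => by simp only [h.pu]),
      per (fun t => ut s t ^ 2) (fun t => by simp only [h.put])] at w
    have hb := h.boundD s
    have : 2 * κ * Iu ≤ (∫ t in (0:ℝ)..(2 * Real.pi), us s t ^ 2) +
        κ ^ 2 * ∫ t in (0:ℝ)..(2 * Real.pi), u s t ^ 2 := by
      rw [hI, ← intervalIntegral.integral_const_mul, ← intervalIntegral.integral_const_mul,
        ← intervalIntegral.integral_add (Continuous.intervalIntegrable (by fun_prop) _ _)
        (Continuous.intervalIntegrable (by fun_prop) _ _)]
      refine intervalIntegral.integral_mono_on h2pi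
        (Continuous.intervalIntegrable (by fun_prop) _ _)
        (Continuous.intervalIntegrable (by fun_prop) _ _) fun t _ => ?_
      nlinarith [sq_nonneg (us s t - κ * u s t)]
    linarith
  have hm0 : 0 ≤ m := mPos_nonneg s
  have hD : 0 ≤ D := h.D_nonneg s
  rcases hm0.eq_or_lt with h0 | hpos
  · rw [← h0, zero_mul]
    by_contra hcon
    push Not at hcon
    have hIp : 0 < Iu := by
      by_contra hh
      push Not at hh
      nlinarith [Real.pi_pos]
    have := key (D / Iu + 1) (by positivity) (by rw [← h0, mul_zero]; exact Real.pi_pos)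
    have e : 2 * (D / Iu + 1) * Iu = 2 * D + 2 * Iu := by field_simp
    linarith
  · have hlim : Filter.Tendsto (fun κ => 2 * κ * Iu) (nhdsWithin (Real.pi / m) (Set.Iio (Real.pi / m)))
        (nhds (2 * (Real.pi / m) * Iu)) :=
      ((by fun_prop : Continuous fun κ => 2 * κ * Iu).tendsto _).mono_left nhdsWithin_le_nhds
    have hle : 2 * (Real.pi / m) * Iu ≤ D := by
      refine le_of_tendsto hlim ?_
      have : Set.Ioo 0 (Real.pi / m) ∈ nhdsWithin (Real.pi / m) (Set.Iio (Real.pi / m)) :=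
        Ioo_mem_nhdsLT (by positivity)
      filter_upwards [this] with κ hκ
      exact key κ hκ.1 ((lt_div_iff₀ hpos).1 hκ.2)
    have e : 2 * Real.pi * Iu = m * (2 * (Real.pi / m) * Iu) := by field_simp
    rw [e]
    exact mul_le_mul_of_nonneg_left hle hm0
end

/-- the set where `|e^s sin t| < 1` is small -/
lemma overlap_small (s : ℝ) :
    ∫ t in (0:ℝ)..(2 * Real.pi), {t | |Real.exp s * Real.sin t| < 1}.indicator (fun _ => (1:ℝ)) t
      ≤ 2 * Real.pi * Real.exp (-s) := by
  have h2pi : (0:ℝ) ≤ 2 * Real.pi := by positivity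
  have hpi := Real.pi_pos
  set O : Set ℝ := {t | |Real.exp s * Real.sin t| < 1} with hO
  have hOm : MeasurableSet O := (isOpen_lt (by fun_prop) continuous_const).measurableSet
  set c := Real.pi / 2 * Real.exp (-s) with hc
  have hc0 : 0 < c := by positivity
  have sinb : ∀ t, 0 ≤ t → t ≤ Real.pi / 2 → |Real.exp s * Real.sin t| < 1 → t ≤ c := by
    intro t h0 h1 h2
    have h3 := Real.mul_le_sin h0 h1
    have h4 := (abs_lt.1 h2).2
    have h5 : Real.exp s * (2 / Real.pi * t) < 1 :=
      lt_of_le_of_lt (mul_le_mul_of_nonneg_left h3 (Real.exp_pos s).le) h4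
    have h6 : t = c * (Real.exp s * (2 / Real.pi * t)) := by
      rw [hc, Real.exp_neg]; field_simp
    rw [h6]
    nlinarith
  have hsub : Set.Ioc 0 (2 * Real.pi) ∩ O ⊆ Set.Icc 0 c ∪
      (Set.Icc (Real.pi - c) (Real.pi + c) ∪ Set.Icc (2 * Real.pi - c) (2 * Real.pi)) := by
    rintro t ⟨ht, htO⟩
    have htO : |Real.exp s * Real.sin t| < 1 := htO
    rcases le_total t (Real.pi / 2) with h1 | h1
    · left; exact ⟨ht.1.le, sinb t ht.1.le h1 htO⟩
    right
    rcases le_total t Real.pi with h2 | h2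
    · left
      have := sinb (Real.pi - t) (by linarith) (by linarith) (by rwa [Real.sin_pi_sub])
      constructor <;> linarith
    rcases le_total t (3 * Real.pi / 2) with h3 | h3
    · left
      have := sinb (t - Real.pi) (by linarith) (by linarith)
        (by rw [Real.sin_sub_pi, mul_neg, abs_neg]; exact htO)
      constructor <;> linarith
    · right
      have := sinb (2 * Real.pi - t) (by linarith [ht.2]) (by linarith)
        (by rw [Real.sin_two_pi_sub, mul_neg, abs_neg]; exact htO)
      constructor <;> linarith [ht.2]
  rw [intervalIntegral.integral_of_le h2pi, integral_indicator hOm,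
    Measure.restrict_restrict hOm, Set.inter_comm]
  simp only [integral_const, smul_eq_mul, mul_one, measureReal_restrict_apply_univ]
  refine (measureReal_mono hsub ?_).trans ?_
  · exact (measure_union_lt_top (by simp) (measure_union_lt_top (by simp) (by simp))).ne
  refine (measureReal_union_le _ _).trans ?_
  have := measureReal_union_le (μ := volume) (Set.Icc (Real.pi - c) (Real.pi + c))
    (Set.Icc (2 * Real.pi - c) (2 * Real.pi))
  simp only [Real.volume_real_Icc] at this ⊢
  rw [max_eq_left (by linarith)] at this ⊢
  rw [max_eq_left (by linarith)] at this
  have e : 2 * Real.pi * Real.exp (-s) = 4 * c := by rw [hc]; ring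
  linarith

end CS

namespace CS

lemma norm_exp_st (s t : ℝ) : ‖Complex.exp (s + t * I)‖ = Real.exp s := by
  rw [Complex.norm_exp]; simp

lemma exists_st (z : ℂ) (hz : z ≠ 0) :
    ∃ s t : ℝ, t ∈ Set.Icc 0 (2 * Real.pi) ∧ Complex.exp (s + t * I) = z := by
  have hpi := Real.pi_pos
  have h0 : Complex.exp (Real.log ‖z‖ + arg z * I) = z := by
    rw [Complex.exp_add, ← Complex.ofReal_exp, Real.exp_log (norm_pos_iff.2 hz)]
    exact Complex.norm_mul_exp_arg_mul_I z
  rcases le_or_gt 0 (arg z) with h | h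
  · exact ⟨Real.log ‖z‖, arg z, ⟨h, by linarith [arg_le_pi z]⟩, h0⟩
  · refine ⟨Real.log ‖z‖, arg z + 2 * Real.pi, ⟨by linarith [neg_pi_lt_arg z], by linarith⟩, ?_⟩
    refine Eq.trans ?_ h0
    rw [← Complex.exp_periodic (Real.log ‖z‖ + arg z * I)]
    congr 1
    push_cast
    ring

section
variable {f : ℂ → ℂ} {us ut uss utt : ℝ → ℝ → ℝ}

lemma bounded_of_I (h0 : ‖f 0‖ < 1) (hf : Continuous f)
    (h : Sub (fun s t => Psi (normSq (f (Complex.exp (s + t * I))))) us ut uss utt)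
    (hI : ∀ s : ℝ, (∫ t in (0:ℝ)..(2 * Real.pi),
      Psi (normSq (f (Complex.exp (s + t * I)))) * us s t) ≤ 0) (z : ℂ) : ‖f z‖ ≤ 1 := by
  have h2pi : (0:ℝ) < 2 * Real.pi := by positivity
  by_cases hz : z = 0
  · rw [hz]; exact h0.le
  have anti : Antitone (fun s : ℝ => ∫ t in (0:ℝ)..(2 * Real.pi),
      Psi (normSq (f (Complex.exp (s + t * I)))) ^ 2) := by
    refine antitone_of_hasDerivAt_nonpos (fun s => h.derivA s) fun s => ?_
    rw [intervalIntegral.integral_const_mul]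
    have := hI s
    simp only [Pi.zero_apply] at *
    linarith
  obtain ⟨δ, hδ, hδ'⟩ : ∃ δ > 0, ∀ w, ‖w‖ < δ → ‖f w‖ < 1 := by
    have : {w | ‖f w‖ < 1} ∈ nhds (0:ℂ) :=
      (isOpen_lt (by fun_prop) continuous_const).mem_nhds h0
    obtain ⟨δ, hδ, hs⟩ := Metric.mem_nhds_iff.1 this
    exact ⟨δ, hδ, fun w hw => hs (by simpa using hw)⟩
  obtain ⟨s, t, ht, hst⟩ := exists_st z hz
  have hA : (∫ t in (0:ℝ)..(2 * Real.pi),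
      Psi (normSq (f (Complex.exp (s + t * I)))) ^ 2) ≤ 0 := by
    refine (anti (min_le_left s (Real.log δ - 1))).trans (le_of_eq ?_)
    beta_reduce
    rw [intervalIntegral.integral_congr (g := fun _ => (0:ℝ))]
    · simp
    intro x _
    have : ‖f (Complex.exp ((min s (Real.log δ - 1) : ℝ) + x * I))‖ < 1 := by
      apply hδ'
      rw [norm_exp_st]
      calc Real.exp (min s (Real.log δ - 1)) ≤ Real.exp (Real.log δ - 1) :=
            Real.exp_le_exp.2 (min_le_right _ _)
        _ < Real.exp (Real.log δ) := Real.exp_lt_exp.2 (by linarith)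
        _ = δ := Real.exp_log hδ
    simp only
    rw [psi_of_le]
    · simp
    · rw [normSq_eq_norm_sq]
      exact pow_le_one₀ (norm_nonneg _) this.le
  by_contra hcon
  push Not at hcon
  have : 0 < ∫ t in (0:ℝ)..(2 * Real.pi),
      Psi (normSq (f (Complex.exp (s + t * I)))) ^ 2 := by
    refine intervalIntegral.integral_pos h2pi ?_ (fun _ _ => sq_nonneg _) ⟨t, ht, ?_⟩
    · exact ((h.cs s).1.pow 2).continuousOn
    · rw [hst]
      refine pow_pos (psi_pos ?_) 2
      rw [normSq_eq_norm_sq]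
      exact one_lt_pow₀ hcon two_ne_zero
  linarith

lemma I_upper (h : Sub (fun s t => Psi (normSq (f (Complex.exp (s + t * I))))) us ut uss utt)
    (c k : ℝ) (hc : 1 ≤ c) (hk : 0 ≤ k) (hg : ∀ z, ‖f z‖ ≤ c * Real.exp (k * ‖z‖)) (s : ℝ) :
    (∫ t in (0:ℝ)..(2 * Real.pi), Psi (normSq (f (Complex.exp (s + t * I)))) * us s t) ≤
      Real.pi * (2 * k * Real.exp (s + 1) + 2 * Real.log c) ^ 2 := by
  have h2pi : (0:ℝ) < 2 * Real.pi := by positivity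
  set A := fun s : ℝ => ∫ t in (0:ℝ)..(2 * Real.pi),
      Psi (normSq (f (Complex.exp (s + t * I)))) ^ 2 with hA
  set Iu := fun s : ℝ => ∫ t in (0:ℝ)..(2 * Real.pi),
      Psi (normSq (f (Complex.exp (s + t * I)))) * us s t with hIu
  have hmono : Monotone Iu := h.I_mono
  have hd : ∀ s, HasDerivAt A (2 * Iu s) s := by
    intro s
    have := h.derivA s
    rwa [intervalIntegral.integral_const_mul] at this
  have h1 : 2 * Iu s * ((s + 1) - s) ≤ A (s + 1) - A s := by
    refine Convex.mul_sub_le_image_sub_of_le_deriv (convex_Icc s (s+1))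
      (fun x _ => (hd x).continuousAt.continuousWithinAt)
      (fun x _ => (hd x).differentiableAt.differentiableWithinAt)
      ?_ s ⟨le_rfl, by linarith⟩ (s+1) ⟨by linarith, le_rfl⟩ (by linarith)
    intro x hx
    rw [(hd x).deriv]
    rw [interior_Icc] at hx
    have := hmono hx.1.le
    linarith
  have h2 : 0 ≤ A s := intervalIntegral.integral_nonneg h2pi.le fun _ _ => sq_nonneg _
  have hlc : 0 ≤ Real.log c := Real.log_nonneg hc
  have h3 : A (s + 1) ≤ ∫ t in (0:ℝ)..(2 * Real.pi),
      (2 * k * Real.exp (s + 1) + 2 * Real.log c) ^ 2 := by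
    refine intervalIntegral.integral_mono_on h2pi.le
      (((h.cs (s+1)).1.pow 2).intervalIntegrable _ _) (by simp) fun t _ => ?_
    refine pow_le_pow_left₀ (psi_nonneg _) ?_ 2
    set w := f (Complex.exp (((s + 1 : ℝ) : ℂ) + t * I)) with hw
    rcases le_or_gt (normSq w) 1 with h1 | h1
    · rw [psi_of_le h1]; positivity
    · refine (psi_le_log h1.le).trans ?_
      have hgw := hg (Complex.exp (((s + 1 : ℝ) : ℂ) + t * I))
      rw [norm_exp_st, ← hw] at hgw
      have hw0 : 0 < ‖w‖ := by
        rw [norm_pos_iff]; intro h; rw [h] at h1; simp at h1; linarith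
      rw [normSq_eq_norm_sq, Real.log_pow]
      have := Real.log_le_log hw0 hgw
      rw [Real.log_mul (by linarith) (Real.exp_pos _).ne', Real.log_exp] at this
      push_cast
      linarith
  rw [intervalIntegral.integral_const, smul_eq_mul] at h3
  have : 2 * Iu s ≤ (2 * Real.pi - 0) * (2 * k * Real.exp (s + 1) + 2 * Real.log c) ^ 2 := by
    linarith
  show Iu s ≤ _
  linarith
end

section
variable {u us ut uss utt v vs vt vss vtt : ℝ → ℝ → ℝ}

lemma mPos_add (hu : Sub u us ut uss utt) (hv : Sub v vs vt vss vtt) (s : ℝ)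
    (hov : ∀ t, 0 < u s t → 0 < v s t → |Real.exp s * Real.sin t| < 1) :
    mPos u s + mPos v s ≤ 2 * Real.pi + 2 * Real.pi * Real.exp (-s) := by
  have h2pi : (0:ℝ) ≤ 2 * Real.pi := by positivity
  have hOm : MeasurableSet {t : ℝ | |Real.exp s * Real.sin t| < 1} :=
    (isOpen_lt (by fun_prop) continuous_const).measurableSet
  have h1 : mPos u s + mPos v s ≤ ∫ t in (0:ℝ)..(2 * Real.pi),
      ((1:ℝ) + {t | |Real.exp s * Real.sin t| < 1}.indicator (fun _ => (1:ℝ)) t) := by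
    unfold mPos
    rw [← intervalIntegral.integral_add (ind_ii (hu.msble s) _ _) (ind_ii (hv.msble s) _ _)]
    refine intervalIntegral.integral_mono_on h2pi
      ((ind_ii (hu.msble s) _ _).add (ind_ii (hv.msble s) _ _))
      ((by simp : IntervalIntegrable (fun _ => (1:ℝ)) volume 0 (2 * Real.pi)).add
        (ind_ii hOm _ _)) fun t _ => ?_
    have := hov t
    simp only [Set.indicator, Set.mem_ofPred_eq]
    split_ifs <;> first | (exfalso; tauto) | norm_num
  rw [intervalIntegral.integral_add (by simp) (ind_ii hOm _ _)] at h1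
  have := overlap_small s
  simp only [intervalIntegral.integral_const, smul_eq_mul] at h1
  linarith

lemma mPos_full (s : ℝ) (hnz : ∀ t, 0 < u s t) : mPos u s = 2 * Real.pi := by
  unfold mPos
  have : {x | 0 < u s x} = Set.univ := Set.eq_univ_of_forall hnz
  rw [this]; simp

lemma mPos_pos_of_I (hu : Sub u us ut uss utt) (s : ℝ) (hz : ∃ t, u s t = 0)
    (hI : 0 < ∫ t in (0:ℝ)..(2 * Real.pi), u s t * us s t) :
    0 < mPos u s ∧ 2 * Real.pi / mPos u s ≤
    (∫ t in (0:ℝ)..(2 * Real.pi), (us s t ^ 2 + u s t * uss s t)) /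
      ∫ t in (0:ℝ)..(2 * Real.pi), u s t * us s t := by
  have h := hu.mPos_I s hz
  have hm : 0 < mPos u s := by
    rcases (mPos_nonneg (u := u) s).eq_or_lt with h0 | h0
    · rw [← h0, zero_mul] at h
      have := Real.pi_pos
      nlinarith
    · exact h0
  refine ⟨hm, ?_⟩
  rw [div_le_div_iff₀ hm hI]
  linarith

/-- the key differential inequality -/
lemma deriv_ineq (hu : Sub u us ut uss utt) (hv : Sub v vs vt vss vtt) (s : ℝ) (hs : 0 < s)
    (hov : ∀ t, 0 < u s t → 0 < v s t → |Real.exp s * Real.sin t| < 1)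
    (hI : 0 < ∫ t in (0:ℝ)..(2 * Real.pi), u s t * us s t)
    (hJ : 0 < ∫ t in (0:ℝ)..(2 * Real.pi), v s t * vs s t) :
    4 - 4 * Real.exp (-s) ≤
    (∫ t in (0:ℝ)..(2 * Real.pi), (us s t ^ 2 + u s t * uss s t)) /
      (∫ t in (0:ℝ)..(2 * Real.pi), u s t * us s t) +
    (∫ t in (0:ℝ)..(2 * Real.pi), (vs s t ^ 2 + v s t * vss s t)) /
      (∫ t in (0:ℝ)..(2 * Real.pi), v s t * vs s t) := by
  have hpi := Real.pi_pos
  have hadd := mPos_add hu hv s hov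
  have he1 : Real.exp (-s) < 1 := by rw [Real.exp_lt_one_iff]; linarith
  have he0 := Real.exp_pos (-s)
  set e := Real.exp (-s)
  have small : ∀ x : ℝ, 0 < x → x ≤ 2 * Real.pi * e → 4 - 4 * e ≤ 2 * Real.pi / x := by
    intro x hx hxe
    rw [le_div_iff₀ hx]
    have : (4 - 4 * e) * x ≤ (4 - 4 * e) * (2 * Real.pi * e) :=
      mul_le_mul_of_nonneg_left hxe (by linarith)
    nlinarith [mul_nonneg hpi.le (sq_nonneg (2 * e - 1))]
  have hDu := div_nonneg (hu.D_nonneg s) hI.le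
  have hDv := div_nonneg (hv.D_nonneg s) hJ.le
  by_cases zu : ∃ t, u s t = 0
  · obtain ⟨mu, ru⟩ := mPos_pos_of_I hu s zu hI
    by_cases zv : ∃ t, v s t = 0
    · obtain ⟨mv, rv⟩ := mPos_pos_of_I hv s zv hJ
      refine le_trans ?_ (add_le_add ru rv)
      set p := mPos u s
      set q := mPos v s
      rw [div_add_div _ _ mu.ne' mv.ne', le_div_iff₀ (by positivity)]
      have h1 : (4 - 4 * e) * (p + q) ≤ 8 * Real.pi := by
        have : (4 - 4 * e) * (p + q) ≤ (4 - 4 * e) * (2 * Real.pi + 2 * Real.pi * e) :=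
          mul_le_mul_of_nonneg_left hadd (by linarith)
        nlinarith [mul_nonneg hpi.le (sq_nonneg e)]
      have h2 : 4 * (p * q) ≤ (p + q) * (p + q) := by nlinarith [sq_nonneg (p - q)]
      have h3 : (4 - 4 * e) * (4 * (p * q)) ≤ (4 - 4 * e) * ((p + q) * (p + q)) :=
        mul_le_mul_of_nonneg_left h2 (by linarith)
      have h4 : (4 - 4 * e) * (p + q) * (p + q) ≤ 8 * Real.pi * (p + q) :=
        mul_le_mul_of_nonneg_right h1 (by linarith)
      nlinarith
    · have fv : mPos v s = 2 * Real.pi := mPos_full s fun t =>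
        lt_of_le_of_ne (hv.nn s t) fun h => zv ⟨t, h.symm⟩
      have := small (mPos u s) mu (by linarith)
      linarith
  · have fu : mPos u s = 2 * Real.pi := mPos_full s fun t =>
      lt_of_le_of_ne (hu.nn s t) fun h => zu ⟨t, h.symm⟩
    have zv : ∃ t, v s t = 0 := by
      by_contra zv
      have fv : mPos v s = 2 * Real.pi := mPos_full s fun t =>
        lt_of_le_of_ne (hv.nn s t) fun h => zv ⟨t, h.symm⟩
      nlinarith
    obtain ⟨mv, rv⟩ := mPos_pos_of_I hv s zv hJ
    have := small (mPos v s) mv (by linarith)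
    linarith
end

lemma heins_core (f h : ℂ → ℂ) (hf : Differentiable ℂ f) (hh : Differentiable ℂ h)
    (hf0 : ‖f 0‖ < 1) (hh0 : ‖h 0‖ < 1)
    (hmin : ∀ z : ℂ, 1 ≤ |z.im| → ‖f z‖ ≤ 1 ∨ ‖h z‖ ≤ 1)
    (hgf : ∀ ε > 0, ∃ c, ∀ z, ‖f z‖ ≤ c * Real.exp (ε * ‖z‖))
    (hgh : ∃ c k, ∀ z, ‖h z‖ ≤ c * Real.exp (k * ‖z‖)) :
    (∀ z, ‖f z‖ ≤ 1) ∨ (∀ z, ‖h z‖ ≤ 1) := by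
  by_contra hcon
  push Not at hcon
  obtain ⟨⟨zf, hzf⟩, ⟨zh, hzh⟩⟩ := hcon
  obtain ⟨us, ut, uss, utt, hu⟩ := exists_sub f hf
  obtain ⟨vs, vt, vss, vtt, hv⟩ := exists_sub h hh
  obtain ⟨s1, hs1⟩ : ∃ s : ℝ, 0 < ∫ t in (0:ℝ)..(2 * Real.pi),
      Psi (normSq (f (Complex.exp (s + t * I)))) * us s t := by
    by_contra hc; push Not at hc
    exact absurd (bounded_of_I hf0 hf.continuous hu hc zf) (not_le.2 hzf)
  obtain ⟨s2, hs2⟩ : ∃ s : ℝ, 0 < ∫ t in (0:ℝ)..(2 * Real.pi),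
      Psi (normSq (h (Complex.exp (s + t * I)))) * vs s t := by
    by_contra hc; push Not at hc
    exact absurd (bounded_of_I hh0 hh.continuous hv hc zh) (not_le.2 hzh)
  have mI := hu.I_mono
  have mJ := hv.I_mono
  have dI := hu.derivI
  have dJ := hv.derivI
  have dine := fun s hs hov => deriv_ineq hu hv s hs hov
  have upI := fun c k hc hk hg => I_upper hu c k hc hk hg
  have upJ := fun c k hc hk hg => I_upper hv c k hc hk hg
  set Iu := fun s : ℝ => ∫ t in (0:ℝ)..(2 * Real.pi),
      Psi (normSq (f (Complex.exp (s + t * I)))) * us s t with hIu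
  set Jv := fun s : ℝ => ∫ t in (0:ℝ)..(2 * Real.pi),
      Psi (normSq (h (Complex.exp (s + t * I)))) * vs s t with hJv
  set s0 := max (max s1 s2) 1 with hs0
  have hIp : ∀ s, s0 ≤ s → 0 < Iu s := fun s hs =>
    lt_of_lt_of_le hs1 (mI (le_trans (le_trans (le_max_left _ _) (le_max_left _ _)) hs))
  have hJp : ∀ s, s0 ≤ s → 0 < Jv s := fun s hs =>
    lt_of_lt_of_le hs2 (mJ (le_trans (le_trans (le_max_right _ _) (le_max_left _ _)) hs))
  have hs0' : 1 ≤ s0 := le_max_right _ _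
  have hov : ∀ s t : ℝ, 0 < Psi (normSq (f (Complex.exp (s + t * I)))) →
      0 < Psi (normSq (h (Complex.exp (s + t * I)))) → |Real.exp s * Real.sin t| < 1 := by
    intro s t h1 h2
    by_contra hc
    push Not at hc
    have him : (Complex.exp (s + t * I)).im = Real.exp s * Real.sin t := by
      rw [Complex.exp_im]; simp
    have key : ∀ w : ℂ, ‖w‖ ≤ 1 → Psi (normSq w) = 0 := fun w hw => psi_of_le (by
      rw [normSq_eq_norm_sq]; exact pow_le_one₀ (norm_nonneg _) hw)
    rcases hmin (Complex.exp (s + t * I)) (by rw [him]; exact hc) with h3 | h3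
    · rw [key _ h3] at h1; exact lt_irrefl _ h1
    · rw [key _ h3] at h2; exact lt_irrefl _ h2
  set G := fun s : ℝ => Real.log (Iu s) + Real.log (Jv s) - 4 * s - 4 * Real.exp (-s) with hG
  have dG : ∀ s, s0 ≤ s → HasDerivAt G
      ((∫ t in (0:ℝ)..(2 * Real.pi), (us s t ^ 2 +
        Psi (normSq (f (Complex.exp (s + t * I)))) * uss s t)) / Iu s +
      (∫ t in (0:ℝ)..(2 * Real.pi), (vs s t ^ 2 +
        Psi (normSq (h (Complex.exp (s + t * I)))) * vss s t)) / Jv s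
        - 4 - 4 * (Real.exp (-s) * (-1))) s := by
    intro s hs
    have h1 := (dI s).log (hIp s hs).ne'
    have h2 := (dJ s).log (hJp s hs).ne'
    have h3 : HasDerivAt (fun s : ℝ => 4 * s) 4 s := by
      simpa using (hasDerivAt_id s).const_mul (4:ℝ)
    have h4 : HasDerivAt (fun s : ℝ => 4 * Real.exp (-s)) (4 * (Real.exp (-s) * (-1))) s :=
      ((hasDerivAt_neg s).exp).const_mul 4
    exact ((h1.add h2).sub h3).sub h4
  have Gmono : MonotoneOn G (Set.Ici s0) := by
    refine monotoneOn_of_deriv_nonneg (convex_Ici s0)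
      (fun s hs => (dG s hs).continuousAt.continuousWithinAt)
      (fun s hs => (dG s (interior_subset hs)).differentiableAt.differentiableWithinAt) ?_
    intro s hs
    have hs := interior_subset hs
    rw [(dG s hs).deriv]
    have := dine s (by have : s0 ≤ s := hs; linarith) (hov s) (hIp s hs) (hJp s hs)
    have : 4 - 4 * Real.exp (-s) ≤ _ := this
    linarith
  -- lower bound
  have lower : ∀ s, s0 ≤ s → Real.exp (G s0) * Real.exp s ^ 4 ≤ Iu s * Jv s := by
    intro s hs
    have h1 := Gmono (Set.self_mem_Ici) hs hs
    have h2 : G s0 + 4 * s ≤ Real.log (Iu s * Jv s) := by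
      rw [Real.log_mul (hIp s hs).ne' (hJp s hs).ne']
      have h3 : G s = Real.log (Iu s) + Real.log (Jv s) - 4 * s - 4 * Real.exp (-s) := rfl
      have := Real.exp_pos (-s)
      linarith
    have h3 := Real.exp_le_exp.2 h2
    rw [Real.exp_log (mul_pos (hIp s hs) (hJp s hs)), Real.exp_add] at h3
    have e : Real.exp (4 * s) = Real.exp s ^ 4 := by rw [← Real.exp_nat_mul]; norm_num
    rwa [e] at h3
  obtain ⟨c, k, hck⟩ := hgh
  have norm_c : ∀ (g : ℂ → ℂ) (c k : ℝ), (∀ z, ‖g z‖ ≤ c * Real.exp (k * ‖z‖)) →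
      ∀ z, ‖g z‖ ≤ max c 1 * Real.exp (max k 0 * ‖z‖) := by
    intro g c k hg z
    refine (hg z).trans ?_
    have h1 : Real.exp (k * ‖z‖) ≤ Real.exp (max k 0 * ‖z‖) :=
      Real.exp_le_exp.2 (mul_le_mul_of_nonneg_right (le_max_left _ _) (norm_nonneg z))
    exact mul_le_mul (le_max_left _ _) h1 (Real.exp_pos _).le (by positivity)
  set K := Real.pi * (2 * max k 0 * Real.exp 1 + 2 * Real.log (max c 1)) ^ 2 with hK
  have hK0 : 0 ≤ K := by positivity
  have hJup : ∀ s, 0 ≤ s → Jv s ≤ K * Real.exp s ^ 2 := by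
    intro s hs
    refine (upJ _ _ (le_max_right c 1) (le_max_right k 0) (norm_c h c k hck) s).trans ?_
    rw [hK, mul_assoc Real.pi, ← mul_pow]
    refine mul_le_mul_of_nonneg_left ?_ Real.pi_pos.le
    have h1 : 0 ≤ Real.log (max c 1) := Real.log_nonneg (le_max_right _ _)
    refine pow_le_pow_left₀ (by positivity) ?_ 2
    rw [Real.exp_add]
    have := Real.one_le_exp hs
    nlinarith
  set M := 16 * Real.pi * Real.exp 1 ^ 2 * K + 1 with hM
  have hM0 : 0 < M := by positivity
  set c0 := Real.exp (G s0) with hc0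
  have hc0p : 0 < c0 := Real.exp_pos _
  set ε := Real.sqrt (c0 / (2 * M)) with hε
  have hεp : 0 < ε := Real.sqrt_pos.2 (by positivity)
  have hε2 : ε ^ 2 * M = c0 / 2 := by
    rw [hε, Real.sq_sqrt (by positivity)]; field_simp
  obtain ⟨c', hc'⟩ := hgf ε hεp
  have hc'' := norm_c f c' ε hc'
  rw [max_eq_left hεp.le] at hc''
  obtain ⟨s, hs, hsl⟩ : ∃ s, s0 ≤ s ∧ Real.log (max c' 1) ≤ ε * Real.exp (s + 1) := by
    have : Filter.Tendsto (fun s => ε * Real.exp (s + 1)) Filter.atTop Filter.atTop :=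
      (Real.tendsto_exp_atTop.comp (Filter.tendsto_atTop_add_const_right _ 1
        Filter.tendsto_id)).const_mul_atTop hεp
    obtain ⟨s, h1, h2⟩ := ((Filter.eventually_ge_atTop s0).and
      (this.eventually_ge_atTop (Real.log (max c' 1)))).exists
    exact ⟨s, h1, h2⟩
  have hlog : 0 ≤ Real.log (max c' 1) := Real.log_nonneg (le_max_right _ _)
  have hI1 : Iu s ≤ Real.pi * (4 * ε * Real.exp (s + 1)) ^ 2 := by
    refine (upI _ _ (le_max_right c' 1) hεp.le hc'' s).trans ?_
    refine mul_le_mul_of_nonneg_left ?_ Real.pi_pos.le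
    refine pow_le_pow_left₀ (by positivity) ?_ 2
    linarith
  have hJ1 := hJup s (by linarith)
  have hl := lower s hs
  have hprod : Iu s * Jv s ≤ Real.pi * (4 * ε * Real.exp (s + 1)) ^ 2 * (K * Real.exp s ^ 2) :=
    mul_le_mul hI1 hJ1 (hJp s hs).le (by positivity)
  have he : Real.pi * (4 * ε * Real.exp (s + 1)) ^ 2 * (K * Real.exp s ^ 2) =
      (ε ^ 2 * (M - 1)) * Real.exp s ^ 4 := by
    rw [Real.exp_add, hM]; ring
  rw [he] at hprod
  have h4 : 0 < Real.exp s ^ 4 := by positivity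
  have : c0 ≤ ε ^ 2 * (M - 1) := le_of_mul_le_mul_right (hl.trans hprod) h4
  nlinarith [sq_nonneg ε]

/-- Heins type theorem -/
theorem heins (f h : ℂ → ℂ) (hf : Differentiable ℂ f) (hh : Differentiable ℂ h) (C : ℝ)
    (hmin : ∀ z : ℂ, 1 ≤ |z.im| → ‖f z‖ ≤ C ∨ ‖h z‖ ≤ C)
    (hgf : ∀ ε > 0, ∃ c, ∀ z, ‖f z‖ ≤ c * Real.exp (ε * ‖z‖))
    (hgh : ∃ c k, ∀ z, ‖h z‖ ≤ c * Real.exp (k * ‖z‖)) :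
    (∀ z, f z = f 0) ∨ (∀ z, h z = h 0) := by
  set N := |C| + ‖f 0‖ + ‖h 0‖ + 1 with hN
  have hN0 : 0 < N := by positivity
  have nrm : ∀ w : ℂ, ‖w / (N : ℂ)‖ = ‖w‖ / N := fun w => by
    rw [norm_div, Complex.norm_real, Real.norm_eq_abs, abs_of_pos hN0]
  have hNC : C ≤ N := by
    have := le_abs_self C; have := norm_nonneg (f 0); have := norm_nonneg (h 0); linarith
  have liou : ∀ g : ℂ → ℂ, Differentiable ℂ g → (∀ z, ‖g z / (N:ℂ)‖ ≤ 1) → ∀ z, g z = g 0 := by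
    intro g hg hb z
    refine hg.apply_eq_apply_of_bounded ?_ z 0
    rw [isBounded_iff_forall_norm_le]
    refine ⟨N, ?_⟩
    rintro _ ⟨w, rfl⟩
    have := hb w
    rw [nrm, div_le_one hN0] at this
    exact this
  have := heins_core (fun z => f z / (N:ℂ)) (fun z => h z / (N:ℂ)) (hf.div_const _)
    (hh.div_const _)
    (by rw [nrm, div_lt_one hN0]; have := abs_nonneg C; have := norm_nonneg (h 0); linarith)
    (by rw [nrm, div_lt_one hN0]; have := abs_nonneg C; have := norm_nonneg (f 0); linarith)
    (by
      intro z hz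
      simp only [nrm, div_le_one hN0]
      exact (hmin z hz).imp (fun h => h.trans hNC) (fun h => h.trans hNC))
    (by
      intro ε hε
      obtain ⟨c, hc⟩ := hgf ε hε
      refine ⟨c / N, fun z => ?_⟩
      rw [nrm, div_mul_eq_mul_div]
      exact div_le_div_of_nonneg_right (hc z) hN0.le)
    (by
      obtain ⟨c, k, hc⟩ := hgh
      refine ⟨c / N, k, fun z => ?_⟩
      rw [nrm, div_mul_eq_mul_div]
      exact div_le_div_of_nonneg_right (hc z) hN0.le)
  exact this.imp (liou f hf) (liou h hh)
end CS

namespace CS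

lemma isBigO_exp_mul (f : ℂ → ℂ) (c k : ℝ) (hg : ∀ z, ‖f z‖ ≤ c * Real.exp (k * ‖z‖)) (a : ℂ)
    (S : Set ℂ) :
    ∃ c < (2 : ℝ), ∃ B, (fun z => f z * Complex.exp (a * z)) =O[Bornology.cobounded ℂ ⊓
      Filter.principal S] fun z => Real.exp (B * ‖z‖ ^ c) := by
  refine ⟨1, by norm_num, k + ‖a‖, ?_⟩
  refine Asymptotics.IsBigO.of_bound c (Filter.Eventually.of_forall fun z => ?_)
  rw [norm_mul, Real.rpow_one, Real.norm_eq_abs, abs_of_pos (Real.exp_pos _), add_mul, Real.exp_add,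
    ← mul_assoc]
  refine mul_le_mul (hg z) ?_ (norm_nonneg _) ((norm_nonneg _).trans (hg z))
  rw [Complex.norm_exp]
  exact Real.exp_le_exp.2 ((Complex.re_le_norm _).trans (norm_mul _ _).le)

lemma pl_quadrant (f : ℂ → ℂ) (hf : Differentiable ℂ f) (c k : ℝ)
    (hg : ∀ z, ‖f z‖ ≤ c * Real.exp (k * ‖z‖)) (ε C : ℝ) (hε : 0 ≤ ε)
    (h1 : ∀ x : ℝ, 0 ≤ x → ‖f x‖ ≤ C * Real.exp (ε * x))
    (h2 : ∀ x : ℝ, 0 ≤ x → ‖f (x * I)‖ ≤ C * Real.exp (ε * x)) (z : ℂ) (hr : 0 ≤ z.re)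
    (hi : 0 ≤ z.im) : ‖f z‖ ≤ C * Real.exp (2 * ε * ‖z‖) := by
  set a : ℂ := -ε + ε * I with ha
  have hnorm : ∀ z : ℂ, ‖Complex.exp (a * z)‖ = Real.exp (-(ε * (z.re + z.im))) := by
    intro z; rw [Complex.norm_exp]; congr 1; simp [ha]; ring
  have hC : 0 ≤ C := by
    have := (norm_nonneg _).trans (h1 0 le_rfl)
    simpa using this
  have key := PhragmenLindelof.quadrant_I (f := fun z => f z * Complex.exp (a * z)) (C := C) (z := z)
    (Differentiable.diffContOnCl (by fun_prop)) (isBigO_exp_mul f c k hg a _) (by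
      intro x hx
      rw [norm_mul, hnorm]
      have := mul_le_mul_of_nonneg_right (h1 x hx) (Real.exp_pos (-(ε * ((x:ℂ).re + (x:ℂ).im)))).le
      refine this.trans (le_of_eq ?_)
      rw [mul_assoc, ← Real.exp_add]; simp) (by
      intro x hx
      rw [norm_mul, hnorm]
      have := mul_le_mul_of_nonneg_right (h2 x hx)
        (Real.exp_pos (-(ε * ((x * I:ℂ).re + (x*I:ℂ).im)))).le
      refine this.trans (le_of_eq ?_)
      rw [mul_assoc, ← Real.exp_add]; simp) hr hi
  rw [norm_mul, hnorm, Real.exp_neg, ← div_eq_mul_inv, div_le_iff₀ (Real.exp_pos _)] at key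
  refine key.trans (mul_le_mul_of_nonneg_left (Real.exp_le_exp.2 ?_) hC)
  have := Complex.re_le_norm z
  have := Complex.im_le_norm z
  nlinarith

theorem pl_zero_type (f : ℂ → ℂ) (hf : Differentiable ℂ f) (c k : ℝ)
    (hg : ∀ z, ‖f z‖ ≤ c * Real.exp (k * ‖z‖))
    (h1 : ∀ ε > 0, ∃ C, ∀ x : ℝ, ‖f x‖ ≤ C * Real.exp (ε * |x|))
    (h2 : ∀ ε > 0, ∃ C, ∀ x : ℝ, ‖f (x * I)‖ ≤ C * Real.exp (ε * |x|)) :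
    ∀ ε > 0, ∃ C, ∀ z, ‖f z‖ ≤ C * Real.exp (ε * ‖z‖) := by
  intro ε hε
  obtain ⟨C1, hC1⟩ := h1 (ε/2) (by positivity)
  obtain ⟨C2, hC2⟩ := h2 (ε/2) (by positivity)
  set C := max C1 C2
  have a1 : ∀ x : ℝ, ‖f x‖ ≤ C * Real.exp (ε/2 * |x|) := fun x =>
    (hC1 x).trans (mul_le_mul_of_nonneg_right (le_max_left _ _) (Real.exp_pos _).le)
  have a2 : ∀ x : ℝ, ‖f (x * I)‖ ≤ C * Real.exp (ε/2 * |x|) := fun x =>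
    (hC2 x).trans (mul_le_mul_of_nonneg_right (le_max_right _ _) (Real.exp_pos _).le)
  refine ⟨C, fun z => ?_⟩
  have rot : ∀ u : ℂ, ‖u‖ = 1 → (∀ x : ℝ, 0 ≤ x → ‖f (u * x)‖ ≤ C * Real.exp (ε/2 * x)) →
      (∀ x : ℝ, 0 ≤ x → ‖f (u * (x * I))‖ ≤ C * Real.exp (ε/2 * x)) →
      ∀ w : ℂ, 0 ≤ w.re → 0 ≤ w.im → u * w = z → ‖f z‖ ≤ C * Real.exp (ε * ‖z‖) := by
    intro u hu b1 b2 w hw1 hw2 hz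
    have := pl_quadrant (fun w => f (u * w)) (by fun_prop) c k (fun w => by
      have := hg (u * w); rwa [norm_mul, hu, one_mul] at this) (ε/2) C (by positivity) b1 b2 w hw1 hw2
    rw [hz] at this
    rw [← hz, norm_mul, hu, one_mul, hz]
    convert this using 3
    ring
  have ab : ∀ x : ℝ, 0 ≤ x → ‖f x‖ ≤ C * Real.exp (ε/2 * x) := fun x hx => by
    have := a1 x; rwa [abs_of_nonneg hx] at this
  have ab' : ∀ x : ℝ, 0 ≤ x → ‖f (-x)‖ ≤ C * Real.exp (ε/2 * x) := fun x hx => by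
    have := a1 (-x); rw [abs_neg, abs_of_nonneg hx] at this; simpa using this
  have ac : ∀ x : ℝ, 0 ≤ x → ‖f (x * I)‖ ≤ C * Real.exp (ε/2 * x) := fun x hx => by
    have := a2 x; rwa [abs_of_nonneg hx] at this
  have ac' : ∀ x : ℝ, 0 ≤ x → ‖f (-(x * I))‖ ≤ C * Real.exp (ε/2 * x) := fun x hx => by
    have := a2 (-x); rw [abs_neg, abs_of_nonneg hx] at this; simpa using this
  rcases le_total 0 z.re with hr | hr <;> rcases le_total 0 z.im with hi | hi
  · exact rot 1 (by simp) (by simpa using ab) (by simpa using ac) z hr hi (by simp)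
  · refine rot (-I) (by simp) (fun x hx => ?_) (fun x hx => ?_) (I * z) (by simpa using hi)
      (by simpa using hr) (by rw [← mul_assoc]; simp)
    · convert ac' x hx using 3; ring
    · convert ab x hx using 3
      rw [mul_comm (x:ℂ) I, ← mul_assoc]; simp
  · refine rot I (by simp) (fun x hx => ?_) (fun x hx => ?_) (-I * z) (by simpa using hi)
      (by simpa using hr) (by rw [← mul_assoc]; simp)
    · convert ac x hx using 3; ring
    · convert ab' x hx using 3
      rw [mul_comm (x:ℂ) I, ← mul_assoc]; simp
  · refine rot (-1) (by simp) (fun x hx => ?_) (fun x hx => ?_) (-z) (by simpa using hr)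
      (by simpa using hi) (by simp)
    · convert ab' x hx using 3; ring
    · convert ac' x hx using 3; ring

theorem pl_const (f : ℂ → ℂ) (hf : Differentiable ℂ f)
    (hz : ∀ ε > 0, ∃ C, ∀ z, ‖f z‖ ≤ C * Real.exp (ε * ‖z‖)) (C : ℝ)
    (hi : ∀ x : ℝ, ‖f (x * I)‖ ≤ C) (z : ℂ) : f z = f 0 := by
  have half : ∀ g : ℂ → ℂ, Differentiable ℂ g →
      (∀ ε > 0, ∃ C, ∀ z, ‖g z‖ ≤ C * Real.exp (ε * ‖z‖)) → (∀ x : ℝ, ‖g (x * I)‖ ≤ C) →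
      ∀ z : ℂ, 0 ≤ z.re → ‖g z‖ ≤ C := by
    intro g hg hzg hig z hz
    have step : ∀ ε : ℝ, 0 < ε → ‖g z‖ ≤ C * Real.exp (ε * z.re) := by
      intro ε hε
      obtain ⟨c, hc⟩ := hzg (ε/2) (by positivity)
      have hnorm : ∀ z : ℂ, ‖Complex.exp (-ε * z)‖ = Real.exp (-(ε * z.re)) := by
        intro z; rw [Complex.norm_exp]; congr 1; simp
      have := PhragmenLindelof.right_half_plane_of_tendsto_zero_on_real
        (f := fun z => g z * Complex.exp (-ε * z)) (C := C) (z := z)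
        (Differentiable.diffContOnCl (by fun_prop)) (isBigO_exp_mul g c (ε/2) hc _ _) (by
          have hlim : Filter.Tendsto (fun x : ℝ => c * Real.exp (-(ε/2 * x))) Filter.atTop (nhds 0) := by
            rw [← mul_zero c]
            refine Filter.Tendsto.const_mul c (Real.tendsto_exp_neg_atTop_nhds_zero.comp ?_)
            exact Filter.tendsto_id.const_mul_atTop (by positivity)
          refine squeeze_zero_norm' ?_ hlim
          filter_upwards [Filter.eventually_ge_atTop 0] with x hx
          rw [norm_mul, hnorm]
          have := mul_le_mul_of_nonneg_right (hc x) (Real.exp_pos (-(ε * (x:ℂ).re))).le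
          refine this.trans (le_of_eq ?_)
          rw [mul_assoc, ← Real.exp_add, Complex.norm_real, Real.norm_eq_abs, abs_of_nonneg hx]
          congr 2; simp; ring) (by
          intro x
          rw [norm_mul, hnorm]
          simpa using hig x) hz
      rw [norm_mul, hnorm, Real.exp_neg, ← div_eq_mul_inv, div_le_iff₀ (Real.exp_pos _)] at this
      exact this
    have hl : Filter.Tendsto (fun ε : ℝ => C * Real.exp (ε * z.re))
        (nhdsWithin 0 (Set.Ioi 0)) (nhds (C * Real.exp (0 * z.re))) :=
      ((by fun_prop : Continuous fun ε : ℝ => C * Real.exp (ε * z.re)).tendsto 0).mono_left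
        nhdsWithin_le_nhds
    simp only [zero_mul, Real.exp_zero, mul_one] at hl
    exact ge_of_tendsto hl (by filter_upwards [self_mem_nhdsWithin] with ε hε using step ε hε)
  have r := half f hf hz hi
  have l := half (fun z => f (-z)) (by fun_prop) (fun ε hε => by
    obtain ⟨c, hc⟩ := hz ε hε
    exact ⟨c, fun z => by simpa using hc (-z)⟩) (fun x => by simpa using hi (-x))
  refine hf.apply_eq_apply_of_bounded ?_ z 0
  rw [isBounded_iff_forall_norm_le]
  refine ⟨C, ?_⟩
  rintro _ ⟨w, rfl⟩
  rcases le_total 0 w.re with h | h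
  · exact r w h
  · simpa using l (-w) (by simpa using h)
end CS

namespace CS

section PartC
open Filter Topology ContinuousLinearMap
variable {E : Type*} [NormedAddCommGroup E] [InnerProductSpace ℂ E] [CompleteSpace E]

structure CSys (V : E →L[ℂ] E) (e1 e2 : E) : Prop where
  adj : ∀ x, adjoint V x = V x - inner ℂ e2 x • e1 + inner ℂ e1 x • e2
  qn : ∀ z : ℂ, Tendsto (fun n : ℕ => ‖(z • V) ^ n‖) atTop (𝓝 0)
  cyc : ∀ w, (∀ n : ℕ, inner ℂ ((V ^ n) e1) w = 0) → w = 0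
  gro : ∃ τ : ℝ, ∀ g, ∀ ε > 0, ∃ C : ℝ, ∀ z : ℂ,
    ‖Ring.inverse (1 - z • V) g‖ ≤ C * Real.exp (ε * ‖z‖ + τ * |z.im|)

def thv (V : E →L[ℂ] E) (e1 : E) (z : ℂ) : E := Ring.inverse (1 - z • V) e1

def kf (V : E →L[ℂ] E) (e1 : E) (A : Submodule ℂ E) [A.HasOrthogonalProjection] (z : ℂ) : ℝ :=
  ‖A.starProjection (thv V e1 z)‖

structure CSub (V : E →L[ℂ] E) (e1 : E) (A : Submodule ℂ E) [A.HasOrthogonalProjection] : Prop where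
  inv : ∀ x ∈ A, adjoint V x ∈ A
  ne : A.starProjection e1 ≠ 0

lemma isUnit_of_qn (W : E →L[ℂ] E) (h : Tendsto (fun n : ℕ => ‖W ^ n‖) atTop (𝓝 0)) :
    IsUnit (1 - W) := by
  obtain ⟨n, hn⟩ := (h.eventually (gt_mem_nhds (zero_lt_one))).exists
  have h1 : IsUnit (1 - W ^ n) := isUnit_one_sub_of_norm_lt_one hn
  rw [← mul_neg_geom_sum] at h1
  have hc : Commute (1 - W) (∑ i ∈ Finset.range n, W ^ i) := by
    show _ * _ = _ * _
    rw [mul_neg_geom_sum, geom_sum_mul_neg]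
  exact (hc.isUnit_mul_iff.1 h1).1

lemma isUnit_R {V : E →L[ℂ] E} {e1 e2 : E} (h : CSys V e1 e2) (z : ℂ) : IsUnit (1 - z • V) :=
  isUnit_of_qn _ (h.qn z)

lemma R_eq {V : E →L[ℂ] E} {e1 e2 : E} (h : CSys V e1 e2) (z : ℂ) (x : E) :
    Ring.inverse (1 - z • V) x - z • V (Ring.inverse (1 - z • V) x) = x := by
  have := Ring.mul_inverse_cancel _ (isUnit_R h z)
  have := congrArg (fun W : E →L[ℂ] E => W x) this
  simpa using this

lemma star_one_sub (V : E →L[ℂ] E) (z : ℂ) :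
    star (1 - (star z) • V) = 1 - z • adjoint V := by
  rw [star_sub, star_one, star_smul, star_star, star_eq_adjoint]

lemma isUnit_RT {V : E →L[ℂ] E} {e1 e2 : E} (h : CSys V e1 e2) (z : ℂ) :
    IsUnit (1 - z • adjoint V) := by
  rw [← star_one_sub]; exact (isUnit_R h _).star

def RT (V : E →L[ℂ] E) (z : ℂ) : E →L[ℂ] E := Ring.inverse (1 - z • adjoint V)

lemma RT_inner (V : E →L[ℂ] E) (z : ℂ) (g φ : E) :
    inner ℂ g (RT V z φ) = inner ℂ (Ring.inverse (1 - (star z) • V) g) φ := by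
  rw [RT, ← star_one_sub, Ring.inverse_star, star_eq_adjoint, adjoint_inner_right]

lemma RT_eq {V : E →L[ℂ] E} {e1 e2 : E} (h : CSys V e1 e2) (z : ℂ) (x : E) :
    RT V z x - z • adjoint V (RT V z x) = x := by
  have := Ring.mul_inverse_cancel _ (isUnit_RT h z)
  have := congrArg (fun W : E →L[ℂ] E => W x) this
  simpa [RT] using this

lemma RT_comm {V : E →L[ℂ] E} {e1 e2 : E} (h : CSys V e1 e2) (z : ℂ) (x : E) :
    RT V z (adjoint V x) = adjoint V (RT V z x) := by
  have h1 : Commute (1 - z • adjoint V) (adjoint V) := by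
    apply Commute.sub_left (Commute.one_left _) 
    exact (Commute.refl _).smul_left z
  obtain ⟨u, hu⟩ := isUnit_RT h z
  have h2 : Commute (RT V z) (adjoint V) := by
    rw [RT, ← hu, Ring.inverse_unit]
    rw [← hu] at h1
    exact h1.units_inv_left
  exact congrArg (fun W : E →L[ℂ] E => W x) h2.eq

lemma qn_T {V : E →L[ℂ] E} {e1 e2 : E} (h : CSys V e1 e2) (z : ℂ) :
    Tendsto (fun n : ℕ => ‖(z • adjoint V) ^ n‖) atTop (𝓝 0) := by
  refine (h.qn (star z)).congr fun n => ?_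
  rw [← norm_star, star_pow, star_smul, star_star, star_eq_adjoint]

lemma RT_mem {V : E →L[ℂ] E} {e1 e2 : E} (h : CSys V e1 e2) (B : Submodule ℂ E)
    [B.HasOrthogonalProjection] (hB : ∀ x ∈ B, adjoint V x ∈ B) (z : ℂ) (x : E) (hx : x ∈ B) :
    RT V z x ∈ B := by
  have hcl : IsClosed (B : Set E) := by
    rw [← Submodule.orthogonal_orthogonal B]; exact Submodule.isClosed_orthogonal _
  set W := z • adjoint V with hW
  have hWB : ∀ n : ℕ, (W ^ n) x ∈ B := by
    intro n
    induction n with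
    | zero => simpa using hx
    | succ n ih =>
      rw [pow_succ', mul_apply_eq_comp]
      exact B.smul_mem _ (hB _ ih)
  have hs : ∀ n : ℕ, RT V z x - (W ^ n) (RT V z x) = ∑ i ∈ Finset.range n, (W ^ i) x := by
    intro n
    have h1 := geom_sum_mul_neg W n
    have h2 := congrArg (fun U : E →L[ℂ] E => U (RT V z x)) h1
    have h3 : (1 - W) (RT V z x) = x := by simpa [hW] using RT_eq h z x
    simp only [mul_apply_eq_comp, h3] at h2
    simpa using h2.symm
  have hl : Tendsto (fun n : ℕ => RT V z x - (W ^ n) (RT V z x)) atTop (𝓝 (RT V z x)) := by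
    have : Tendsto (fun n : ℕ => (W ^ n) (RT V z x)) atTop (𝓝 0) := by
      apply squeeze_zero_norm (fun n => (W ^ n).le_opNorm _)
      simpa using (qn_T h z).mul_const ‖RT V z x‖
    simpa using tendsto_const_nhds.sub this
  refine hcl.mem_of_tendsto hl (Eventually.of_forall fun n => ?_)
  rw [hs]
  exact B.sum_mem fun i _ => hWB i

lemma RT_diff {V : E →L[ℂ] E} {e1 e2 : E} (h : CSys V e1 e2) (g φ : E) :
    Differentiable ℂ (fun z => inner ℂ g (RT V z φ)) := by
  intro z
  have h1 : DifferentiableAt ℂ (fun z : ℂ => (1 - z • adjoint V : E →L[ℂ] E)) z := by fun_prop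
  have h2 := (differentiableAt_inverse (𝕜 := ℂ) (isUnit_RT h z)).comp z h1
  have h3 : DifferentiableAt ℂ (fun z => RT V z φ) z := by
    exact (h2.clm_apply (differentiableAt_const φ))
  exact (innerSL ℂ g).differentiableAt.comp z h3

lemma kf_ne {V : E →L[ℂ] E} {e1 e2 : E} (h : CSys V e1 e2) (B : Submodule ℂ E)
    [B.HasOrthogonalProjection] (hB : CSub V e1 B) (z : ℂ) : 0 < kf V e1 B z := by
  rw [kf, norm_pos_iff]
  intro h0
  apply hB.ne
  have h1 := R_eq h z e1
  have hm : thv V e1 z ∈ Bᗮ := by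
    have := B.sub_starProjection_mem_orthogonal (thv V e1 z)
    rwa [h0, sub_zero] at this
  have hm2 : V (thv V e1 z) ∈ Bᗮ := by
    rw [Submodule.mem_orthogonal] at hm ⊢
    intro u hu
    rw [← adjoint_inner_left]
    exact hm _ (hB.inv u hu)
  have : e1 ∈ Bᗮ := by
    rw [← h1]
    exact Bᗮ.sub_mem hm (Bᗮ.smul_mem _ hm2)
  exact (Submodule.starProjection_apply_eq_zero_iff B).2 this

def Sr (V : E →L[ℂ] E) (e1 e2 : E) (r : ℝ) : E →L[ℂ] E :=
  adjoint V - (innerSL ℂ e1).smulRight (e2 - (r : ℂ) • e1)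

lemma Sr_apply (V : E →L[ℂ] E) (e1 e2 : E) (r : ℝ) (x : E) :
    Sr V e1 e2 r x = adjoint V x - inner ℂ e1 x • (e2 - (r : ℂ) • e1) := by
  simp [Sr]

lemma Sr_sym {V : E →L[ℂ] E} {e1 e2 : E} (h : CSys V e1 e2) (r : ℝ) (x y : E) :
    inner ℂ (Sr V e1 e2 r x) y = inner ℂ x (Sr V e1 e2 r y) := by
  rw [Sr_apply, Sr_apply, inner_sub_left, adjoint_inner_left, inner_sub_right, h.adj y]
  simp only [inner_sub_left, inner_sub_right, inner_add_right, inner_smul_left, inner_smul_right,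
    inner_conj_symm, Complex.conj_ofReal]
  ring

lemma Sr_ker {V : E →L[ℂ] E} {e1 e2 : E} (h : CSys V e1 e2) :
    ∃ r : ℝ, ∀ w, Sr V e1 e2 r w = 0 → w = 0 := by
  have h0 : ∀ (r : ℝ) w, Sr V e1 e2 r w = 0 → inner ℂ e1 w = 0 → w = 0 := by
    intro r w hw he
    rw [Sr_apply, he, zero_smul, sub_zero] at hw
    apply h.cyc
    intro n
    cases n with
    | zero => simpa using he
    | succ n =>
      rw [pow_succ', mul_apply_eq_comp, ← adjoint_inner_right, hw, inner_zero_right]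
  by_contra! hc
  obtain ⟨w, hw, hw0⟩ := hc 0
  obtain ⟨w', hw', hw0'⟩ := hc 1
  have a1 : inner ℂ e1 w ≠ 0 := fun he => hw0 (h0 _ w hw he)
  have a2 : inner ℂ e1 w' ≠ 0 := fun he => hw0' (h0 _ w' hw' he)
  have h1 : Sr V e1 e2 1 w' = Sr V e1 e2 0 w' + inner ℂ e1 w' • e1 := by
    rw [Sr_apply, Sr_apply]; simp [smul_sub]; abel
  have h2 : inner ℂ w (Sr V e1 e2 1 w') = 0 := by rw [hw', inner_zero_right]
  rw [h1, inner_add_right, ← Sr_sym h, hw, inner_zero_left, zero_add, inner_smul_right] at h2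
  rcases mul_eq_zero.1 h2 with h3 | h3
  · exact a2 h3
  · exact a1 (inner_eq_zero_symm.1 h3)

lemma Sr_unit {V : E →L[ℂ] E} {e1 e2 : E} (h : CSys V e1 e2) (r : ℝ) (z : ℂ) (hz : z.im ≠ 0) :
    IsUnit (1 - z • Sr V e1 e2 r) := by
  have hsa : IsSelfAdjoint (Sr V e1 e2 r) := by
    rw [isSelfAdjoint_iff']
    apply (eq_adjoint_iff _ _).2 (fun x y => ?_) |>.symm
    exact Sr_sym h r x y
  have hz0 : z ≠ 0 := by rintro rfl; simp at hz
  have h1 : z⁻¹ ∉ spectrum ℂ (Sr V e1 e2 r) := by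
    intro hm
    have h2 := hsa.mem_spectrum_eq_re hm
    have h3 := congrArg Complex.im h2
    simp only [Complex.inv_im, Complex.ofReal_im] at h3
    have : Complex.normSq z ≠ 0 := by simpa using hz0
    field_simp at h3
    apply hz; simpa using h3
  rw [spectrum.notMem_iff] at h1
  have h4 : (1 - z • Sr V e1 e2 r) = z • (algebraMap ℂ (E →L[ℂ] E) z⁻¹ - Sr V e1 e2 r) := by
    rw [smul_sub, Algebra.algebraMap_eq_smul_one, smul_smul, mul_inv_cancel₀ hz0, one_smul]
  rw [h4]
  exact (IsUnit.smul (Units.mk0 z hz0) h1 : _)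

lemma Q_bound {V : E →L[ℂ] E} {e1 e2 : E} (h : CSys V e1 e2) (r : ℝ) (z : ℂ) (hz : z.im ≠ 0)
    (x φ : E) (hx : x - z • Sr V e1 e2 r x = φ) : ‖x‖ ≤ ‖z‖ / |z.im| * ‖φ‖ := by
  have hz0 : z ≠ 0 := by rintro rfl; simp at hz
  have hy : 0 < |z.im| := abs_pos.2 hz
  have hzn : 0 < ‖z‖ := norm_pos_iff.2 hz0
  by_cases hx0 : x = 0
  · subst hx0; simp; positivity
  have hxn : 0 < ‖x‖ := norm_pos_iff.2 hx0
  set s := inner ℂ x (Sr V e1 e2 r x) with hs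
  have hsr : s.im = 0 := by
    have : (starRingEnd ℂ) s = s := by
      rw [hs, inner_conj_symm, Sr_sym h]
    exact Complex.conj_eq_iff_im.1 this
  have h1 : inner ℂ x φ = (‖x‖ : ℂ) ^ 2 - z * s := by
    rw [← hx, inner_sub_right, inner_smul_right, inner_self_eq_norm_sq_to_K]; rfl
  have h2 : (star z * inner ℂ x φ).im = - z.im * ‖x‖ ^ 2 := by
    rw [h1]
    have : ((‖x‖ : ℂ) ^ 2) = ((‖x‖ ^ 2 : ℝ) : ℂ) := by push_cast; rfl
    rw [this]
    simp only [Complex.mul_im, Complex.mul_re, hsr, Complex.sub_re, Complex.sub_im,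
      Complex.ofReal_re, Complex.ofReal_im, Complex.star_def, Complex.conj_re, Complex.conj_im]
    ring
  have h3 : |z.im| * ‖x‖ ^ 2 ≤ ‖z‖ * (‖x‖ * ‖φ‖) := by
    calc |z.im| * ‖x‖ ^ 2 = |(star z * inner ℂ x φ).im| := by
          rw [h2, abs_mul, abs_neg, abs_of_nonneg (sq_nonneg ‖x‖)]
      _ ≤ ‖star z * inner ℂ x φ‖ := Complex.abs_im_le_norm _
      _ ≤ ‖z‖ * (‖x‖ * ‖φ‖) := by
          rw [norm_mul, norm_star]; gcongr; exact norm_inner_le_norm _ _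
  rw [div_mul_eq_mul_div, le_div_iff₀ hy]
  apply le_of_mul_le_mul_left _ hxn
  nlinarith

def Qr (V : E →L[ℂ] E) (e1 e2 : E) (r : ℝ) (z : ℂ) : E →L[ℂ] E :=
  Ring.inverse (1 - z • Sr V e1 e2 r)

lemma Q_eq {V : E →L[ℂ] E} {e1 e2 : E} (h : CSys V e1 e2) (r : ℝ) (z : ℂ) (hz : z.im ≠ 0) (x : E) :
    Qr V e1 e2 r z x - z • Sr V e1 e2 r (Qr V e1 e2 r z x) = x := by
  have := Ring.mul_inverse_cancel _ (Sr_unit h r z hz)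
  have := congrArg (fun W : E →L[ℂ] E => W x) this
  simpa [Qr] using this

lemma Q_eq2 {V : E →L[ℂ] E} {e1 e2 : E} (h : CSys V e1 e2) (r : ℝ) (z : ℂ) (hz : z.im ≠ 0) (x : E) :
    Qr V e1 e2 r z (x - z • Sr V e1 e2 r x) = x := by
  have := Ring.inverse_mul_cancel _ (Sr_unit h r z hz)
  have := congrArg (fun W : E →L[ℂ] E => W x) this
  simpa [Qr] using this

lemma Q_norm {V : E →L[ℂ] E} {e1 e2 : E} (h : CSys V e1 e2) (r : ℝ) (z : ℂ) (hz : z.im ≠ 0) (x : E) :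
    ‖Qr V e1 e2 r z x‖ ≤ ‖z‖ / |z.im| * ‖x‖ :=
  Q_bound h r z hz _ _ (Q_eq h r z hz x)

lemma Q_tendsto {V : E →L[ℂ] E} {e1 e2 : E} (h : CSys V e1 e2) (r : ℝ)
    (hr : ∀ w, Sr V e1 e2 r w = 0 → w = 0) (φ : E) :
    ∀ ε > 0, ∃ y0 : ℝ, 0 < y0 ∧ ∀ y : ℝ, y0 ≤ |y| → ‖Qr V e1 e2 r (y * I) φ‖ ≤ ε := by
  intro ε hε
  set S := Sr V e1 e2 r with hS
  have hsa : adjoint S = S := by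
    apply ((eq_adjoint_iff _ _).2 (fun x y => ?_)).symm
    exact Sr_sym h r x y
  have hd : S.range.topologicalClosure = ⊤ := by
    rw [Submodule.topologicalClosure_eq_top_iff, ContinuousLinearMap.orthogonal_range, hsa]
    rw [Submodule.eq_bot_iff]
    intro w hw
    exact hr w (by simpa using hw)
  have hφ : φ ∈ closure (S.range : Set E) := by
    rw [← Submodule.topologicalClosure_coe, hd]; trivial
  obtain ⟨u, ⟨w, rfl⟩, hu⟩ := Metric.mem_closure_iff.1 hφ (ε / 2) (by positivity)
  rw [dist_eq_norm] at hu
  refine ⟨4 * ‖w‖ / ε + 1, by positivity, fun y hy => ?_⟩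
  have hy0 : 0 < |y| := lt_of_lt_of_le (by positivity) hy
  have hyne : y ≠ 0 := abs_pos.1 hy0
  have him : ((y : ℂ) * I).im ≠ 0 := by simpa using hyne
  have hzn : ‖(y : ℂ) * I‖ = |y| := by simp
  have hz1 : ‖(y : ℂ) * I‖ / |((y : ℂ) * I).im| = 1 := by
    rw [hzn]; simp [hyne]
  have hQ : ∀ x, ‖Qr V e1 e2 r (y * I) x‖ ≤ ‖x‖ := by
    intro x
    have := Q_norm h r (y * I) him x
    rwa [hz1, one_mul] at this
  have h1 : ((y : ℂ) * I) • Qr V e1 e2 r (y * I) (S w) = Qr V e1 e2 r (y * I) w - w := by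
    have := Q_eq2 h r (y * I) him w
    rw [map_sub, map_smul] at this
    rw [← hS] at this
    rw [eq_sub_iff_add_eq, add_comm]
    exact (sub_eq_iff_eq_add.1 this).symm
  have h2 : |y| * ‖Qr V e1 e2 r (y * I) (S w)‖ ≤ 2 * ‖w‖ := by
    rw [← hzn, ← norm_smul, h1]
    calc _ ≤ ‖Qr V e1 e2 r (y * I) w‖ + ‖w‖ := norm_sub_le _ _
      _ ≤ 2 * ‖w‖ := by linarith [hQ w]
  have h3 : ‖Qr V e1 e2 r (y * I) (S w)‖ ≤ ε / 2 := by
    apply le_of_mul_le_mul_left _ hy0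
    have : 4 * ‖w‖ / ε ≤ |y| := by linarith
    rw [div_le_iff₀ hε] at this
    linarith
  calc ‖Qr V e1 e2 r (y * I) φ‖ = ‖Qr V e1 e2 r (y * I) (φ - S w) + Qr V e1 e2 r (y * I) (S w)‖ := by
        rw [← map_add, sub_add_cancel]
    _ ≤ ‖Qr V e1 e2 r (y * I) (φ - S w)‖ + ‖Qr V e1 e2 r (y * I) (S w)‖ := norm_add_le _ _
    _ ≤ ε := by
      have hu2 : ‖φ - S w‖ < ε / 2 := hu
      linarith [hQ (φ - S w)]

lemma main_est {V : E →L[ℂ] E} {e1 e2 : E} (h : CSys V e1 e2) (r : ℝ) (A B : Submodule ℂ E)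
    [A.HasOrthogonalProjection] [B.HasOrthogonalProjection] (hB : CSub V e1 B)
    (φ g : E) (hφ : φ ∈ A) (hg : g ∈ Bᗮ) (z : ℂ) (hz : z.im ≠ 0) :
    ‖inner ℂ g (RT V z φ)‖ ≤ ‖g‖ * ‖Qr V e1 e2 r z φ‖ +
      ‖φ‖ * ‖g‖ * (‖z‖ / |z.im|) * (kf V e1 A (star z) / kf V e1 B (star z)) := by
  set d := e2 - (r : ℂ) • e1 with hd
  set θ := thv V e1 (star z) with hθ
  have hkB := kf_ne h B hB (star z)
  have hF : ∀ ψ, inner ℂ e1 (RT V z ψ) = inner ℂ θ ψ := fun ψ => RT_inner V z e1 ψ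
  have hx : ∀ ψ, RT V z ψ = Qr V e1 e2 r z ψ + (z * inner ℂ θ ψ) • Qr V e1 e2 r z d := by
    intro ψ
    have h1 := Q_eq2 h r z hz (RT V z ψ)
    have h2 : RT V z ψ - z • Sr V e1 e2 r (RT V z ψ) = ψ + (z * inner ℂ θ ψ) • d := by
      rw [Sr_apply, smul_sub, hF, smul_smul, ← sub_add, RT_eq h]
    rw [h2, map_add, map_smul] at h1
    exact h1.symm
  have hFA : ‖inner ℂ θ φ‖ ≤ kf V e1 A (star z) * ‖φ‖ := by
    rw [← (Submodule.starProjection_eq_self_iff).2 hφ, ← Submodule.inner_starProjection_left_eq_right]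
    refine (norm_inner_le_norm _ _).trans ?_
    rw [(Submodule.starProjection_eq_self_iff).2 hφ, kf]
  have hκ : ‖z * inner ℂ g (Qr V e1 e2 r z d)‖ * kf V e1 B (star z) ≤ ‖g‖ * (‖z‖ / |z.im|) := by
    set κ := B.starProjection θ with hκ
    have hκB : κ ∈ B := Submodule.starProjection_apply_mem B θ
    have h1 : inner ℂ g (RT V z κ) = 0 :=
      Submodule.inner_left_of_mem_orthogonal (RT_mem h B hB.inv z κ hκB) hg
    have h2 : inner ℂ θ κ = ((‖κ‖ ^ 2 : ℝ) : ℂ) := by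
      rw [← (Submodule.starProjection_eq_self_iff).2 hκB,
        ← Submodule.inner_starProjection_left_eq_right, ← hκ,
        (Submodule.starProjection_eq_self_iff).2 hκB, inner_self_eq_norm_sq_to_K]
      push_cast; rfl
    rw [hx, inner_add_right, inner_smul_right, h2] at h1
    have h3 : (z * inner ℂ g (Qr V e1 e2 r z d)) * ((‖κ‖ ^ 2 : ℝ) : ℂ)
        = - inner ℂ g (Qr V e1 e2 r z κ) := by
      rw [eq_neg_iff_add_eq_zero, ← h1]; ring
    have h4 : ‖z * inner ℂ g (Qr V e1 e2 r z d)‖ * ‖κ‖ ^ 2 ≤ ‖g‖ * (‖z‖ / |z.im| * ‖κ‖) := by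
      have := congrArg norm h3
      rw [norm_mul, norm_neg, Complex.norm_real, Real.norm_of_nonneg (sq_nonneg _)] at this
      rw [this]
      refine (norm_inner_le_norm _ _).trans ?_
      gcongr
      exact Q_norm h r z hz κ
    have hk : kf V e1 B (star z) = ‖κ‖ := rfl
    rw [hk] at hkB ⊢
    apply le_of_mul_le_mul_right _ hkB
    nlinarith
  rw [hx, inner_add_right, inner_smul_right]
  refine (norm_add_le _ _).trans ?_
  gcongr
  · exact norm_inner_le_norm _ _
  · have e : z * inner ℂ θ φ * inner ℂ g (Qr V e1 e2 r z d) =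
        inner ℂ θ φ * (z * inner ℂ g (Qr V e1 e2 r z d)) := by ring
    rw [e, norm_mul]
    have h5 : ‖z * inner ℂ g (Qr V e1 e2 r z d)‖ ≤ ‖g‖ * (‖z‖ / |z.im|) / kf V e1 B (star z) := by
      rw [le_div_iff₀ hkB]; exact hκ
    calc _ ≤ (kf V e1 A (star z) * ‖φ‖) * (‖g‖ * (‖z‖ / |z.im|) / kf V e1 B (star z)) := by
          apply mul_le_mul hFA h5 (norm_nonneg _)
          exact mul_nonneg (norm_nonneg _) (norm_nonneg _)
      _ = _ := by ring

end PartC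
end CS

namespace CS

section PartC
open Filter Topology ContinuousLinearMap
variable {E : Type*} [NormedAddCommGroup E] [InnerProductSpace ℂ E] [CompleteSpace E]

def AxB (V : E →L[ℂ] E) (e1 : E) (A : Submodule ℂ E) [A.HasOrthogonalProjection] (τ : ℝ) : Prop :=
  ∀ ε > 0, ∃ C c : ℝ, 0 < c ∧ ∀ y : ℝ, kf V e1 A (y * I) ≤ C * Real.exp ((τ + ε) * |y|) ∧
    c * Real.exp ((τ - ε) * |y|) ≤ kf V e1 A (y * I)

lemma f_id {V : E →L[ℂ] E} {e1 e2 : E} (h : CSys V e1 e2) (φ g : E) (z : ℂ) :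
    inner ℂ g (RT V z φ) = inner ℂ g φ + z * inner ℂ g (RT V z (adjoint V φ)) := by
  rw [RT_comm h, ← inner_smul_right, ← inner_add_right]
  congr 1
  exact (sub_eq_iff_eq_add.1 (RT_eq h z φ))

lemma est1 {V : E →L[ℂ] E} {e1 e2 : E} (h : CSys V e1 e2) (A B : Submodule ℂ E)
    [A.HasOrthogonalProjection] [B.HasOrthogonalProjection] (hB : CSub V e1 B)
    (φ g : E) (hφ : φ ∈ A) (hg : g ∈ Bᗮ) (z : ℂ) (hz : z.im ≠ 0) :
    ‖inner ℂ g (RT V z φ)‖ ≤ 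
      ‖φ‖ * ‖g‖ * (‖z‖ / |z.im|) * (1 + kf V e1 A (star z) / kf V e1 B (star z)) := by
  refine (main_est h 0 A B hB φ g hφ hg z hz).trans ?_
  have := mul_le_mul_of_nonneg_left (Q_norm h 0 z hz φ) (norm_nonneg g)
  nlinarith

lemma est2 {V : E →L[ℂ] E} {e1 e2 : E} (h : CSys V e1 e2) (A B : Submodule ℂ E)
    [A.HasOrthogonalProjection] [B.HasOrthogonalProjection] (hB : CSub V e1 B)
    (φ g : E) (hφ : φ ∈ A) (hg : g ∈ Bᗮ) (z : ℂ) (hz : 1 ≤ |z.im|) :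
    ‖inner ℂ g (RT V z (adjoint V φ))‖ ≤ 
      ‖φ‖ * ‖g‖ * (2 + kf V e1 A (star z) / kf V e1 B (star z)) := by
  have him : z.im ≠ 0 := by intro h0; rw [h0] at hz; norm_num at hz
  have hzn : 1 ≤ ‖z‖ := hz.trans (Complex.abs_im_le_norm z)
  have h1 := est1 h A B hB φ g hφ hg z him
  have h2 : z * inner ℂ g (RT V z (adjoint V φ)) = inner ℂ g (RT V z φ) - inner ℂ g φ := by
    rw [f_id h φ g z]; ring
  set k := kf V e1 A (star z) / kf V e1 B (star z) with hk
  have hk0 : 0 ≤ k := div_nonneg (norm_nonneg _) (norm_nonneg _)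
  have h3 : ‖z‖ / |z.im| ≤ ‖z‖ := div_le_self (norm_nonneg _) hz
  have hpg : 0 ≤ ‖φ‖ * ‖g‖ := by positivity
  apply le_of_mul_le_mul_left _ (lt_of_lt_of_le one_pos hzn)
  rw [← norm_mul, h2]
  refine (norm_sub_le _ _).trans ?_
  have h4 : ‖inner ℂ g φ‖ ≤ ‖φ‖ * ‖g‖ := by
    rw [mul_comm]; exact norm_inner_le_norm _ _
  calc _ ≤ ‖φ‖ * ‖g‖ * (‖z‖ / |z.im|) * (1 + k) + ‖φ‖ * ‖g‖ := add_le_add h1 h4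
    _ ≤ ‖φ‖ * ‖g‖ * ‖z‖ * (1 + k) + ‖φ‖ * ‖g‖ * ‖z‖ := by
        apply add_le_add
        · gcongr
        · exact le_mul_of_one_le_right hpg hzn
    _ = _ := by ring

lemma f_gro {V : E →L[ℂ] E} {e1 e2 : E} (h : CSys V e1 e2) : ∃ τ : ℝ, ∀ g φ, ∀ ε > 0, ∃ C : ℝ, 0 ≤ C ∧
    ∀ z : ℂ, ‖inner ℂ g (RT V z φ)‖ ≤ C * Real.exp (ε * ‖z‖ + τ * |z.im|) := by
  obtain ⟨τ, hτ⟩ := h.gro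
  refine ⟨τ, fun g φ ε hε => ?_⟩
  obtain ⟨C, hC⟩ := hτ g ε hε
  refine ⟨|C| * ‖φ‖, by positivity, fun z => ?_⟩
  rw [RT_inner]
  refine (norm_inner_le_norm _ _).trans ?_
  have := hC (star z)
  have e1 : ‖star z‖ = ‖z‖ := norm_star z
  have e2 : |(star z).im| = |z.im| := by simp
  rw [e1, e2] at this
  have h3 : C * Real.exp (ε * ‖z‖ + τ * |z.im|) ≤ |C| * Real.exp (ε * ‖z‖ + τ * |z.im|) := by
    gcongr; exact le_abs_self C
  calc _ ≤ (|C| * Real.exp (ε * ‖z‖ + τ * |z.im|)) * ‖φ‖ := by gcongr; exact this.trans h3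
    _ = _ := by ring

lemma f_exp {V : E →L[ℂ] E} {e1 e2 : E} (h : CSys V e1 e2) (g φ : E) :
    (∃ c k : ℝ, ∀ z : ℂ, ‖inner ℂ g (RT V z φ)‖ ≤ c * Real.exp (k * ‖z‖)) ∧
    (∀ ε > 0, ∃ C : ℝ, ∀ x : ℝ, ‖inner ℂ g (RT V x φ)‖ ≤ C * Real.exp (ε * |x|)) := by
  obtain ⟨τ, hτ⟩ := f_gro h
  constructor
  · obtain ⟨C, hC0, hC⟩ := hτ g φ 1 one_pos
    refine ⟨C, 1 + |τ|, fun z => (hC z).trans ?_⟩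
    have h1 : τ * |z.im| ≤ |τ| * ‖z‖ :=
      mul_le_mul (le_abs_self τ) (Complex.abs_im_le_norm z) (abs_nonneg _) (abs_nonneg _)
    gcongr
    linarith
  · intro ε hε
    obtain ⟨C, hC0, hC⟩ := hτ g φ ε hε
    refine ⟨C, fun x => ?_⟩
    have := hC x
    simpa using this

lemma f_bdd_ball {V : E →L[ℂ] E} {e1 e2 : E} (h : CSys V e1 e2) (g φ : E) (R : ℝ) :
    ∃ C : ℝ, ∀ z : ℂ, ‖z‖ ≤ R → ‖inner ℂ g (RT V z φ)‖ ≤ C := by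
  obtain ⟨⟨c, k, hc⟩, -⟩ := f_exp h g φ
  refine ⟨|c| * Real.exp (|k| * R), fun z hz => (hc z).trans ?_⟩
  have h1 : k * ‖z‖ ≤ |k| * R :=
    mul_le_mul (le_abs_self k) hz (norm_nonneg _) (abs_nonneg _)
  calc _ ≤ |c| * Real.exp (k * ‖z‖) := by gcongr; exact le_abs_self c
    _ ≤ _ := by gcongr

lemma star_yI (y : ℝ) : star ((y : ℂ) * I) = ((-y : ℝ) : ℂ) * I := by
  simp

lemma affine_step {V : E →L[ℂ] E} {e1 e2 : E} (h : CSys V e1 e2) (X Y : Submodule ℂ E)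
    [X.HasOrthogonalProjection] [Y.HasOrthogonalProjection] (hY : CSub V e1 Y)
    (φ g : E) (hφ : φ ∈ X) (hg : g ∈ Yᗮ) (h0 : inner ℂ g φ ≠ 0)
    (hc : ∀ z, inner ℂ g (RT V z (adjoint V φ)) = inner ℂ g (RT V 0 (adjoint V φ))) :
    ∃ C y0 : ℝ, ∀ y : ℝ, y0 ≤ |y| → kf V e1 Y (y * I) ≤ C * kf V e1 X (y * I) := by
  obtain ⟨r, hr⟩ := Sr_ker h
  set c := inner ℂ g (RT V 0 (adjoint V φ)) with hcdef
  set b := inner ℂ g φ with hb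
  have hbn : 0 < ‖b‖ := norm_pos_iff.2 h0
  have hf : ∀ z, inner ℂ g (RT V z φ) = b + z * c := fun z => by rw [f_id h, hc]
  have hlow : ∃ y1 : ℝ, ∀ y : ℝ, y1 ≤ |y| → ‖b‖ ≤ ‖b + (y * I : ℂ) * c‖ := by
    by_cases hc0 : c = 0
    · exact ⟨0, fun y _ => by simp [hc0]⟩
    · have hcn : 0 < ‖c‖ := norm_pos_iff.2 hc0
      refine ⟨2 * ‖b‖ / ‖c‖, fun y hy => ?_⟩
      rw [div_le_iff₀ hcn] at hy
      have h1 : ‖(y * I : ℂ) * c‖ = |y| * ‖c‖ := by simp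
      have h2 := norm_sub_le (b + (y * I : ℂ) * c) b
      rw [add_sub_cancel_left, h1] at h2
      linarith
  obtain ⟨y1, hy1⟩ := hlow
  have hgn : 0 < ‖g‖ := by
    rw [norm_pos_iff]; rintro rfl; simp [hb] at h0
  have hpn : 0 < ‖φ‖ := by
    rw [norm_pos_iff]; rintro rfl; simp [hb] at h0
  obtain ⟨y2, hy2p, hy2⟩ := Q_tendsto h r hr φ (‖b‖ / (2 * ‖g‖)) (by positivity)
  refine ⟨2 * ‖φ‖ * ‖g‖ / ‖b‖, max y1 y2, fun y hy => ?_⟩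
  have a1 := hy1 (-y) (by rw [abs_neg]; exact (le_max_left _ _).trans hy)
  have a2 := hy2 (-y) (by rw [abs_neg]; exact (le_max_right _ _).trans hy)
  have hyp : 0 < |y| := hy2p.trans_le ((le_max_right _ _).trans hy)
  have hyne : y ≠ 0 := abs_pos.1 hyp
  have him : (((-y : ℝ) : ℂ) * I).im ≠ 0 := by simpa using hyne
  have hzn : ‖((-y : ℝ) : ℂ) * I‖ / |(((-y : ℝ) : ℂ) * I).im| = 1 := by simp [hyne]
  have m := main_est h r X Y hY φ g hφ hg (((-y : ℝ) : ℂ) * I) him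
  rw [hf, hzn, star_yI, neg_neg] at m
  have hk := kf_ne h Y hY (y * I)
  have h1 : ‖g‖ * ‖Qr V e1 e2 r (((-y : ℝ) : ℂ) * I) φ‖ ≤ ‖b‖ / 2 := by
    calc _ ≤ ‖g‖ * (‖b‖ / (2 * ‖g‖)) := by gcongr
      _ = _ := by field_simp
  have h2 : ‖b‖ / 2 ≤ ‖φ‖ * ‖g‖ * (kf V e1 X (y * I) / kf V e1 Y (y * I)) := by
    have := a1.trans m
    linarith
  rw [← mul_div_assoc, le_div_iff₀ hk] at h2
  rw [div_mul_eq_mul_div, le_div_iff₀ hbn]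
  linarith

lemma zero_of_const {V : E →L[ℂ] E} {e1 e2 : E} (h : CSys V e1 e2) (φ g : E)
    (hc : ∀ z, inner ℂ g (RT V z φ) = inner ℂ g (RT V 0 φ)) :
    ∀ z, inner ℂ g (RT V z (adjoint V φ)) = 0 := by
  have hid : ∀ ψ, RT V 0 ψ = ψ := fun ψ => by simpa using RT_eq h 0 ψ
  have h1 : ∀ z : ℂ, z ≠ 0 → inner ℂ g (RT V z (adjoint V φ)) = 0 := by
    intro z hz
    have := f_id h φ g z
    rw [hc, hid] at this
    have h2 : z * inner ℂ g (RT V z (adjoint V φ)) = 0 := by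
      linear_combination -this
    exact (mul_eq_zero.1 h2).resolve_left hz
  intro z
  by_cases hz : z = 0
  · subst hz
    have hcont : ContinuousAt (fun z => inner ℂ g (RT V z (adjoint V φ))) 0 :=
      (RT_diff h g (adjoint V φ) 0).continuousAt
    have t1 : Tendsto (fun z => inner ℂ g (RT V z (adjoint V φ))) (𝓝[≠] 0)
      (𝓝 (inner ℂ g (RT V 0 (adjoint V φ)))) := hcont.tendsto.mono_left nhdsWithin_le_nhds
    have t2 : Tendsto (fun z : ℂ => inner ℂ g (RT V z (adjoint V φ))) (𝓝[≠] 0) (𝓝 0) := by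
      apply tendsto_const_nhds.congr'
      filter_upwards [self_mem_nhdsWithin] with z hz
      exact (h1 z hz).symm
    exact tendsto_nhds_unique t1 t2
  · exact h1 z hz

lemma bdd_step {V : E →L[ℂ] E} {e1 e2 : E} (h : CSys V e1 e2) (X Y : Submodule ℂ E)
    [X.HasOrthogonalProjection] [Y.HasOrthogonalProjection] (hX : CSub V e1 X)
    (C y0 : ℝ) (hk : ∀ y : ℝ, y0 ≤ |y| → kf V e1 Y (y * I) ≤ C * kf V e1 X (y * I))
    (φ g : E) (hφ : φ ∈ Y) (hg : g ∈ Xᗮ) :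
    ∀ z, inner ℂ g (RT V z (adjoint V φ)) = 0 := by
  apply zero_of_const h
  obtain ⟨C2, hC2⟩ := f_bdd_ball h g φ (max y0 1)
  have hb : ∀ y : ℝ, ‖inner ℂ g (RT V (y * I) φ)‖ ≤ max C2 (‖φ‖ * ‖g‖ * (1 + C)) := by
    intro y
    by_cases hy : |y| ≤ max y0 1
    · exact (hC2 _ (by simpa using hy)).trans (le_max_left _ _)
    · push Not at hy
      refine le_trans ?_ (le_max_right _ _)
      have hyp : 0 < |y| := one_pos.trans_le ((le_max_right _ _).trans hy.le)
      have hyne : y ≠ 0 := abs_pos.1 hyp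
      have him : ((y : ℂ) * I).im ≠ 0 := by simpa using hyne
      have hzn : ‖(y : ℂ) * I‖ / |((y : ℂ) * I).im| = 1 := by simp [hyne]
      have m := est1 h Y X hX φ g hφ hg (y * I) him
      rw [hzn, star_yI, mul_one] at m
      refine m.trans ?_
      gcongr
      rw [div_le_iff₀ (kf_ne h X hX _)]
      exact hk (-y) (by rw [abs_neg]; exact (le_max_left _ _).trans hy.le)
  obtain ⟨⟨c, k, hc⟩, hr⟩ := f_exp h g φ
  have hz := pl_zero_type (fun z => inner ℂ g (RT V z φ)) (RT_diff h g φ) c k hc hr (by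
    intro ε hε
    refine ⟨max C2 (‖φ‖ * ‖g‖ * (1 + C)), fun x => (hb x).trans ?_⟩
    have h0 : 0 ≤ max C2 (‖φ‖ * ‖g‖ * (1 + C)) := (norm_nonneg _).trans (hb 0)
    apply le_mul_of_one_le_right h0
    exact Real.one_le_exp (by positivity))
  exact pl_const _ (RT_diff h g φ) hz _ hb

lemma T_sub {V : E →L[ℂ] E} {e1 e2 : E} (h : CSys V e1 e2) (X Y : Submodule ℂ E)
    [X.HasOrthogonalProjection] (h0 : ∀ φ ∈ Y, ∀ g ∈ Xᗮ, ∀ z, inner ℂ g (RT V z (adjoint V φ)) = 0) :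
    ∀ φ ∈ Y, adjoint V φ ∈ X := by
  intro φ hφ
  rw [← Submodule.orthogonal_orthogonal X, Submodule.mem_orthogonal]
  intro g hg
  have := h0 φ hφ g hg 0
  have hid : ∀ ψ, RT V 0 ψ = ψ := fun ψ => by simpa using RT_eq h 0 ψ
  rwa [hid] at this

lemma not_le_pick (A B : Submodule ℂ E) [B.HasOrthogonalProjection] (hn : ¬ A ≤ B) :
    ∃ φ ∈ A, ∃ g ∈ Bᗮ, inner ℂ g φ ≠ 0 := by
  obtain ⟨φ, hφ, hφB⟩ := Set.not_subset.1 hn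
  refine ⟨φ, hφ, ?_⟩
  by_contra! hc
  apply hφB
  show φ ∈ B
  rw [← Submodule.orthogonal_orthogonal B, Submodule.mem_orthogonal]
  exact hc

lemma alg_contra {V : E →L[ℂ] E} {e1 e2 : E} (h : CSys V e1 e2) (A B : Submodule ℂ E)
    [A.HasOrthogonalProjection] [B.HasOrthogonalProjection]
    (hA : CSub V e1 A) (hB : CSub V e1 B)
    (hAB : ∀ φ ∈ A, adjoint V φ ∈ B) (hBA : ∀ φ ∈ B, adjoint V φ ∈ A) : A ≤ B ∨ B ≤ A := by
  by_contra! hc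
  obtain ⟨hn1, hn2⟩ := hc
  set C := A ⊓ B with hC
  have hcA : IsClosed (A : Set E) := by
    rw [← Submodule.orthogonal_orthogonal A]; exact Submodule.isClosed_orthogonal _
  have hcB : IsClosed (B : Set E) := by
    rw [← Submodule.orthogonal_orthogonal B]; exact Submodule.isClosed_orthogonal _
  have hcC : IsClosed (C : Set E) := by
    rw [hC, Submodule.coe_inf]; exact hcA.inter hcB
  have : CompleteSpace C := hcC.completeSpace_coe
  have key : ∀ X : Submodule ℂ E, C ≤ X → ¬ X ≤ C → ∃ a ∈ X, a ∈ Cᗮ ∧ a ∉ C := by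
    intro X hCX hn
    obtain ⟨φ, hφ, hφC⟩ := Set.not_subset.1 hn
    refine ⟨φ - C.starProjection φ, X.sub_mem hφ (hCX (C.starProjection_apply_mem φ)),
      C.sub_starProjection_mem_orthogonal φ, fun hm => hφC ?_⟩
    have := C.add_mem hm (C.starProjection_apply_mem φ)
    rwa [sub_add_cancel] at this
  obtain ⟨a, haA, haC, ha⟩ := key A inf_le_left (fun hle => hn1 (hle.trans inf_le_right))
  obtain ⟨b, hbB, hbC, hb⟩ := key B inf_le_right (fun hle => hn2 (hle.trans inf_le_left))
  have haB : a ∉ B := fun hm => ha ⟨haA, hm⟩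
  have hbA : b ∉ A := fun hm => hb ⟨hm, hbB⟩
  set T := adjoint V with hT
  have hTa : T a ∈ C := ⟨hA.inv a haA, hAB a haA⟩
  have hTb : T b ∈ C := ⟨hBA b hbB, hB.inv b hbB⟩
  have hTC : ∀ c ∈ C, T c ∈ C := fun c hc => ⟨hA.inv c hc.1, hB.inv c hc.2⟩
  have hVC : ∀ w ∈ Cᗮ, V w ∈ Cᗮ := by
    intro w hw
    rw [Submodule.mem_orthogonal] at hw ⊢
    intro u hu
    rw [← adjoint_inner_left]
    exact hw _ (hTC u hu)
  have hin : ∀ α β : ℂ, inner ℂ e1 (α • a + β • b) = 0 → inner ℂ e2 (α • a + β • b) = 0 →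
      α = 0 ∧ β = 0 := by
    intro α β h1 h2
    set w := α • a + β • b with hw
    have hwC : w ∈ Cᗮ := Cᗮ.add_mem (Cᗮ.smul_mem _ haC) (Cᗮ.smul_mem _ hbC)
    have hTw : T w ∈ C := by
      rw [hw, map_add, map_smul, map_smul]
      exact C.add_mem (C.smul_mem _ hTa) (C.smul_mem _ hTb)
    have hTV : T w = V w := by
      have := h.adj w
      rw [h1, h2] at this
      simpa using this
    have hT0 : T w = 0 := by
      have : T w ∈ Cᗮ := hTV ▸ hVC w hwC
      exact inner_self_eq_zero.1 ((Submodule.mem_orthogonal _ _).1 this _ hTw)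
    have hw0 : w = 0 := by
      apply h.cyc
      intro n
      cases n with
      | zero => simpa using h1
      | succ n =>
        rw [pow_succ', mul_apply_eq_comp, ← adjoint_inner_right, ← hT, hT0, inner_zero_right]
    constructor
    · by_contra hα
      apply haB
      have : a = -(α⁻¹ * β) • b := by
        have h3 : α • a = -(β • b) := eq_neg_of_add_eq_zero_left hw0
        have h4 := congrArg (fun v => α⁻¹ • v) h3
        simp only [smul_smul, inv_mul_cancel₀ hα, one_smul, smul_neg] at h4
        rw [h4, neg_smul]
      rw [this]; exact B.smul_mem _ hbB
    · by_contra hβ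
      apply hbA
      have : b = -(β⁻¹ * α) • a := by
        have h3 : β • b = -(α • a) := eq_neg_of_add_eq_zero_right hw0
        have h4 := congrArg (fun v => β⁻¹ • v) h3
        simp only [smul_smul, inv_mul_cancel₀ hβ, one_smul, smul_neg] at h4
        rw [h4, neg_smul]
      rw [this]; exact A.smul_mem _ haA
  set p := inner ℂ e1 a with hp
  set q := inner ℂ e1 b with hq
  set r := inner ℂ e2 a with hr
  set s := inner ℂ e2 b with hs
  have hin' : ∀ α β : ℂ, α * p + β * q = 0 → α * r + β * s = 0 → α = 0 ∧ β = 0 := by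
    intro α β h1 h2
    apply hin
    · rw [inner_add_right, inner_smul_right, inner_smul_right]; exact h1
    · rw [inner_add_right, inner_smul_right, inner_smul_right]; exact h2
  have hdet : p * s - q * r ≠ 0 := by
    intro hd
    have h1 := hin' q (-p) (by ring) (by linear_combination -hd)
    have h2 := hin' s (-r) (by linear_combination hd) (by ring)
    have h3 := hin' 1 0 (by simpa using h1.2) (by simpa using h2.2)
    exact one_ne_zero h3.1
  -- pairing
  have hz : ∀ w w', w ∈ Cᗮ → w' ∈ Cᗮ → T w ∈ C → T w' ∈ C →
      inner ℂ (T w) w' - inner ℂ w (T w') = 0 := by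
    intro w w' hw hw' h1 h2
    rw [(Submodule.mem_orthogonal _ _).1 hw' _ h1, (Submodule.mem_orthogonal' _ _).1 hw _ h2, sub_zero]
  have hab := hz a b haC hbC hTa hTb
  have haa := hz a a haC haC hTa hTa
  have hbb := hz b b hbC hbC hTb hTb
  have hform : ∀ w w', inner ℂ (T w) w' - inner ℂ w (T w') =
      inner ℂ w e1 * inner ℂ e2 w' - inner ℂ w e2 * inner ℂ e1 w' := by
    intro w w'
    rw [hT, adjoint_inner_left, h.adj w', inner_add_right, inner_sub_right, inner_smul_right,
      inner_smul_right]
    ring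
  rw [hform, ← inner_conj_symm a e1, ← inner_conj_symm a e2, ← hp, ← hq, ← hr, ← hs] at hab
  rw [hform, ← inner_conj_symm a e1, ← inner_conj_symm a e2, ← hp, ← hr] at haa
  rw [hform, ← inner_conj_symm b e1, ← inner_conj_symm b e2, ← hq, ← hs] at hbb
  -- conj p * s = conj r * q, conj p * r = conj r * p
  have h1 : (starRingEnd ℂ) p * (p * s - q * r) = 0 := by
    linear_combination p * hab - q * haa
  have h2 : (starRingEnd ℂ) r * (p * s - q * r) = 0 := by
    linear_combination r * hab - s * haa
  have hp0 : p = 0 := by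
    have := (mul_eq_zero.1 h1).resolve_right hdet
    simpa using this
  have hr0 : r = 0 := by
    have := (mul_eq_zero.1 h2).resolve_right hdet
    simpa using this
  exact one_ne_zero (hin' 1 0 (by simp [hp0]) (by simp [hr0])).1

lemma order_aux {V : E →L[ℂ] E} {e1 e2 : E} (h : CSys V e1 e2) (X Y : Submodule ℂ E)
    [X.HasOrthogonalProjection] [Y.HasOrthogonalProjection]
    (hX : CSub V e1 X) (hY : CSub V e1 Y) (φ g : E) (hφ : φ ∈ X) (hg : g ∈ Yᗮ)
    (h0 : inner ℂ g φ ≠ 0)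
    (hc : ∀ z, inner ℂ g (RT V z (adjoint V φ)) = inner ℂ g (RT V 0 (adjoint V φ)))
    (hn : ¬ Y ≤ X) : X ≤ Y ∨ Y ≤ X := by
  obtain ⟨C, y0, hk⟩ := affine_step h X Y hY φ g hφ hg h0 hc
  have s1 := bdd_step h X Y hX C y0 hk
  obtain ⟨φ1, hφ1, g1, hg1, h1⟩ := not_le_pick Y X hn
  obtain ⟨C', y0', hk'⟩ := affine_step h Y X hX φ1 g1 hφ1 hg1 h1 (fun z => by
    rw [s1 φ1 g1 hφ1 hg1, s1 φ1 g1 hφ1 hg1])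
  have s2 := bdd_step h Y X hY C' y0' hk'
  exact alg_contra h X Y hX hY (T_sub h Y X fun φ hφ g hg => s2 φ g hφ hg)
    (T_sub h X Y fun φ hφ g hg => s1 φ g hφ hg)

lemma order_wlog {V : E →L[ℂ] E} {e1 e2 : E} (h : CSys V e1 e2) (A B : Submodule ℂ E)
    [A.HasOrthogonalProjection] [B.HasOrthogonalProjection]
    (hA : CSub V e1 A) (hB : CSub V e1 B) (τA τB : ℝ) (hτ : τA ≤ τB)
    (hxA : AxB V e1 A τA) (hxB : AxB V e1 B τB) : A ≤ B ∨ B ≤ A := by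
  by_cases hn1 : A ≤ B
  · exact Or.inl hn1
  by_cases hn2 : B ≤ A
  · exact Or.inr hn2
  obtain ⟨φ, hφ, g, hg, h0⟩ := not_le_pick A B hn1
  obtain ⟨φ1, hφ1, g1, hg1, h1⟩ := not_le_pick B A hn2
  obtain ⟨⟨c, k, hc⟩, hr⟩ := f_exp h g (adjoint V φ)
  have hz := pl_zero_type (fun z => inner ℂ g (RT V z (adjoint V φ))) (RT_diff h g _) c k hc hr (by
    intro ε hε
    obtain ⟨CA, _, _, hAA⟩ := hxA (ε / 2) (by positivity)
    obtain ⟨_, cB, hcB, hBB⟩ := hxB (ε / 2) (by positivity)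
    obtain ⟨C2, hC2⟩ := f_bdd_ball h g (adjoint V φ) 1
    have hCA : 0 ≤ CA := by
      have := (norm_nonneg _).trans (hAA 0).1
      simpa using this
    refine ⟨max C2 (‖φ‖ * ‖g‖ * (2 + CA / cB)), fun y => ?_⟩
    have hexp : 1 ≤ Real.exp (ε * |y|) := Real.one_le_exp (by positivity)
    have hm0 : 0 ≤ max C2 (‖φ‖ * ‖g‖ * (2 + CA / cB)) := le_max_of_le_right (by positivity)
    by_cases hy : |y| ≤ 1
    · exact ((hC2 _ (by simpa using hy)).trans (le_max_left _ _)).trans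
        (le_mul_of_one_le_right hm0 hexp)
    · push Not at hy
      refine (est2 h A B hB φ g hφ hg (y * I) (by simpa using hy.le)).trans ?_
      rw [star_yI]
      have q1 := (hAA (-y)).1
      have q2 := (hBB (-y)).2
      rw [abs_neg] at q1 q2
      have q3 : kf V e1 A (((-y : ℝ) : ℂ) * I) / kf V e1 B (((-y : ℝ) : ℂ) * I) ≤
          CA / cB * Real.exp (ε * |y|) := by
        rw [div_le_iff₀ (kf_ne h B hB _)]
        calc _ ≤ CA * Real.exp ((τA + ε / 2) * |y|) := q1
          _ ≤ CA * (Real.exp (ε * |y|) * Real.exp ((τB - ε / 2) * |y|)) := by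
            rw [← Real.exp_add]
            gcongr
            nlinarith [abs_nonneg y]
          _ = CA / cB * Real.exp (ε * |y|) * (cB * Real.exp ((τB - ε / 2) * |y|)) := by
            field_simp
          _ ≤ _ := by gcongr
      calc _ ≤ ‖φ‖ * ‖g‖ * (2 * Real.exp (ε * |y|) + CA / cB * Real.exp (ε * |y|)) := by
            gcongr; linarith
        _ = (‖φ‖ * ‖g‖ * (2 + CA / cB)) * Real.exp (ε * |y|) := by ring
        _ ≤ _ := by gcongr; exact le_max_right _ _)
  obtain ⟨hh, -⟩ := f_exp h g1 (adjoint V φ1)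
  have hei := heins (fun z => inner ℂ g (RT V z (adjoint V φ)))
    (fun z => inner ℂ g1 (RT V z (adjoint V φ1))) (RT_diff h g _) (RT_diff h g1 _)
    (max (‖φ‖ * ‖g‖ * 3) (‖φ1‖ * ‖g1‖ * 3)) (by
      intro z hz
      rcases le_total (kf V e1 A (star z)) (kf V e1 B (star z)) with hle | hle
      · left
        refine (est2 h A B hB φ g hφ hg z hz).trans (le_trans ?_ (le_max_left _ _))
        have := (div_le_one (kf_ne h B hB (star z))).2 hle
        gcongr; linarith
      · right
        refine (est2 h B A hA φ1 g1 hφ1 hg1 z hz).trans (le_trans ?_ (le_max_right _ _))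
        have := (div_le_one (kf_ne h A hA (star z))).2 hle
        gcongr; linarith) hz hh
  rcases hei with hk | hk
  · exact order_aux h A B hA hB φ g hφ hg h0 hk hn2
  · exact (order_aux h B A hB hA φ1 g1 hφ1 hg1 h1 hk hn1).symm

theorem ordering {V : E →L[ℂ] E} {e1 e2 : E} (h : CSys V e1 e2) (A B : Submodule ℂ E)
    [A.HasOrthogonalProjection] [B.HasOrthogonalProjection]
    (hA : CSub V e1 A) (hB : CSub V e1 B) (τA τB : ℝ)
    (hxA : AxB V e1 A τA) (hxB : AxB V e1 B τB) : A ≤ B ∨ B ≤ A := by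
  rcases le_total τA τB with hle | hle
  · exact order_wlog h A B hA hB τA τB hle hxA hxB
  · exact (order_wlog h B A hB hA τB τA hle hxB hxA).symm

end PartC
end CS

namespace CS
section PD1
open Set

/-- absolutely continuous with a.e. derivative -/
structure AD {F : Type*} [NormedAddCommGroup F] [NormedSpace ℝ F] (f f' : ℝ → F) (a b : ℝ) : Prop where
  ac : AbsolutelyContinuousOnInterval f a b
  der : ∀ᵐ x, x ∈ uIcc a b → HasDerivAt f (f' x) x

theorem ac_of_le {X Y : Type*} [PseudoMetricSpace X] [PseudoMetricSpace Y] {f : ℝ → X} {g : ℝ → Y} {a b C : ℝ}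
    (hg : AbsolutelyContinuousOnInterval g a b) (hC : 0 ≤ C)
    (h : ∀ x ∈ uIcc a b, ∀ y ∈ uIcc a b, dist (f x) (f y) ≤ C * dist (g x) (g y)) :
    AbsolutelyContinuousOnInterval f a b := by
  rw [absolutelyContinuousOnInterval_iff] at hg ⊢
  intro ε hε
  obtain ⟨δ, hδ, H⟩ := hg (ε / (C + 1)) (by positivity)
  refine ⟨δ, hδ, fun E hE hs => ?_⟩
  have h1 := H E hE hs
  calc _ ≤ ∑ i ∈ Finset.range E.1, C * dist (g (E.2 i).1) (g (E.2 i).2) :=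
        Finset.sum_le_sum fun i hi => h _ (hE.1 i hi).1 _ (hE.1 i hi).2
    _ = C * ∑ i ∈ Finset.range E.1, dist (g (E.2 i).1) (g (E.2 i).2) := (Finset.mul_sum _ _ _).symm
    _ ≤ (C + 1) * ∑ i ∈ Finset.range E.1, dist (g (E.2 i).1) (g (E.2 i).2) := by
        gcongr
        linarith
    _ < (C + 1) * (ε / (C + 1)) := by gcongr
    _ = ε := by field_simp

variable {F : Type*} [NormedAddCommGroup F] [NormedSpace ℝ F]

theorem AD.congr {f f' g' : ℝ → F} {a b : ℝ} (h : AD f f' a b) (he : ∀ᵐ x, x ∈ uIcc a b → f' x = g' x) :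
    AD f g' a b := by
  refine ⟨h.ac, ?_⟩
  filter_upwards [h.der, he] with x h1 h2 hx
  rw [← h2 hx]; exact h1 hx

theorem AD.congr_fun {f g f' : ℝ → F} {a b : ℝ} (h : AD f f' a b) (he : ∀ x, f x = g x) :
    AD g f' a b := by
  have : f = g := funext he
  exact this ▸ h

theorem AD.mono {f f' : ℝ → F} {a b c d : ℝ} (h : AD f f' a b) (hs : uIcc c d ⊆ uIcc a b) : AD f f' c d := by
  refine ⟨h.ac.mono hs, ?_⟩
  filter_upwards [h.der] with x h1 hx
  exact h1 (hs hx)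

theorem AD.const (c : F) (a b : ℝ) : AD (fun _ => c) (fun _ => 0) a b := by
  refine ⟨?_, Filter.Eventually.of_forall fun x _ => hasDerivAt_const _ _⟩
  exact (LipschitzOnWith.absolutelyContinuousOnInterval (K := 0) (LipschitzWith.const c).lipschitzOnWith)

theorem AD.add {f f' g g' : ℝ → F} {a b : ℝ} (hf : AD f f' a b) (hg : AD g g' a b) :
    AD (fun x => f x + g x) (fun x => f' x + g' x) a b := by
  refine ⟨hf.ac.add hg.ac, ?_⟩
  filter_upwards [hf.der, hg.der] with x h1 h2 hx
  exact (h1 hx).add (h2 hx)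

theorem AD.sub {f f' g g' : ℝ → F} {a b : ℝ} (hf : AD f f' a b) (hg : AD g g' a b) :
    AD (fun x => f x - g x) (fun x => f' x - g' x) a b := by
  refine ⟨hf.ac.sub hg.ac, ?_⟩
  filter_upwards [hf.der, hg.der] with x h1 h2 hx
  exact (h1 hx).sub (h2 hx)

theorem AD.neg {f f' : ℝ → F} {a b : ℝ} (hf : AD f f' a b) :
    AD (fun x => - f x) (fun x => - f' x) a b := by
  refine ⟨hf.ac.neg, ?_⟩
  filter_upwards [hf.der] with x h1 hx
  exact (h1 hx).neg

theorem AD.mul {𝕜 : Type*} [RCLike 𝕜] {f f' g g' : ℝ → 𝕜} {a b : ℝ} (hf : AD f f' a b) (hg : AD g g' a b) :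
    AD (fun x => f x * g x) (fun x => f' x * g x + f x * g' x) a b := by
  refine ⟨hf.ac.smul hg.ac, ?_⟩
  filter_upwards [hf.der, hg.der] with x h1 h2 hx
  exact (h1 hx).mul (h2 hx)

theorem AD.const_mul {𝕜 : Type*} [RCLike 𝕜] {f f' : ℝ → 𝕜} {a b : ℝ} (c : 𝕜) (hf : AD f f' a b) :
    AD (fun x => c * f x) (fun x => c * f' x) a b := by
  refine ((AD.const c a b).mul hf).congr ?_
  exact Filter.Eventually.of_forall fun x _ => by simp

theorem AD.clm {G : Type*} [NormedAddCommGroup G] [NormedSpace ℝ G] {f f' : ℝ → F} {a b : ℝ} (T : F →L[ℝ] G)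
    (hf : AD f f' a b) : AD (fun x => T (f x)) (fun x => T (f' x)) a b := by
  refine ⟨ac_of_le hf.ac (norm_nonneg T) ?_, ?_⟩
  · intro x _ y _
    rw [dist_eq_norm, dist_eq_norm, ← map_sub]
    exact T.le_opNorm _
  · filter_upwards [hf.der] with x h1 hx
    exact T.hasFDerivAt.comp_hasDerivAt x (h1 hx)

theorem AD.re {f f' : ℝ → ℂ} {a b : ℝ} (hf : AD f f' a b) : AD (fun x => (f x).re) (fun x => (f' x).re) a b :=
  hf.clm Complex.reCLM

theorem AD.conj {f f' : ℝ → ℂ} {a b : ℝ} (hf : AD f f' a b) :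
    AD (fun x => (starRingEnd ℂ) (f x)) (fun x => (starRingEnd ℂ) (f' x)) a b :=
  hf.clm Complex.conjCLE.toContinuousLinearMap

theorem AD.integral [CompleteSpace F] {f : ℝ → F} {a b c : ℝ} (hf : IntervalIntegrable f volume a b) (hc : c ∈ uIcc a b) :
    AD (fun x => ∫ t in c..x, f t) f a b := by
  refine ⟨?_, ?_⟩
  · refine ac_of_le (hf.norm.absolutelyContinuousOnInterval_intervalIntegral hc) zero_le_one ?_
    intro x hx y hy
    have hs : ∀ u ∈ uIcc a b, ∀ v ∈ uIcc a b, IntervalIntegrable f volume u v := fun u hu v hv =>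
      hf.mono_set (uIcc_subset_uIcc hu hv)
    rw [dist_eq_norm, dist_eq_norm, one_mul,
      intervalIntegral.integral_interval_sub_left (hs _ hc _ hx) (hs _ hc _ hy),
      intervalIntegral.integral_interval_sub_left (hs _ hc _ hx).norm (hs _ hc _ hy).norm, Real.norm_eq_abs]
    exact intervalIntegral.norm_integral_le_abs_integral_norm
  · filter_upwards [hf.ae_hasDerivAt_integral] with x h hx
    exact h hx c hc

theorem AD.inv {f f' : ℝ → ℂ} {a b m : ℝ} (hf : AD f f' a b) (hm : 0 < m) (h : ∀ x ∈ uIcc a b, m ≤ ‖f x‖) :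
    AD (fun x => (f x)⁻¹) (fun x => - f' x / (f x)^2) a b := by
  refine ⟨ac_of_le hf.ac (C := (m*m)⁻¹) (by positivity) ?_, ?_⟩
  · intro x hx y hy
    have h1 := h x hx
    have h2 := h y hy
    have n1 : f x ≠ 0 := norm_pos_iff.1 (lt_of_lt_of_le hm h1)
    have n2 : f y ≠ 0 := norm_pos_iff.1 (lt_of_lt_of_le hm h2)
    rw [dist_inv_inv₀ n1 n2, div_eq_inv_mul]
    gcongr
  · filter_upwards [hf.der] with x h1 hx
    exact (h1 hx).inv (norm_pos_iff.1 (lt_of_lt_of_le hm (h x hx)))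

theorem AD.exp {f f' : ℝ → ℝ} {a b : ℝ} (hf : AD f f' a b) :
    AD (fun x => Real.exp (f x)) (fun x => Real.exp (f x) * f' x) a b := by
  obtain ⟨M, hM⟩ := hf.ac.exists_bound
  have hl : ContDiffOn ℝ 1 Real.exp (Icc (-M) M) := Real.contDiff_exp.contDiffOn
  obtain ⟨K, hK⟩ := hl.exists_lipschitzOnWith (by decide) (convex_Icc _ _) isCompact_Icc
  refine ⟨ac_of_le hf.ac (C := K) K.2 ?_, ?_⟩
  · intro x hx y hy
    exact hK.dist_le_mul _ (abs_le.1 (hM x hx)) _ (abs_le.1 (hM y hy))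
  · filter_upwards [hf.der] with x h1 hx
    exact (h1 hx).exp

theorem AD.const_of_zero {f f' : ℝ → F} {a b : ℝ} (hf : AD f f' a b) (h0 : ∀ᵐ x, x ∈ uIcc a b → f' x = 0) :
    ∀ x ∈ uIcc a b, ∀ y ∈ uIcc a b, f x = f y := by
  obtain ⟨C, hC⟩ := hf.ac.const_of_ae_hasDerivAt_zero (by
    filter_upwards [hf.der, h0] with x h1 h2 hx
    rw [← h2 hx]; exact h1 hx)
  intro x hx y hy
  rw [hC x hx, hC y hy]

theorem AD.ftc [CompleteSpace F] {f f' : ℝ → F} {a b : ℝ} (hf : AD f f' a b) (hi : IntervalIntegrable f' volume a b) :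
    ∫ t in a..b, f' t = f b - f a := by
  have h := (hf.sub (AD.integral hi (c := a) left_mem_uIcc)).const_of_zero
    (Filter.Eventually.of_forall fun x _ => by simp) a left_mem_uIcc b right_mem_uIcc
  simp only [intervalIntegral.integral_same, sub_zero] at h
  rw [h]; abel

theorem AD.le {f f' : ℝ → ℝ} {a b : ℝ} (hab : a ≤ b) (hf : AD f f' a b) (h0 : ∀ᵐ x, x ∈ uIcc a b → f' x ≤ 0) :
    f b ≤ f a := by
  have h := hf.ac.integral_deriv_eq_sub
  have : ∫ x in a..b, deriv f x ≤ 0 := by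
    rw [intervalIntegral.integral_of_le hab]
    apply integral_nonpos_of_ae
    rw [Filter.EventuallyLE, ae_restrict_iff' measurableSet_Ioc]
    filter_upwards [hf.der, h0] with x h1 h2 hx
    have hx' : x ∈ uIcc a b := by rw [uIcc_of_le hab]; exact ⟨hx.1.le, hx.2⟩
    rw [(h1 hx').deriv]; exact h2 hx'
  linarith

theorem AD.gronwall {u u' β γ : ℝ → ℝ} {a b : ℝ} (hab : a ≤ b) (hu : AD u u' a b)
    (hβ : IntervalIntegrable β volume a b) (hγ : IntervalIntegrable γ volume a b)
    (hβ0 : ∀ x, 0 ≤ β x) (hγ0 : ∀ x, 0 ≤ γ x)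
    (h : ∀ᵐ x, x ∈ uIcc a b → u' x ≤ β x * u x + γ x) :
    u b ≤ (u a + ∫ t in a..b, γ t) * Real.exp (∫ t in a..b, β t) := by
  have hB := AD.integral hβ (c := a) left_mem_uIcc
  have hG := AD.integral hγ (c := a) left_mem_uIcc
  have hw := (hu.mul hB.neg.exp).sub hG
  have := hw.le hab (by
    filter_upwards [h] with x hx hxm
    have h1 := hx hxm
    have hxm' := hxm
    rw [uIcc_of_le hab] at hxm'
    have h2 : 0 ≤ ∫ t in a..x, β t := intervalIntegral.integral_nonneg hxm'.1 fun t _ => hβ0 t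
    have h3 : Real.exp (-∫ t in a..x, β t) ≤ 1 := Real.exp_le_one_iff.2 (by linarith)
    have h4 := Real.exp_pos (-∫ t in a..x, β t)
    nlinarith [mul_le_mul_of_nonneg_right h1 h4.le, mul_le_mul_of_nonneg_right h3 (hγ0 x)])
  simp only [intervalIntegral.integral_same, neg_zero, Real.exp_zero, mul_one, sub_zero] at this
  have h5 : u b * Real.exp (-∫ t in a..b, β t) ≤ u a + ∫ t in a..b, γ t := by linarith
  calc u b = (u b * Real.exp (-∫ t in a..b, β t)) * Real.exp (∫ t in a..b, β t) := by
        rw [mul_assoc, ← Real.exp_add]; simp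
    _ ≤ _ := by gcongr

theorem AD.gronwall_lower {u u' β : ℝ → ℝ} {a b : ℝ} (hab : a ≤ b) (hu : AD u u' a b)
    (hβ : IntervalIntegrable β volume a b)
    (h : ∀ᵐ x, x ∈ uIcc a b → β x * u x ≤ u' x) :
    u a * Real.exp (∫ t in a..b, β t) ≤ u b := by
  have hB := AD.integral hβ (c := a) left_mem_uIcc
  have hw := (hu.mul hB.neg.exp).neg
  have := hw.le hab (by
    filter_upwards [h] with x hx hxm
    have h1 := hx hxm
    have h4 := Real.exp_pos (-∫ t in a..x, β t)
    nlinarith [mul_le_mul_of_nonneg_right h1 h4.le])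
  simp only [intervalIntegral.integral_same, neg_zero, Real.exp_zero, mul_one] at this
  calc _ ≤ (u b * Real.exp (-∫ t in a..b, β t)) * Real.exp (∫ t in a..b, β t) := by gcongr; linarith
    _ = u b := by rw [mul_assoc, ← Real.exp_add]; simp

end PD1
end CS

namespace CS
section PD2
open Set Filter Topology

abbrev W := EuclideanSpace ℂ (Fin 2)

/-- vector-valued data with Gram matrix the Hamiltonian -/
structure Coef where
  L : ℝ
  hL : 0 < L
  ev : Fin 2 → ℝ → W
  mev : ∀ i, Measurable (ev i)
  h : Fin 2 → Fin 2 → ℝ → ℝ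
  mh : ∀ i j, Measurable (h i j)
  gram : ∀ i j t, inner ℂ (ev i t) (ev j t) = (h i j t : ℂ)
  tr : ∀ t, h 0 0 t + h 1 1 t = 1

namespace Coef
variable (c : Coef)

def μ : Measure ℝ := volume.restrict (Ioc 0 c.L)

instance : IsFiniteMeasure c.μ := by unfold μ; infer_instance

abbrev K := Lp W 2 c.μ

theorem ae_iff {p : ℝ → Prop} : (∀ᵐ x ∂c.μ, p x) ↔ ∀ᵐ x, x ∈ Ioc 0 c.L → p x :=
  ae_restrict_iff' measurableSet_Ioc

theorem h_diag (i : Fin 2) (t : ℝ) : c.h i i t = ‖c.ev i t‖ ^ 2 := by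
  have := c.gram i i t
  rw [inner_self_eq_norm_sq_to_K] at this
  apply Complex.ofReal_injective
  rw [← this]; push_cast; rfl

theorem ev_le (i : Fin 2) (t : ℝ) : ‖c.ev i t‖ ≤ 1 := by
  have h0 := c.h_diag 0 t
  have h1 := c.h_diag 1 t
  have h2 := c.tr t
  have : ‖c.ev i t‖ ^ 2 ≤ 1 := by
    fin_cases i
    · simp only [Fin.zero_eta]; nlinarith [sq_nonneg ‖c.ev 1 t‖]
    · simp only [Fin.mk_one]; nlinarith [sq_nonneg ‖c.ev 0 t‖]
  nlinarith [norm_nonneg (c.ev i t)]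

theorem h_symm (i j : Fin 2) (t : ℝ) : c.h i j t = c.h j i t := by
  have h1 := c.gram i j t
  have h2 := c.gram j i t
  rw [← inner_conj_symm, h2, Complex.conj_ofReal] at h1
  exact_mod_cast h1.symm

theorem h_abs (i j : Fin 2) (t : ℝ) : |c.h i j t| ≤ 1 := by
  have h1 := norm_inner_le_norm (𝕜 := ℂ) (c.ev i t) (c.ev j t)
  rw [c.gram i j t, Complex.norm_real, Real.norm_eq_abs] at h1
  exact h1.trans (mul_le_one₀ (c.ev_le i t) (norm_nonneg _) (c.ev_le j t))

theorem h_det (t : ℝ) : (c.h 0 1 t) ^ 2 ≤ c.h 0 0 t * c.h 1 1 t := by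
  have h1 := norm_inner_le_norm (𝕜 := ℂ) (c.ev 0 t) (c.ev 1 t)
  rw [c.gram 0 1 t, Complex.norm_real, Real.norm_eq_abs] at h1
  rw [h_diag, h_diag, ← sq_abs, ← mul_pow]
  exact pow_le_pow_left₀ (abs_nonneg _) h1 2

/-- pointwise functional -/
def g (i : Fin 2) (f : ℝ → W) : ℝ → ℂ := (Ioc 0 c.L).indicator fun t => inner ℂ (c.ev i t) (f t)

theorem g_le (i : Fin 2) (f : ℝ → W) (t : ℝ) : ‖c.g i f t‖ ≤ ‖f t‖ := by
  unfold g
  refine (norm_indicator_le_norm_self _ _).trans ((norm_inner_le_norm _ _).trans ?_)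
  exact mul_le_of_le_one_left (norm_nonneg _) (c.ev_le i t)

theorem g_of_mem (i : Fin 2) (f : ℝ → W) {t : ℝ} (ht : t ∈ Ioc 0 c.L) : c.g i f t = inner ℂ (c.ev i t) (f t) :=
  indicator_of_mem ht _

theorem g_of_not_mem (i : Fin 2) (f : ℝ → W) {t : ℝ} (ht : t ∉ Ioc 0 c.L) : c.g i f t = 0 :=
  indicator_of_notMem ht _

theorem g_congr (i : Fin 2) {f f' : ℝ → W} (h : f =ᵐ[c.μ] f') : c.g i f =ᵐ[volume] c.g i f' := by
  have := c.ae_iff.1 h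
  filter_upwards [this] with t ht
  by_cases hm : t ∈ Ioc 0 c.L
  · rw [g_of_mem _ _ _ hm, g_of_mem _ _ _ hm, ht hm]
  · rw [g_of_not_mem _ _ _ hm, g_of_not_mem _ _ _ hm]

theorem f_int (f : c.K) : Integrable f c.μ := (Lp.memLp f).integrable one_le_two

theorem g_int (i : Fin 2) (f : c.K) : Integrable (c.g i f) := by
  unfold g
  rw [integrable_indicator_iff measurableSet_Ioc]
  refine (c.f_int f).norm.mono ?_ ?_
  · exact (c.mev i).aestronglyMeasurable.inner (Lp.aestronglyMeasurable f)
  · refine Eventually.of_forall fun t => ?_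
    rw [norm_norm]
    exact (norm_inner_le_norm _ _).trans (mul_le_of_le_one_left (norm_nonneg _) (c.ev_le i t))

def F (i : Fin 2) (f : c.K) (x : ℝ) : ℂ := ∫ t in (0:ℝ)..x, c.g i f t

theorem F_AD (i : Fin 2) (f : c.K) (a b : ℝ) : AD (c.F i f) (c.g i f) a b := by
  have := AD.integral ((c.g_int i f).intervalIntegrable (a := -(|a| + |b|)) (b := |a| + |b|)) (c := 0)
    (by rw [mem_uIcc]; left; constructor <;> linarith [abs_nonneg a, abs_nonneg b])
  refine this.mono (uIcc_subset_uIcc ?_ ?_) <;> rw [mem_uIcc] <;> left <;>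
  constructor <;> linarith [abs_nonneg a, abs_nonneg b, neg_abs_le a, neg_abs_le b, le_abs_self a, le_abs_self b]

theorem F_cont (i : Fin 2) (f : c.K) : Continuous (c.F i f) :=
  intervalIntegral.continuous_primitive (fun _ _ => (c.g_int i f).intervalIntegrable) 0

theorem F_add (i : Fin 2) (f f' : c.K) (x : ℝ) : c.F i (f + f') x = c.F i f x + c.F i f' x := by
  unfold F
  rw [← intervalIntegral.integral_add (c.g_int i f).intervalIntegrable (c.g_int i f').intervalIntegrable]
  apply intervalIntegral.integral_congr_ae
  filter_upwards [c.g_congr i (Lp.coeFn_add f f')] with t ht _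
  rw [ht]
  by_cases hm : t ∈ Ioc 0 c.L
  · simp only [g_of_mem _ _ _ hm, Pi.add_apply, inner_add_right]
  · simp only [g_of_not_mem _ _ _ hm, add_zero]

theorem F_smul (i : Fin 2) (a : ℂ) (f : c.K) (x : ℝ) : c.F i (a • f) x = a * c.F i f x := by
  unfold F
  rw [← intervalIntegral.integral_const_mul]
  apply intervalIntegral.integral_congr_ae
  filter_upwards [c.g_congr i (Lp.coeFn_smul a f)] with t ht _
  rw [ht]
  by_cases hm : t ∈ Ioc 0 c.L
  · simp only [g_of_mem _ _ _ hm, Pi.smul_apply, inner_smul_right]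
  · simp only [g_of_not_mem _ _ _ hm, mul_zero]

@[simp] theorem F_zero_right (i : Fin 2) (f : c.K) : c.F i f 0 = 0 := by simp [F]

theorem mkOp_exists (T : c.K → ℝ → W) (hm : ∀ f, MemLp (T f) 2 c.μ)
    (ha : ∀ f f', T (f + f') =ᵐ[c.μ] T f + T f') (hs : ∀ (a : ℂ) f, T (a • f) =ᵐ[c.μ] a • T f)
    (C : ℝ) (hb : ∀ f, ‖(hm f).toLp (T f)‖ ≤ C * ‖f‖) : ∃ A : c.K →L[ℂ] c.K, ∀ f, A f =ᵐ[c.μ] T f := by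
  refine ⟨LinearMap.mkContinuous ⟨⟨fun f => (hm f).toLp (T f), ?_⟩, ?_⟩ C hb, fun f => ?_⟩
  · intro f f'
    rw [← MemLp.toLp_add, MemLp.toLp_eq_toLp_iff]
    exact ha f f'
  · intro a f
    simp only [RingHom.id_apply]
    rw [← MemLp.toLp_const_smul, MemLp.toLp_eq_toLp_iff]
    exact hs a f
  · exact (hm f).coeFn_toLp

theorem P_exists (x : ℝ) : ∃ A : c.K →L[ℂ] c.K, ∀ f : c.K, A f =ᵐ[c.μ] (Iic x).indicator f := by
  have hm : ∀ f : c.K, MemLp ((Iic x).indicator f) 2 c.μ := fun f => (Lp.memLp f).indicator measurableSet_Iic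
  refine c.mkOp_exists (fun f => (Iic x).indicator f) hm ?_ ?_ 1 ?_
  · intro f f'
    filter_upwards [Lp.coeFn_add f f'] with t ht
    by_cases h : t ∈ Iic x
    · simp only [indicator_of_mem h, Pi.add_apply, ht]
    · simp only [indicator_of_notMem h, Pi.add_apply, add_zero]
  · intro a f
    filter_upwards [Lp.coeFn_smul a f] with t ht
    by_cases h : t ∈ Iic x
    · simp only [indicator_of_mem h, Pi.smul_apply, ht]
    · simp only [indicator_of_notMem h, Pi.smul_apply, smul_zero]
  · intro f
    rw [one_mul]
    apply Lp.norm_le_norm_of_ae_le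
    filter_upwards [(hm f).coeFn_toLp] with t ht
    rw [ht]
    exact norm_indicator_le_norm_self _ _

def P (x : ℝ) : c.K →L[ℂ] c.K := (c.P_exists x).choose
theorem P_ae (x : ℝ) (f : c.K) : c.P x f =ᵐ[c.μ] (Iic x).indicator f := (c.P_exists x).choose_spec f

theorem e_memLp (i : Fin 2) : MemLp (c.ev i) 2 c.μ :=
  MemLp.of_bound (c.mev i).aestronglyMeasurable 1 (Eventually.of_forall (c.ev_le i))

def e (i : Fin 2) : c.K := (c.e_memLp i).toLp _
theorem e_ae (i : Fin 2) : c.e i =ᵐ[c.μ] c.ev i := (c.e_memLp i).coeFn_toLp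

theorem P_sa (x : ℝ) (u v : c.K) : inner ℂ (c.P x u) v = inner ℂ u (c.P x v) := by
  rw [L2.inner_def, L2.inner_def]
  apply integral_congr_ae
  filter_upwards [c.P_ae x u, c.P_ae x v] with t h1 h2
  rw [h1, h2]
  by_cases h : t ∈ Iic x
  · simp only [indicator_of_mem h]
  · simp only [indicator_of_notMem h, inner_zero_left, inner_zero_right]

theorem P_mul {x y : ℝ} (hxy : x ≤ y) (u : c.K) : c.P x (c.P y u) = c.P x u ∧ c.P y (c.P x u) = c.P x u := by
  constructor
  · apply Lp.ext
    filter_upwards [c.P_ae x (c.P y u), c.P_ae y u, c.P_ae x u] with t h1 h2 h3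
    rw [h1, h3]
    by_cases h : t ∈ Iic x
    · have h' : t ∈ Iic y := le_trans h hxy
      simp only [indicator_of_mem h, h2, indicator_of_mem h']
    · simp only [indicator_of_notMem h]
  · apply Lp.ext
    filter_upwards [c.P_ae y (c.P x u), c.P_ae x u] with t h1 h2
    rw [h1, h2]
    by_cases h : t ∈ Iic x
    · have h' : t ∈ Iic y := le_trans h hxy
      simp only [indicator_of_mem h', h2]
    · by_cases h' : t ∈ Iic y
      · simp only [indicator_of_mem h', h2]
      · simp only [indicator_of_notMem h, indicator_of_notMem h']

theorem P_L (u : c.K) : c.P c.L u = u := by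
  apply Lp.ext
  have hm : ∀ᵐ t ∂c.μ, t ∈ Ioc 0 c.L := ae_restrict_mem measurableSet_Ioc
  filter_upwards [c.P_ae c.L u, hm] with t h1 h2
  rw [h1, indicator_of_mem]
  exact h2.2

theorem P_zero (u : c.K) : c.P 0 u = 0 := by
  apply Lp.ext
  have hm : ∀ᵐ t ∂c.μ, t ∈ Ioc 0 c.L := ae_restrict_mem measurableSet_Ioc
  filter_upwards [c.P_ae 0 u, hm, Lp.coeFn_zero W 2 c.μ] with t h1 h2 h3
  rw [h1, indicator_of_notMem, h3]; · rfl
  exact not_le.2 h2.1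

theorem inner_eP (i : Fin 2) {x : ℝ} (hx : 0 ≤ x) (f : c.K) : inner ℂ (c.e i) (c.P x f) = c.F i f x := by
  rw [L2.inner_def]
  unfold F
  rw [intervalIntegral.integral_of_le hx, ← integral_indicator measurableSet_Ioc]
  unfold μ
  rw [← integral_indicator measurableSet_Ioc]
  apply integral_congr_ae
  filter_upwards [c.ae_iff.1 (c.e_ae i), c.ae_iff.1 (c.P_ae x f)] with t h1 h2
  by_cases hm : t ∈ Ioc 0 c.L
  · simp only [indicator_of_mem hm]
    erw [h1 hm, h2 hm]
    by_cases h : t ≤ x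
    · rw [indicator_of_mem (show t ∈ Iic x from h), indicator_of_mem (show t ∈ Ioc 0 x from ⟨hm.1, h⟩), g_of_mem _ _ _ hm]
      rfl
    · rw [indicator_of_notMem (show t ∉ Iic x from h), indicator_of_notMem (fun h' => h h'.2), inner_zero_right]
  · rw [indicator_of_notMem hm]
    by_cases h : t ∈ Ioc 0 x
    · rw [indicator_of_mem h, g_of_not_mem _ _ _ hm]
    · rw [indicator_of_notMem h]

theorem inner_e (i : Fin 2) (f : c.K) : inner ℂ (c.e i) f = c.F i f c.L := by
  rw [← c.inner_eP i c.hL.le, P_L]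

theorem P_norm (x : ℝ) (f : c.K) : ‖c.P x f‖ ≤ ‖f‖ := by
  apply Lp.norm_le_norm_of_ae_le
  filter_upwards [c.P_ae x f] with t ht
  rw [ht]
  exact norm_indicator_le_norm_self _ _

theorem F_le (i : Fin 2) {x : ℝ} (hx : 0 ≤ x) (f : c.K) : ‖c.F i f x‖ ≤ ‖c.e i‖ * ‖f‖ := by
  rw [← inner_eP _ _ hx]
  exact (norm_inner_le_norm _ _).trans (by gcongr; exact c.P_norm x f)

def vf (f : c.K) (x : ℝ) : W := c.F 1 f x • c.ev 0 x - c.F 0 f x • c.ev 1 x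

theorem vf_le (f : c.K) (x : ℝ) : ‖c.vf f x‖ ≤ ‖c.F 1 f x‖ + ‖c.F 0 f x‖ := by
  unfold vf
  refine (norm_sub_le _ _).trans ?_
  rw [norm_smul, norm_smul]
  gcongr <;> exact mul_le_of_le_one_right (norm_nonneg _) (c.ev_le _ _)

theorem vf_bd (f : c.K) : ∀ᵐ x ∂c.μ, ‖c.vf f x‖ ≤ (‖c.e 1‖ + ‖c.e 0‖) * ‖f‖ := by
  rw [ae_iff]
  refine Eventually.of_forall fun x hx => (c.vf_le f x).trans ?_
  rw [add_mul]
  exact add_le_add (c.F_le 1 hx.1.le f) (c.F_le 0 hx.1.le f)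

theorem vf_memLp (f : c.K) : MemLp (c.vf f) 2 c.μ := by
  refine MemLp.of_bound ?_ _ (c.vf_bd f)
  exact ((c.F_cont 1 f).measurable.smul (c.mev 0)).sub ((c.F_cont 0 f).measurable.smul (c.mev 1)) |>.aestronglyMeasurable

theorem V_exists : ∃ A : c.K →L[ℂ] c.K, ∀ f : c.K, A f =ᵐ[c.μ] c.vf f := by
  refine c.mkOp_exists c.vf c.vf_memLp ?_ ?_
    (((measureUnivNNReal c.μ : ℝ) ^ ((2:ℝ≥0∞).toReal)⁻¹) * (‖c.e 1‖ + ‖c.e 0‖)) ?_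
  · intro f f'
    refine Eventually.of_forall fun x => ?_
    simp only [vf, Pi.add_apply, F_add, add_smul]; abel
  · intro a f
    refine Eventually.of_forall fun x => ?_
    simp only [vf, Pi.smul_apply, F_smul, mul_smul, smul_sub]
  · intro f
    rw [mul_assoc]
    apply Lp.norm_le_of_ae_bound (by positivity)
    filter_upwards [c.vf_bd f, (c.vf_memLp f).coeFn_toLp] with t h1 h2
    rw [h2]; exact h1

def V : c.K →L[ℂ] c.K := c.V_exists.choose
theorem V_ae (f : c.K) : c.V f =ᵐ[c.μ] c.vf f := c.V_exists.choose_spec f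

end Coef
end PD2
end CS

namespace CS
section PD3
open Set Filter Topology ContinuousLinearMap

namespace Coef
variable (c : Coef)

theorem inner_int (u v : c.K) : inner ℂ u v = ∫ t in (0:ℝ)..c.L, inner ℂ (u t) (v t) := by
  rw [L2.inner_def, intervalIntegral.integral_of_le c.hL.le]; rfl

theorem inner_V (f f' : c.K) : inner ℂ f (c.V f') =
    ∫ t in (0:ℝ)..c.L, ((starRingEnd ℂ) (c.g 0 f t) * c.F 1 f' t - (starRingEnd ℂ) (c.g 1 f t) * c.F 0 f' t) := by
  rw [inner_int]
  apply intervalIntegral.integral_congr_ae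
  filter_upwards [c.ae_iff.1 (c.V_ae f')] with t h1 hm
  rw [uIoc_of_le c.hL.le] at hm
  rw [h1 hm, g_of_mem _ _ _ hm, g_of_mem _ _ _ hm, vf, inner_sub_right, inner_smul_right, inner_smul_right,
    inner_conj_symm, inner_conj_symm]
  ring

theorem g_ii (i : Fin 2) (f : c.K) (a b : ℝ) : IntervalIntegrable (c.g i f) volume a b :=
  (c.g_int i f).intervalIntegrable

theorem g_conj_ii (i : Fin 2) (f : c.K) (a b : ℝ) :
    IntervalIntegrable (fun t => (starRingEnd ℂ) (c.g i f t)) volume a b :=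
  (Complex.conjCLE.toContinuousLinearMap.integrable_comp (c.g_int i f)).intervalIntegrable

theorem conj_F_cont (i : Fin 2) (f : c.K) : Continuous fun t => (starRingEnd ℂ) (c.F i f t) :=
  Complex.continuous_conj.comp (c.F_cont i f)

theorem green (f f' : c.K) : inner ℂ f (c.V f') - inner ℂ (c.V f) f' =
    (starRingEnd ℂ) (c.F 0 f c.L) * c.F 1 f' c.L - (starRingEnd ℂ) (c.F 1 f c.L) * c.F 0 f' c.L := by
  have h1 : ∀ i j : Fin 2, IntervalIntegrable (fun t => (starRingEnd ℂ) (c.g i f t) * c.F j f' t) volume 0 c.L :=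
    fun i j => (c.g_conj_ii i f _ _).mul_continuousOn (c.F_cont j f').continuousOn
  have h2 : ∀ i j : Fin 2, IntervalIntegrable (fun t => (starRingEnd ℂ) (c.F i f t) * c.g j f' t) volume 0 c.L :=
    fun i j => (c.g_ii j f' _ _).continuousOn_mul (c.conj_F_cont i f).continuousOn
  have e2 : inner ℂ (c.V f) f' = ∫ t in (0:ℝ)..c.L, ((starRingEnd ℂ) (c.F 1 f t) * c.g 0 f' t
      - (starRingEnd ℂ) (c.F 0 f t) * c.g 1 f' t) := by
    rw [inner_int]
    apply intervalIntegral.integral_congr_ae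
    filter_upwards [c.ae_iff.1 (c.V_ae f)] with t h1 hm
    rw [uIoc_of_le c.hL.le] at hm
    rw [h1 hm, g_of_mem _ _ _ hm, g_of_mem _ _ _ hm, vf, inner_sub_left, inner_smul_left, inner_smul_left]
  rw [inner_V, e2, ← intervalIntegral.integral_sub ((h1 0 1).sub (h1 1 0)) ((h2 1 0).sub (h2 0 1))]
  have hD := ((c.F_AD 0 f 0 c.L).conj.mul (c.F_AD 1 f' 0 c.L)).sub ((c.F_AD 1 f 0 c.L).conj.mul (c.F_AD 0 f' 0 c.L))
  have := hD.ftc (((h1 0 1).add (h2 0 1)).sub ((h1 1 0).add (h2 1 0)))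
  simp only [F_zero_right, mul_zero, sub_zero] at this
  rw [← this]
  apply intervalIntegral.integral_congr
  intro t _
  simp only
  ring

theorem adj (x : c.K) : adjoint c.V x = c.V x - inner ℂ (c.e 1) x • c.e 0 + inner ℂ (c.e 0) x • c.e 1 := by
  apply ext_inner_right ℂ
  intro v
  rw [adjoint_inner_left, inner_add_left, inner_sub_left, inner_smul_left, inner_smul_left]
  have := c.green x v
  rw [inner_e, inner_e, inner_e, inner_e]
  linear_combination this

theorem T_ae (f : c.K) : ∀ᵐ x, x ∈ Ioc 0 c.L → (adjoint c.V f : c.K) x =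
    (c.F 0 f c.L - c.F 0 f x) • c.ev 1 x - (c.F 1 f c.L - c.F 1 f x) • c.ev 0 x := by
  rw [← ae_iff, adj]
  filter_upwards [Lp.coeFn_add (c.V f - inner ℂ (c.e 1) f • c.e 0) (inner ℂ (c.e 0) f • c.e 1),
    Lp.coeFn_sub (c.V f) (inner ℂ (c.e 1) f • c.e 0), Lp.coeFn_smul (inner ℂ (c.e 1) f) (c.e 0),
    Lp.coeFn_smul (inner ℂ (c.e 0) f) (c.e 1), c.V_ae f, c.e_ae 0, c.e_ae 1] with x h1 h2 h3 h4 h5 h6 h7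
  rw [h1, Pi.add_apply, h2, Pi.sub_apply, h3, h4, Pi.smul_apply, Pi.smul_apply, h5, h6, h7, vf, inner_e, inner_e,
    sub_smul, sub_smul]
  abel

theorem V_pow_bd (f : c.K) (n : ℕ) : ∀ᵐ x, x ∈ Ioc 0 c.L → ‖((c.V ^ (n+1)) f : c.K) x‖ ≤
    (‖c.e 1‖ + ‖c.e 0‖) * ‖f‖ * ((2 * x) ^ n / n.factorial) := by
  induction n with
  | zero =>
    filter_upwards [c.ae_iff.1 (c.V_ae f), c.ae_iff.1 (c.vf_bd f)] with x h1 h2 hx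
    rw [zero_add, pow_one, h1 hx]
    simpa using h2 hx
  | succ n ih =>
    set M := (‖c.e 1‖ + ‖c.e 0‖) * ‖f‖ with hM
    have hM0 : 0 ≤ M := by positivity
    set f' := (c.V ^ (n+1)) f with hf'
    have e1 : (c.V ^ (n+1+1)) f = c.V f' := by rw [pow_succ']; rfl
    rw [e1]
    have hF : ∀ i : Fin 2, ∀ x ∈ Ioc 0 c.L, ‖c.F i f' x‖ ≤ M * (2 ^ n * x ^ (n+1) / (n+1).factorial) := by
      intro i x hx
      unfold F
      have : ∫ t in (0:ℝ)..x, M * ((2 * t) ^ n / n.factorial) = M * (2 ^ n * x ^ (n+1) / (n+1).factorial) := by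
        rw [intervalIntegral.integral_const_mul, intervalIntegral.integral_div]
        simp_rw [mul_pow]
        rw [intervalIntegral.integral_const_mul, integral_pow, Nat.factorial_succ]
        push_cast
        have : (n.factorial : ℝ) ≠ 0 := by positivity
        field_simp
        ring
      rw [← this]
      apply intervalIntegral.norm_integral_le_of_norm_le hx.1.le
      · filter_upwards [ih] with t ht htm
        exact (c.g_le i f' t).trans (ht ⟨htm.1, htm.2.trans hx.2⟩)
      · apply Continuous.intervalIntegrable; fun_prop
    filter_upwards [c.ae_iff.1 (c.V_ae f')] with x h1 hx
    rw [h1 hx]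
    refine (c.vf_le f' x).trans ((add_le_add (hF 1 x hx) (hF 0 x hx)).trans (le_of_eq ?_))
    rw [mul_pow]; ring

theorem qn (z : ℂ) : Tendsto (fun n : ℕ => ‖(z • c.V) ^ n‖) atTop (𝓝 0) := by
  set A := ((measureUnivNNReal c.μ : ℝ) ^ ((2:ℝ≥0∞).toReal)⁻¹) with hA
  have hA0 : 0 ≤ A := by positivity
  set M := (‖c.e 1‖ + ‖c.e 0‖) with hM
  have hM0 : 0 ≤ M := by positivity
  have hL := c.hL
  rw [← tendsto_add_atTop_iff_nat 1]
  have hb : ∀ n : ℕ, ‖(z • c.V) ^ (n+1)‖ ≤ (‖z‖ * A * M) * ((2 * c.L * ‖z‖) ^ n / n.factorial) := by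
    intro n
    have h1 : ‖c.V ^ (n+1)‖ ≤ A * M * ((2 * c.L) ^ n / n.factorial) := by
      apply ContinuousLinearMap.opNorm_le_bound _ (by positivity)
      intro f
      have : ‖(c.V ^ (n+1)) f‖ ≤ A * (M * ‖f‖ * ((2 * c.L) ^ n / n.factorial)) := by
        apply Lp.norm_le_of_ae_bound (by positivity)
        rw [ae_iff]
        filter_upwards [c.V_pow_bd f n] with x h hx
        refine (h hx).trans ?_
        have := hx.1.le
        have := hx.2
        gcongr
      refine this.trans (le_of_eq ?_); ring
    rw [smul_pow, norm_smul, norm_pow]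
    calc ‖z‖ ^ (n+1) * ‖c.V ^ (n+1)‖ ≤ ‖z‖ ^ (n+1) * (A * M * ((2 * c.L) ^ n / n.factorial)) := by gcongr
      _ = _ := by rw [pow_succ, mul_pow (2 * c.L)]; ring
  have ht := (FloorSemiring.tendsto_pow_div_factorial_atTop (2 * c.L * ‖z‖)).const_mul (‖z‖ * A * M)
  rw [mul_zero] at ht
  exact squeeze_zero (fun _ => norm_nonneg _) hb ht

theorem F_P {x s : ℝ} (hx : 0 ≤ x) (hs : x ≤ s) (i : Fin 2) (f : c.K) : c.F i (c.P x f) s = c.F i f x := by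
  rw [← inner_eP _ _ (hx.trans hs), (c.P_mul hs f).2, inner_eP _ _ hx]

theorem PT {x : ℝ} (hx : x ∈ Icc 0 c.L) (u : c.K) : c.P x (adjoint c.V (c.P x u)) = adjoint c.V (c.P x u) := by
  apply Lp.ext
  filter_upwards [c.P_ae x (adjoint c.V (c.P x u)), c.ae_iff.2 (c.T_ae (c.P x u)),
    ae_restrict_mem (μ := volume) measurableSet_Ioc] with t h1 h2 _
  rw [h1]
  by_cases h : t ∈ Iic x
  · rw [indicator_of_mem h]
  · rw [indicator_of_notMem h, h2, c.F_P hx.1 hx.2, c.F_P hx.1 hx.2, c.F_P hx.1 (not_le.1 h).le,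
      c.F_P hx.1 (not_le.1 h).le]
    simp

/-- primitives of the entries -/
def I (i j : Fin 2) (x : ℝ) : ℝ := ∫ t in (0:ℝ)..x, c.h i j t

theorem h_ii (i j : Fin 2) (a b : ℝ) : IntervalIntegrable (c.h i j) volume a b := by
  refine (intervalIntegrable_const (c := (1:ℝ))).mono_fun (c.mh i j).aestronglyMeasurable ?_
  refine Eventually.of_forall fun t => ?_
  rw [Real.norm_eq_abs]; simpa using c.h_abs i j t

theorem gramP (i j : Fin 2) {x : ℝ} (hx : x ∈ Icc 0 c.L) : inner ℂ (c.e i) (c.P x (c.e j)) = (c.I i j x : ℂ) := by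
  rw [inner_eP _ _ hx.1]
  unfold F I
  rw [← intervalIntegral.integral_ofReal]
  apply intervalIntegral.integral_congr_ae
  filter_upwards [c.g_congr i (c.e_ae j)] with t ht hm
  rw [uIoc_of_le hx.1] at hm
  rw [ht, g_of_mem _ _ _ ⟨hm.1, hm.2.trans hx.2⟩, gram]

theorem I_tr (x : ℝ) : c.I 0 0 x + c.I 1 1 x = x := by
  unfold I
  rw [← intervalIntegral.integral_add (c.h_ii _ _ _ _) (c.h_ii _ _ _ _)]
  simp [c.tr]

end Coef
end PD3
end CS

namespace CS
section PD4
open Set Filter Topology ContinuousLinearMap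

theorem qform_real {α β c : ℝ} (hα : 0 ≤ α) (hβ : 0 ≤ β) (h : c ^ 2 ≤ α * β) (x u : ℝ) :
    0 ≤ α * x ^ 2 - 2 * c * (x * u) + β * u ^ 2 := by
  rcases hα.eq_or_lt with h0 | h0
  · have hc : c = 0 := by
      rw [← h0, zero_mul] at h
      exact pow_eq_zero_iff two_ne_zero |>.1 (le_antisymm h (sq_nonneg c))
    rw [← h0, hc]; nlinarith [mul_nonneg hβ (sq_nonneg u)]
  · have : α * (α * x ^ 2 - 2 * c * (x * u) + β * u ^ 2) = (α * x - c * u) ^ 2 + (α * β - c ^ 2) * u ^ 2 := by ring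
    have h2 : 0 ≤ α * (α * x ^ 2 - 2 * c * (x * u) + β * u ^ 2) := by
      rw [this]; have := sub_nonneg.2 h; positivity
    exact nonneg_of_mul_nonneg_right h2 h0

/-- the quadratic form -/
def qN (a b c : ℝ) (f k : ℂ) : ℝ := b * ‖f‖ ^ 2 - 2 * c * ((starRingEnd ℂ) f * k).re + a * ‖k‖ ^ 2

theorem qN_nonneg {α β c : ℝ} (hα : 0 ≤ α) (hβ : 0 ≤ β) (h : c ^ 2 ≤ α * β) (f k : ℂ) :
    0 ≤ qN α β c f k := by
  have h1 := qform_real hβ hα (by linarith : c ^ 2 ≤ β * α) f.re k.re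
  have h2 := qform_real hβ hα (by linarith : c ^ 2 ≤ β * α) f.im k.im
  unfold qN
  rw [← Complex.normSq_eq_norm_sq, ← Complex.normSq_eq_norm_sq, Complex.normSq_apply, Complex.normSq_apply]
  simp only [Complex.mul_re, Complex.conj_re, Complex.conj_im]
  nlinarith

theorem qN_lower {a b c δ : ℝ} (ha : δ ≤ a) (hb : δ ≤ b) (h : c ^ 2 ≤ (a - δ) * (b - δ)) (f k : ℂ) :
    δ * (‖f‖ ^ 2 + ‖k‖ ^ 2) ≤ qN a b c f k := by
  have := qN_nonneg (sub_nonneg.2 ha) (sub_nonneg.2 hb) h f k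
  unfold qN at *
  linarith

theorem qN_mul (a b c : ℝ) (f k : ℂ) :
    a * qN a b c f k = ‖a * k - c * f‖ ^ 2 + (a * b - c ^ 2) * ‖f‖ ^ 2 := by
  unfold qN
  simp only [← Complex.normSq_eq_norm_sq, Complex.normSq_apply]
  simp
  ring

theorem two_mul_le_sq (x y : ℝ) : 2 * (x * y) ≤ x ^ 2 + y ^ 2 := by nlinarith [sq_nonneg (x - y)]

theorem qN_im {a b c : ℝ} (ha : 0 < a) (hD : 0 ≤ a * b - c ^ 2) (f k : ℂ) :
    2 * (Real.sqrt (a * b - c ^ 2) * |((starRingEnd ℂ) f * k).im|) ≤ qN a b c f k := by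
  have h1 := qN_mul a b c f k
  have h2 : ((starRingEnd ℂ) f * (a * k - c * f)).im = a * ((starRingEnd ℂ) f * k).im := by
    simp; ring
  have h3 : a * |((starRingEnd ℂ) f * k).im| ≤ ‖f‖ * ‖a * k - c * f‖ := by
    rw [← abs_of_pos ha, ← abs_mul, abs_of_pos ha, ← h2]
    refine (Complex.abs_im_le_norm _).trans ?_
    rw [norm_mul, RCLike.norm_conj]
  have h4 := two_mul_le_sq (Real.sqrt (a * b - c ^ 2) * ‖f‖) ‖a * k - c * f‖
  rw [mul_pow, Real.sq_sqrt hD] at h4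
  have h5 := mul_le_mul_of_nonneg_left h3 (Real.sqrt_nonneg (a * b - c ^ 2))
  have : a * (2 * (Real.sqrt (a * b - c ^ 2) * |((starRingEnd ℂ) f * k).im|)) ≤ a * qN a b c f k := by
    nlinarith
  exact le_of_mul_le_mul_left this ha

theorem alg_X {a b c δ : ℝ} (hδ : 0 < δ) (ha : δ ≤ a) (hb : δ ≤ b) (h : c ^ 2 ≤ (a - δ) * (b - δ))
    (hab : a + b ≤ 2) (f k : ℂ) :
    2 * δ * ‖(starRingEnd ℂ) f * (b * k + c * f) - (starRingEnd ℂ) k * (a * f + c * k)‖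
      ≤ 3 * Real.sqrt δ * qN a b c f k := by
  have ha0 : 0 < a := lt_of_lt_of_le hδ ha
  have hD : 0 ≤ a * b - c ^ 2 := by nlinarith
  set w : ℂ := a * k - c * f with hw
  set v : ℂ := a * f + c * k with hv
  set κ := Real.sqrt δ with hκ
  have hκ0 : 0 < κ := Real.sqrt_pos.2 hδ
  have hκ2 : κ ^ 2 = δ := Real.sq_sqrt hδ.le
  have e1 : (a : ℂ) * ((starRingEnd ℂ) f * (b * k + c * f) - (starRingEnd ℂ) k * v)
      = - ((starRingEnd ℂ) w * v) + ((a * b - c ^ 2 : ℝ) : ℂ) * ((starRingEnd ℂ) f * k) := by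
    simp only [hw, hv, map_sub, map_mul, Complex.conj_ofReal]
    push_cast
    ring
  have h1 := qN_mul a b c f k
  have h2 : a * qN b a (-c) f k = ‖v‖ ^ 2 + (a * b - c ^ 2) * ‖k‖ ^ 2 := by
    unfold qN
    simp only [hv, ← Complex.normSq_eq_norm_sq, Complex.normSq_apply]
    simp
    ring
  have h3 : qN a b c f k + qN b a (-c) f k = (a + b) * (‖f‖ ^ 2 + ‖k‖ ^ 2) := by unfold qN; ring
  have h4 := qN_lower ha hb h f k
  have hN0 : 0 ≤ qN a b c f k := le_trans (by positivity) h4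
  have e2 : a * ‖(starRingEnd ℂ) f * (b * k + c * f) - (starRingEnd ℂ) k * v‖ ≤
      ‖w‖ * ‖v‖ + (a * b - c ^ 2) * (‖f‖ * ‖k‖) := by
    have := congrArg norm e1
    rw [norm_mul, Complex.norm_real, Real.norm_eq_abs, abs_of_pos ha0] at this
    rw [this]
    refine (norm_add_le _ _).trans (le_of_eq ?_)
    rw [norm_neg, norm_mul, norm_mul, norm_mul, RCLike.norm_conj, RCLike.norm_conj, Complex.norm_real,
      Real.norm_eq_abs, abs_of_nonneg hD]
  set n := ‖(starRingEnd ℂ) f * (b * k + c * f) - (starRingEnd ℂ) k * v‖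
  have e3 : a * (2 * κ * n) ≤ a * (qN a b c f k + κ ^ 2 * qN b a (-c) f k) := by
    have hr : a * (qN a b c f k + κ ^ 2 * qN b a (-c) f k) = (a * qN a b c f k) + κ ^ 2 * (a * qN b a (-c) f k) := by ring
    rw [hr, h1, h2]
    have i1 := two_mul_le_sq ‖w‖ (κ * ‖v‖)
    have i2 := two_mul_le_sq ‖f‖ (κ * ‖k‖)
    have i3 := mul_le_mul_of_nonneg_left i2 hD
    have i4 := mul_le_mul_of_nonneg_left e2 hκ0.le
    nlinarith
  have e4 := le_of_mul_le_mul_left e3 ha0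
  rw [hκ2] at e4
  have e5 : δ * qN b a (-c) f k ≤ 2 * qN a b c f k := by
    have : qN b a (-c) f k ≤ 2 * (‖f‖ ^ 2 + ‖k‖ ^ 2) := by
      have : (a + b) * (‖f‖ ^ 2 + ‖k‖ ^ 2) ≤ 2 * (‖f‖ ^ 2 + ‖k‖ ^ 2) := by gcongr
      linarith
    nlinarith
  calc 2 * δ * n = κ * (2 * κ * n) := by rw [← hκ2]; ring
    _ ≤ κ * (3 * qN a b c f k) := mul_le_mul_of_nonneg_left (by linarith) hκ0.le
    _ = _ := by ring

theorem norm_row {a c η : ℝ} (ha : |a| ≤ 2) (hc : |c| ≤ 1) (u v : ℂ) (hu : ‖u‖ ≤ η) (hv : ‖v‖ ≤ η) :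
    ‖(a:ℂ) * u - c * v‖ ≤ 3 * η := by
  refine (norm_sub_le _ _).trans ?_
  rw [norm_mul, norm_mul, Complex.norm_real, Complex.norm_real, Real.norm_eq_abs, Real.norm_eq_abs]
  have h0 : 0 ≤ η := (norm_nonneg _).trans hu
  have h1 : |a| * ‖u‖ ≤ 2 * η := by gcongr
  have h2 : |c| * ‖v‖ ≤ 1 * η := by gcongr
  linarith

theorem alg_sqrt {a b c δ x y w η : ℝ} (hδ : 0 < δ) (hδ1 : δ ≤ 1) (ha : δ ≤ a) (hb : δ ≤ b)
    (h : c ^ 2 ≤ (a - δ) * (b - δ)) (hab : a + b ≤ 2) (hx : |x| ≤ 1) (hy : |y| ≤ 1) (hw : |w| ≤ 1)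
    (e1 : |x - (a - δ)| ≤ η) (e2 : |w - c| ≤ η) (e3 : |y - (b - δ)| ≤ η) :
    Real.sqrt (a * b - c ^ 2) ≤ Real.sqrt (x * y - w ^ 2) + 4 * Real.sqrt δ + 6 * η / δ := by
  have hη : 0 ≤ η := (abs_nonneg _).trans e1
  have hc1 : |c| ≤ 1 := by
    rw [abs_le_one_iff_mul_self_le_one]; nlinarith [sq_nonneg (a - b)]
  rw [abs_le] at hx hy hw e1 e2 e3 hc1
  have key : a * b - c ^ 2 ≤ (x * y - w ^ 2) + 6 * (η + δ) := by
    have t1 : (a - δ) * (b - δ) - x * y ≤ 2 * η := by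
      have : (a - δ) * (b - δ) - x * y = (a - δ) * (b - δ - y) + y * (a - δ - x) := by ring
      rw [this]
      have u1 : (a - δ) * (b - δ - y) ≤ (2 - b - δ) * η := by nlinarith
      have u2 : |y * (a - δ - x)| ≤ 1 * η := by
        rw [abs_mul]
        apply mul_le_mul (abs_le.2 hy) (abs_le.2 ⟨by linarith, by linarith⟩) (abs_nonneg _) zero_le_one
      have := le_abs_self (y * (a - δ - x))
      nlinarith
    have t2 : w ^ 2 - c ^ 2 ≤ 2 * η := by
      have : w ^ 2 - c ^ 2 = (w - c) * (w + c) := by ring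
      rw [this]
      have u2 : |(w - c) * (w + c)| ≤ η * 2 := by
        rw [abs_mul]
        apply mul_le_mul (abs_le.2 e2) (abs_le.2 ⟨by linarith, by linarith⟩) (abs_nonneg _) hη
      have := le_abs_self ((w - c) * (w + c))
      linarith
    nlinarith
  have hs1 : Real.sqrt δ ≤ 1 := Real.sqrt_le_one.2 hδ1
  have hs0 : 0 < Real.sqrt δ := Real.sqrt_pos.2 hδ
  have hs2 : Real.sqrt δ ^ 2 = δ := Real.sq_sqrt hδ.le
  have hR : 0 ≤ Real.sqrt (x * y - w ^ 2) := Real.sqrt_nonneg _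
  have hR2 : x * y - w ^ 2 ≤ Real.sqrt (x * y - w ^ 2) ^ 2 := by
    rw [Real.sq_sqrt']; exact le_max_left _ _
  have hq : 6 * η / Real.sqrt δ ≤ 6 * η / δ := by
    gcongr
    nlinarith
  refine le_trans ?_ (add_le_add_right hq _)
  apply Real.sqrt_le_iff.2 ⟨by positivity, ?_⟩
  set s := Real.sqrt δ
  set R := Real.sqrt (x * y - w ^ 2)
  have hm : s * (6 * η / s) = 6 * η := by field_simp
  have : 0 ≤ 6 * η / s := by positivity
  nlinarith [mul_nonneg hR hs0.le, mul_nonneg hR this, sq_nonneg (6 * η / s)]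

set_option maxHeartbeats 1000000 in
theorem alg_main (f k φ0 φ1 z : ℂ) {a b c δ x y w ρ η : ℝ} (hδ : 0 < δ) (hδ1 : δ ≤ 1) (ha : δ ≤ a) (hb : δ ≤ b)
    (h : c ^ 2 ≤ (a - δ) * (b - δ)) (hab : a + b ≤ 2) (hx : |x| ≤ 1) (hy : |y| ≤ 1) (hw : |w| ≤ 1)
    (e1 : |x - (a - δ)| ≤ η) (e2 : |w - c| ≤ η) (e3 : |y - (b - δ)| ≤ η) (h0 : ‖φ0‖ ≤ ρ) (h1 : ‖φ1‖ ≤ ρ) :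
    2 * ((starRingEnd ℂ) f * (b * (φ0 + z * (k * x - f * w)) - c * (φ1 + z * (k * w - f * y))) +
      (starRingEnd ℂ) k * (a * (φ1 + z * (k * w - f * y)) - c * (φ0 + z * (k * x - f * w)))).re ≤
    (2 * Real.sqrt (x * y - w ^ 2) * |z.im| + ‖z‖ * (11 * Real.sqrt δ + 36 * η / δ) + 12 * ρ / δ) * qN a b c f k
      + 12 * ρ := by
  have ha0 : 0 < a := lt_of_lt_of_le hδ ha
  have hD : 0 ≤ a * b - c ^ 2 := by nlinarith
  have hη : 0 ≤ η := (abs_nonneg _).trans e1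
  have hρ : 0 ≤ ρ := (norm_nonneg _).trans h0
  have hc1 : |c| ≤ 1 := by
    rw [abs_le_one_iff_mul_self_le_one]; nlinarith [sq_nonneg (a - b)]
  have ha2 : |a| ≤ 2 := by rw [abs_of_pos ha0]; linarith
  have hb2 : |b| ≤ 2 := by rw [abs_of_pos (lt_of_lt_of_le hδ hb)]; linarith
  have hN := qN_lower ha hb h f k
  set N := qN a b c f k with hNdef
  have hN0 : 0 ≤ N := le_trans (by positivity) hN
  set n := ‖f‖ ^ 2 + ‖k‖ ^ 2 with hn
  have hn0 : 0 ≤ n := by positivity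
  have hnN : n ≤ N / δ := by rw [le_div_iff₀ hδ]; linarith
  -- decomposition
  set X := (starRingEnd ℂ) f * (b * k + c * f) - (starRingEnd ℂ) k * (a * f + c * k) with hX
  set Y0 : ℂ := k * ((x - (a - δ) : ℝ) : ℂ) - f * ((w - c : ℝ) : ℂ) with hY0
  set Y1 : ℂ := k * ((w - c : ℝ) : ℂ) - f * ((y - (b - δ) : ℝ) : ℂ) with hY1
  set s : ℂ := (starRingEnd ℂ) f * k with hs
  have dec : (starRingEnd ℂ) f * (b * (φ0 + z * (k * x - f * w)) - c * (φ1 + z * (k * w - f * y))) +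
      (starRingEnd ℂ) k * (a * (φ1 + z * (k * w - f * y)) - c * (φ0 + z * (k * x - f * w))) =
      z * (((a * b - c ^ 2 : ℝ) : ℂ) * (s - (starRingEnd ℂ) s)) - δ * z * X
      + z * ((starRingEnd ℂ) f * (b * Y0 - c * Y1) + (starRingEnd ℂ) k * (a * Y1 - c * Y0))
      + ((starRingEnd ℂ) f * (b * φ0 - c * φ1) + (starRingEnd ℂ) k * (a * φ1 - c * φ0)) := by
    simp only [hX, hY0, hY1, hs, map_mul, Complex.conj_conj]
    push_cast
    ring
  rw [dec, Complex.add_re, Complex.add_re, Complex.sub_re]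
  have b1 : 2 * (z * (((a * b - c ^ 2 : ℝ) : ℂ) * (s - (starRingEnd ℂ) s))).re ≤
      2 * Real.sqrt (a * b - c ^ 2) * |z.im| * N := by
    have e : (z * (((a * b - c ^ 2 : ℝ) : ℂ) * (s - (starRingEnd ℂ) s))).re = -(2 * (a * b - c ^ 2) * (z.im * s.im)) := by
      rw [Complex.sub_conj]
      simp only [Complex.mul_re, Complex.mul_im, Complex.ofReal_re, Complex.ofReal_im, Complex.I_re, Complex.I_im]
      ring
    rw [e]
    have i1 := qN_im ha0 hD f k
    have i2 : Real.sqrt (a * b - c ^ 2) ^ 2 = a * b - c ^ 2 := Real.sq_sqrt hD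
    have i3 : -(z.im * s.im) ≤ |z.im| * |s.im| := by rw [← abs_mul]; exact neg_le_abs _
    calc 2 * -(2 * (a * b - c ^ 2) * (z.im * s.im)) = 4 * (a * b - c ^ 2) * -(z.im * s.im) := by ring
      _ ≤ 4 * (a * b - c ^ 2) * (|z.im| * |s.im|) := by gcongr
      _ = 2 * Real.sqrt (a * b - c ^ 2) * |z.im| * (2 * (Real.sqrt (a * b - c ^ 2) * |s.im|)) := by
        rw [← i2, Real.sqrt_sq (Real.sqrt_nonneg _)]; ring
      _ ≤ _ := by gcongr
  have b2 : -(2 * (δ * z * X).re) ≤ ‖z‖ * (3 * Real.sqrt δ) * N := by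
    have i1 := alg_X hδ ha hb h hab f k
    have i2 : -(δ * z * X).re ≤ ‖δ * z * X‖ := (neg_le_abs _).trans (Complex.abs_re_le_norm _)
    rw [norm_mul, norm_mul, Complex.norm_real, Real.norm_eq_abs, abs_of_pos hδ] at i2
    have := mul_le_mul_of_nonneg_left i1 (norm_nonneg z)
    nlinarith
  have hfk : ∀ A B : ℂ, ∀ m : ℝ, ‖A‖ ≤ m → ‖B‖ ≤ m →
      ‖(starRingEnd ℂ) f * A + (starRingEnd ℂ) k * B‖ ≤ (‖f‖ + ‖k‖) * m := by
    intro A B m hA hB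
    refine (norm_add_le _ _).trans ?_
    rw [norm_mul, norm_mul, RCLike.norm_conj, RCLike.norm_conj, add_mul]
    gcongr
  have hfk2 : (‖f‖ + ‖k‖) ^ 2 ≤ 2 * n := by nlinarith [sq_nonneg (‖f‖ - ‖k‖)]
  have b3 : 2 * (z * ((starRingEnd ℂ) f * (b * Y0 - c * Y1) + (starRingEnd ℂ) k * (a * Y1 - c * Y0))).re ≤
      ‖z‖ * (12 * η / δ) * N := by
    have y0 : ‖Y0‖ ≤ (‖f‖ + ‖k‖) * η := by
      refine (norm_sub_le _ _).trans ?_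
      rw [norm_mul, norm_mul, Complex.norm_real, Complex.norm_real, Real.norm_eq_abs, Real.norm_eq_abs]
      nlinarith [mul_le_mul_of_nonneg_left e1 (norm_nonneg k), mul_le_mul_of_nonneg_left e2 (norm_nonneg f)]
    have y1 : ‖Y1‖ ≤ (‖f‖ + ‖k‖) * η := by
      refine (norm_sub_le _ _).trans ?_
      rw [norm_mul, norm_mul, Complex.norm_real, Complex.norm_real, Real.norm_eq_abs, Real.norm_eq_abs]
      nlinarith [mul_le_mul_of_nonneg_left e2 (norm_nonneg k), mul_le_mul_of_nonneg_left e3 (norm_nonneg f)]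
    have i1 := hfk _ _ _ (norm_row hb2 hc1 Y0 Y1 y0 y1) (norm_row ha2 hc1 Y1 Y0 y1 y0)
    refine (mul_le_mul_of_nonneg_left (Complex.re_le_norm _) zero_le_two).trans ?_
    rw [norm_mul]
    have i2 : (‖f‖ + ‖k‖) * (3 * ((‖f‖ + ‖k‖) * η)) ≤ 6 * η * (N / δ) := by
      have : (‖f‖ + ‖k‖) * (3 * ((‖f‖ + ‖k‖) * η)) = 3 * η * (‖f‖ + ‖k‖) ^ 2 := by ring
      rw [this]
      calc _ ≤ 3 * η * (2 * n) := by gcongr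
        _ ≤ 3 * η * (2 * (N / δ)) := by gcongr
        _ = _ := by ring
    calc _ ≤ 2 * (‖z‖ * (6 * η * (N / δ))) := by gcongr; exact i1.trans i2
      _ = _ := by ring
  have b4 : 2 * ((starRingEnd ℂ) f * (b * φ0 - c * φ1) + (starRingEnd ℂ) k * (a * φ1 - c * φ0)).re ≤
      12 * ρ / δ * N + 12 * ρ := by
    have i1 := hfk _ _ _ (norm_row hb2 hc1 φ0 φ1 h0 h1) (norm_row ha2 hc1 φ1 φ0 h1 h0)
    refine (mul_le_mul_of_nonneg_left (Complex.re_le_norm _) zero_le_two).trans ?_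
    have i2 : ‖f‖ + ‖k‖ ≤ 2 + N / δ := by
      have j1 := sq_nonneg (‖f‖ - 1)
      have j2 := sq_nonneg (‖k‖ - 1)
      have j3 : ‖f‖ + ‖k‖ ≤ 2 + n := by
        rw [hn]; linarith [sq_nonneg ‖f‖, sq_nonneg ‖k‖, sub_sq ‖f‖ 1, sub_sq ‖k‖ 1]
      linarith
    have i3 : ‖f‖ + ‖k‖ ≤ 2 * (1 + N / δ) := by have : 0 ≤ N / δ := by positivity
                                                linarith
    calc _ ≤ 2 * ((2 * (1 + N / δ)) * (3 * ρ)) := by gcongr; exact i1.trans (by gcongr)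
      _ = _ := by ring
  have b5 := alg_sqrt hδ hδ1 ha hb h hab hx hy hw e1 e2 e3
  have b6 : 2 * Real.sqrt (a * b - c ^ 2) * |z.im| * N ≤
      (2 * Real.sqrt (x * y - w ^ 2) * |z.im| + ‖z‖ * (8 * Real.sqrt δ + 12 * η / δ)) * N := by
    have i1 : |z.im| ≤ ‖z‖ := Complex.abs_im_le_norm z
    gcongr
    calc 2 * Real.sqrt (a * b - c ^ 2) * |z.im| ≤
        2 * (Real.sqrt (x * y - w ^ 2) + 4 * Real.sqrt δ + 6 * η / δ) * |z.im| := by gcongr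
      _ = 2 * Real.sqrt (x * y - w ^ 2) * |z.im| + |z.im| * (8 * Real.sqrt δ + 12 * η / δ) := by ring
      _ ≤ _ := by gcongr
  have b7 : 0 ≤ ‖z‖ * (12 * η / δ) * N := by positivity
  have e9 : ‖z‖ * (36 * η / δ) = 3 * (‖z‖ * (12 * η / δ)) := by ring
  have e10 : (2 * Real.sqrt (x * y - w ^ 2) * |z.im| + ‖z‖ * (11 * Real.sqrt δ + 36 * η / δ) + 12 * ρ / δ) * N
     = (2 * Real.sqrt (x * y - w ^ 2) * |z.im| + ‖z‖ * (8 * Real.sqrt δ + 12 * η / δ)) * N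
      + ‖z‖ * (3 * Real.sqrt δ) * N + 2 * (‖z‖ * (12 * η / δ) * N) + 12 * ρ / δ * N := by ring
  rw [e10]
  linarith

end PD4
end CS

namespace CS
section PD5
open Set Filter Topology ContinuousLinearMap

theorem qN_AD {a a' b b' d d' : ℝ → ℝ} {f f' k k' : ℝ → ℂ} {l r : ℝ} (ha : AD a a' l r) (hb : AD b b' l r)
    (hd : AD d d' l r) (hf : AD f f' l r) (hk : AD k k' l r) :
    AD (fun t => qN (a t) (b t) (d t) (f t) (k t))
      (fun t => qN (a' t) (b' t) (d' t) (f t) (k t) + 2 * ((starRingEnd ℂ) (f t) * (b t * f' t - d t * k' t)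
        + (starRingEnd ℂ) (k t) * (a t * k' t - d t * f' t)).re) l r := by
  have h1 := ((hb.mul (hf.conj.mul hf).re).sub (((AD.const 2 l r).mul hd).mul (hf.conj.mul hk).re)).add
    (ha.mul (hk.conj.mul hk).re)
  refine (h1.congr_fun ?_).congr (Eventually.of_forall ?_)
  · intro t
    unfold qN
    simp only [← Complex.normSq_eq_norm_sq, Complex.normSq_apply, Complex.mul_re, Complex.conj_re, Complex.conj_im]
    ring
  · intro t _
    unfold qN
    simp only [← Complex.normSq_eq_norm_sq, Complex.normSq_apply, Complex.mul_re, Complex.conj_re, Complex.conj_im,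
      Complex.add_re, Complex.sub_re, Complex.sub_im, Complex.mul_im, Complex.ofReal_re, Complex.ofReal_im]
    ring

theorem ae_Icc_of_Ioc {p : ℝ → Prop} {L b : ℝ} (hb : 0 ≤ b) (hbL : b ≤ L) (h : ∀ᵐ x, x ∈ Ioc 0 L → p x) :
    ∀ᵐ x, x ∈ uIcc 0 b → p x := by
  have h0 : ∀ᵐ x : ℝ, x ∉ ({0} : Set ℝ) := measure_eq_zero_iff_ae_notMem.1 (measure_singleton 0)
  filter_upwards [h, h0] with x hx hx0 hm
  rw [uIcc_of_le hb] at hm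
  exact hx ⟨lt_of_le_of_ne hm.1 fun h => hx0 h.symm, hm.2.trans hbL⟩

namespace Coef
variable (c : Coef)

theorem I_AD (i j : Fin 2) (a b : ℝ) : AD (c.I i j) (c.h i j) a b := by
  have := AD.integral (c.h_ii i j (-(|a| + |b|)) (|a| + |b|)) (c := 0)
    (by rw [mem_uIcc]; left; constructor <;> linarith [abs_nonneg a, abs_nonneg b])
  refine this.mono (uIcc_subset_uIcc ?_ ?_) <;> rw [mem_uIcc] <;> left <;>
  constructor <;> linarith [abs_nonneg a, abs_nonneg b, neg_abs_le a, neg_abs_le b, le_abs_self a, le_abs_self b]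

theorem I_cont (i j : Fin 2) : Continuous (c.I i j) :=
  intervalIntegral.continuous_primitive (fun _ _ => c.h_ii i j _ _) 0

/-- Steklov averages -/
def av (i j : Fin 2) (s t : ℝ) : ℝ := s⁻¹ * (c.I i j (t + s) - c.I i j t)

theorem av_eq (i j : Fin 2) (s t : ℝ) : c.av i j s t = s⁻¹ * ∫ u in t..(t+s), c.h i j u := by
  unfold av I
  rw [intervalIntegral.integral_interval_sub_left (c.h_ii _ _ _ _) (c.h_ii _ _ _ _)]

theorem av_cont (i j : Fin 2) (s : ℝ) : Continuous (c.av i j s) := by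
  unfold av
  have := c.I_cont i j
  fun_prop

theorem av_AD (i j : Fin 2) (s b : ℝ) :
    AD (c.av i j s) (fun t => s⁻¹ * (c.h i j (t + s) - c.h i j t)) 0 b := by
  have hi : IntervalIntegrable (fun u => c.h i j (u + s)) volume 0 b := by
    have := (c.h_ii i j (0 + s) (b + s)).comp_add_right s
    simpa using this
  have h1 := AD.integral hi (c := 0) left_mem_uIcc
  have h2 := (((AD.const (c.I i j s) 0 b).add h1).sub (c.I_AD i j 0 b)).const_mul s⁻¹
  refine (h2.congr_fun ?_).congr (Eventually.of_forall fun t _ => by simp)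
  intro t
  rw [intervalIntegral.integral_comp_add_right, av, zero_add]
  congr 2
  unfold I
  rw [intervalIntegral.integral_add_adjacent_intervals (c.h_ii _ _ _ _) (c.h_ii _ _ _ _)]

theorem av_abs (i j : Fin 2) {s : ℝ} (hs : 0 < s) (t : ℝ) : |c.av i j s t| ≤ 1 := by
  rw [av_eq, abs_mul, abs_of_pos (inv_pos.2 hs), inv_mul_le_iff₀ hs]
  have := intervalIntegral.norm_integral_le_of_norm_le_const (a := t) (b := t + s) (C := 1) (f := c.h i j)
    (fun x _ => c.h_abs i j x)
  simpa [abs_of_pos hs] using this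

theorem av_tr {s : ℝ} (hs : 0 < s) (t : ℝ) : c.av 0 0 s t + c.av 1 1 s t = 1 := by
  unfold av
  have h1 := c.I_tr (t + s)
  have h2 := c.I_tr t
  rw [← mul_add, show c.I 0 0 (t + s) - c.I 0 0 t + (c.I 1 1 (t + s) - c.I 1 1 t) = s by linarith]
  exact inv_mul_cancel₀ hs.ne'

theorem av_nonneg (i : Fin 2) {s : ℝ} (hs : 0 < s) (t : ℝ) : 0 ≤ c.av i i s t := by
  rw [av_eq]
  refine mul_nonneg (inv_pos.2 hs).le (intervalIntegral.integral_nonneg (by linarith) fun u _ => ?_)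
  rw [h_diag]; positivity

theorem av_det {s : ℝ} (hs : 0 < s) (t : ℝ) : c.av 0 1 s t ^ 2 ≤ c.av 0 0 s t * c.av 1 1 s t := by
  have key : ∀ u : ℝ, 0 ≤ c.av 0 0 s t * (u * u) + (2 * c.av 0 1 s t) * u + c.av 1 1 s t := by
    intro u
    have e : c.av 0 0 s t * (u * u) + (2 * c.av 0 1 s t) * u + c.av 1 1 s t =
        s⁻¹ * ∫ v in t..(t+s), (u * u * c.h 0 0 v + 2 * u * c.h 0 1 v + c.h 1 1 v) := by
      rw [intervalIntegral.integral_add (((c.h_ii _ _ _ _).const_mul _).add ((c.h_ii _ _ _ _).const_mul _)) (c.h_ii _ _ _ _),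
        intervalIntegral.integral_add ((c.h_ii _ _ _ _).const_mul _) ((c.h_ii _ _ _ _).const_mul _),
        intervalIntegral.integral_const_mul, intervalIntegral.integral_const_mul, av_eq, av_eq, av_eq]
      ring
    rw [e]
    refine mul_nonneg (inv_pos.2 hs).le (intervalIntegral.integral_nonneg (by linarith) fun v _ => ?_)
    have h0 := c.h_diag 0 v
    have h1 := c.h_diag 1 v
    have := qform_real (α := c.h 0 0 v) (β := c.h 1 1 v) (c := c.h 0 1 v) (by rw [h0]; positivity) (by rw [h1]; positivity)
      (c.h_det v) u (-1)
    linarith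
  have := discrim_le_zero key
  unfold discrim at this
  linarith

def eta (s t : ℝ) : ℝ := |c.h 0 0 t - c.av 0 0 s t| + |c.h 0 1 t - c.av 0 1 s t| + |c.h 1 1 t - c.av 1 1 s t|

theorem eta_nonneg (s t : ℝ) : 0 ≤ c.eta s t := by unfold eta; positivity

theorem eta_le {s : ℝ} (hs : 0 < s) (t : ℝ) : c.eta s t ≤ 6 := by
  unfold eta
  have h : ∀ i j : Fin 2, |c.h i j t - c.av i j s t| ≤ 2 := fun i j => by
    refine (abs_sub _ _).trans ?_
    linarith [c.h_abs i j t, c.av_abs i j hs t]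
  linarith [h 0 0, h 0 1, h 1 1]

theorem eta_meas (s : ℝ) : Measurable (c.eta s) := by
  have h : ∀ i j : Fin 2, Measurable fun t => |c.h i j t - c.av i j s t| := fun i j =>
    ((c.mh i j).sub (c.av_cont i j s).measurable).abs
  exact ((h 0 0).add (h 0 1)).add (h 1 1)

theorem eta_ii {s : ℝ} (hs : 0 < s) (a b : ℝ) : IntervalIntegrable (c.eta s) volume a b := by
  refine (intervalIntegrable_const (c := (6:ℝ))).mono_fun (c.eta_meas s).aestronglyMeasurable ?_
  refine Eventually.of_forall fun t => ?_
  show ‖c.eta s t‖ ≤ ‖(6:ℝ)‖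
  rw [Real.norm_eq_abs, abs_of_nonneg (c.eta_nonneg s t)]; simpa using c.eta_le hs t

theorem eta_lim : Tendsto (fun s => ∫ t in (0:ℝ)..c.L, c.eta s t) (𝓝[>] 0) (𝓝 0) := by
  have : (0:ℝ) = ∫ t in (0:ℝ)..c.L, (0:ℝ) := by simp
  conv => rhs; rw [this]
  apply intervalIntegral.tendsto_integral_filter_of_dominated_convergence (fun _ => (6:ℝ))
  · exact Eventually.of_forall fun s => (c.eta_meas s).aestronglyMeasurable
  · filter_upwards [self_mem_nhdsWithin] with s hs
    refine Eventually.of_forall fun t _ => ?_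
    rw [Real.norm_eq_abs, abs_of_nonneg (c.eta_nonneg s t)]; exact c.eta_le hs t
  · exact intervalIntegrable_const
  · filter_upwards [(c.I_AD 0 0 0 c.L).der, (c.I_AD 0 1 0 c.L).der, (c.I_AD 1 1 0 c.L).der] with t h1 h2 h3 ht
    have ht' := uIoc_subset_uIcc ht
    have key : ∀ i j : Fin 2, HasDerivAt (c.I i j) (c.h i j t) t →
        Tendsto (fun s => |c.h i j t - c.av i j s t|) (𝓝[>] 0) (𝓝 0) := by
      intro i j hd
      have := (hd.tendsto_slope_zero_right.const_sub (c.h i j t)).abs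
      simpa [av] using this
    have := ((key _ _ (h1 ht')).add (key _ _ (h2 ht'))).add (key _ _ (h3 ht'))
    simpa [eta] using this

/-- square root of the determinant -/
def dd (t : ℝ) : ℝ := Real.sqrt (c.h 0 0 t * c.h 1 1 t - c.h 0 1 t ^ 2)
theorem dd_nonneg (t : ℝ) : 0 ≤ c.dd t := Real.sqrt_nonneg _
theorem dd_le (t : ℝ) : c.dd t ≤ 1 := by
  unfold dd
  rw [Real.sqrt_le_one]
  have h0 := c.h_diag 0 t
  have h1 := c.h_diag 1 t
  have := c.tr t
  nlinarith [sq_nonneg (c.h 0 1 t), sq_nonneg (c.h 0 0 t - c.h 1 1 t)]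
theorem dd_ii (a b : ℝ) : IntervalIntegrable c.dd volume a b := by
  refine (intervalIntegrable_const (c := (1:ℝ))).mono_fun ?_ ?_
  · exact (((c.mh 0 0).mul (c.mh 1 1)).sub ((c.mh 0 1).pow_const 2)).sqrt.aestronglyMeasurable
  refine Eventually.of_forall fun t => ?_
  show ‖c.dd t‖ ≤ ‖(1:ℝ)‖
  rw [Real.norm_eq_abs, abs_of_nonneg (c.dd_nonneg t)]; simpa using c.dd_le t

def T (x : ℝ) : ℝ := ∫ t in (0:ℝ)..x, c.dd t

theorem T_mono {x y : ℝ} (hxy : x ≤ y) : c.T x ≤ c.T y := by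
  have := intervalIntegral.integral_nonneg (f := c.dd) (μ := volume) hxy fun t _ => c.dd_nonneg t
  unfold T
  rw [← intervalIntegral.integral_interval_sub_left (c.dd_ii 0 y) (c.dd_ii 0 x)] at this
  linarith

theorem T_le {x : ℝ} (hx : 0 ≤ x) : c.T x ≤ x := by
  unfold T
  have := intervalIntegral.integral_mono_on hx (c.dd_ii 0 x) (intervalIntegrable_const (c := (1:ℝ))) fun t _ => c.dd_le t
  simpa using this

theorem T_nonneg {x : ℝ} (hx : 0 ≤ x) : 0 ≤ c.T x := intervalIntegral.integral_nonneg hx fun t _ => c.dd_nonneg t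

/-- the differential equation for the primitives -/
theorem g_sol {φ ψ : c.K} {z : ℂ} (h : ψ = φ + z • c.V ψ) (i : Fin 2) : ∀ᵐ t, t ∈ Ioc 0 c.L →
    c.g i ψ t = c.g i φ t + z * (c.F 1 ψ t * c.h i 0 t - c.F 0 ψ t * c.h i 1 t) := by
  have h1 := Lp.coeFn_add φ (z • c.V ψ)
  rw [← h] at h1
  filter_upwards [c.ae_iff.1 h1, c.ae_iff.1 (Lp.coeFn_smul z (c.V ψ)), c.ae_iff.1 (c.V_ae ψ)] with t h1 h2 h3 ht
  rw [g_of_mem _ _ _ ht, h1 ht, Pi.add_apply, h2 ht, Pi.smul_apply, h3 ht, g_of_mem _ _ _ ht, inner_add_right,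
    inner_smul_right, vf, inner_sub_right, inner_smul_right, inner_smul_right, gram, gram]

theorem rho_ii (φ : c.K) {a b : ℝ} (ha : 0 ≤ a) (hab : a ≤ b) (hb : b ≤ c.L) :
    IntervalIntegrable (fun t => ‖φ t‖) volume a b := by
  rw [intervalIntegrable_iff_integrableOn_Ioc_of_le hab]
  exact IntegrableOn.mono_set (c.f_int φ).norm (Ioc_subset_Ioc ha hb)

theorem growth_F {φ ψ : c.K} {z : ℂ} (h : ψ = φ + z • c.V ψ) {x δ s : ℝ} (hx : x ∈ Icc 0 c.L) (hδ : 0 < δ)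
    (hδ1 : δ ≤ 1 / 2) (hs : 0 < s) :
    δ * (‖c.F 0 ψ x‖ ^ 2 + ‖c.F 1 ψ x‖ ^ 2) ≤ (12 * ∫ t in (0:ℝ)..x, ‖φ t‖) * Real.exp (2 * |z.im| * c.T x +
      ‖z‖ * (11 * Real.sqrt δ * x + 36 / δ * ∫ t in (0:ℝ)..x, c.eta s t) + 12 / δ * (∫ t in (0:ℝ)..x, ‖φ t‖)
      + 4 / (s * δ) * x) := by
  have hδ1' : δ ≤ 1 := by linarith
  have hA : AD (fun t => c.av 0 0 s t + δ) _ 0 x := (c.av_AD 0 0 s x).add (AD.const δ 0 x)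
  have hB : AD (fun t => c.av 1 1 s t + δ) _ 0 x := (c.av_AD 1 1 s x).add (AD.const δ 0 x)
  have hN := qN_AD hA hB (c.av_AD 0 1 s x) (c.F_AD 0 ψ 0 x) (c.F_AD 1 ψ 0 x)
  have hlow : ∀ t, δ * (‖c.F 0 ψ t‖ ^ 2 + ‖c.F 1 ψ t‖ ^ 2) ≤
      qN (c.av 0 0 s t + δ) (c.av 1 1 s t + δ) (c.av 0 1 s t) (c.F 0 ψ t) (c.F 1 ψ t) := fun t => by
    apply qN_lower
    · linarith [c.av_nonneg 0 hs t]
    · linarith [c.av_nonneg 1 hs t]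
    · simpa using c.av_det hs t
  have iρ := c.rho_ii φ le_rfl hx.1 hx.2
  have iη := c.eta_ii hs 0 x
  have id := c.dd_ii 0 x
  have iβ := (((id.const_mul (2 * |z.im|)).add (((intervalIntegrable_const (c := 11 * Real.sqrt δ)).add
    (iη.const_mul (36 / δ))).const_mul ‖z‖)).add (iρ.const_mul (12 / δ))).add (intervalIntegrable_const (c := 4 / (s * δ)))
  have hg := hN.gronwall hx.1 iβ (iρ.const_mul 12) ?_ ?_ ?_
  · refine (hlow x).trans (hg.trans (le_of_eq ?_))
    rw [intervalIntegral.integral_add (((id.const_mul (2 * |z.im|)).add (((intervalIntegrable_const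
      (c := 11 * Real.sqrt δ)).add (iη.const_mul (36 / δ))).const_mul ‖z‖)).add (iρ.const_mul (12 / δ)))
      (intervalIntegrable_const (c := 4 / (s * δ))),
      intervalIntegral.integral_add ((id.const_mul (2 * |z.im|)).add (((intervalIntegrable_const
      (c := 11 * Real.sqrt δ)).add (iη.const_mul (36 / δ))).const_mul ‖z‖)) (iρ.const_mul (12 / δ)),
      intervalIntegral.integral_add (id.const_mul (2 * |z.im|)) (((intervalIntegrable_const
      (c := 11 * Real.sqrt δ)).add (iη.const_mul (36 / δ))).const_mul ‖z‖),
      intervalIntegral.integral_const_mul, intervalIntegral.integral_const_mul, intervalIntegral.integral_const_mul,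
      intervalIntegral.integral_const_mul,
      intervalIntegral.integral_add (intervalIntegrable_const (c := 11 * Real.sqrt δ)) (iη.const_mul (36 / δ)),
      intervalIntegral.integral_const_mul, intervalIntegral.integral_const, intervalIntegral.integral_const]
    simp only [F_zero_right, sub_zero, smul_eq_mul, T]
    have : qN (c.av 0 0 s 0 + δ) (c.av 1 1 s 0 + δ) (c.av 0 1 s 0) 0 0 = 0 := by simp [qN]
    rw [this, zero_add]
    simp only [intervalIntegral.integral_const_mul]
    congr 2
    ring
  · intro t
    have := c.dd_nonneg t
    have := c.eta_nonneg s t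
    positivity
  · intro t; positivity
  · filter_upwards [ae_Icc_of_Ioc hx.1 hx.2 (c.g_sol h 0), ae_Icc_of_Ioc hx.1 hx.2 (c.g_sol h 1)] with t g0 g1 ht
    rw [g0 ht, g1 ht]
    have e0 : |c.h 0 0 t - (c.av 0 0 s t + δ - δ)| ≤ c.eta s t := by
      rw [add_sub_cancel_right]; unfold eta
      linarith [abs_nonneg (c.h 0 1 t - c.av 0 1 s t), abs_nonneg (c.h 1 1 t - c.av 1 1 s t)]
    have e1 : |c.h 0 1 t - c.av 0 1 s t| ≤ c.eta s t := by
      unfold eta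
      linarith [abs_nonneg (c.h 0 0 t - c.av 0 0 s t), abs_nonneg (c.h 1 1 t - c.av 1 1 s t)]
    have e2 : |c.h 1 1 t - (c.av 1 1 s t + δ - δ)| ≤ c.eta s t := by
      rw [add_sub_cancel_right]; unfold eta
      linarith [abs_nonneg (c.h 0 1 t - c.av 0 1 s t), abs_nonneg (c.h 0 0 t - c.av 0 0 s t)]
    have key := alg_main (c.F 0 ψ t) (c.F 1 ψ t) (c.g 0 φ t) (c.g 1 φ t) z (a := c.av 0 0 s t + δ) (b := c.av 1 1 s t + δ)
      (c := c.av 0 1 s t) hδ hδ1' (by linarith [c.av_nonneg 0 hs t]) (by linarith [c.av_nonneg 1 hs t])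
      (by simpa using c.av_det hs t) (by linarith [c.av_tr hs t]) (c.h_abs 0 0 t) (c.h_abs 1 1 t) (c.h_abs 0 1 t)
      e0 e1 e2 (c.g_le 0 φ t) (c.g_le 1 φ t)
    have hsym : c.h 1 0 t = c.h 0 1 t := c.h_symm 1 0 t
    rw [hsym]
    have hl := hlow t
    set N := qN (c.av 0 0 s t + δ) (c.av 1 1 s t + δ) (c.av 0 1 s t) (c.F 0 ψ t) (c.F 1 ψ t)
    -- the term from the derivative of the averages
    have ex : qN (s⁻¹ * (c.h 0 0 (t + s) - c.h 0 0 t) + 0) (s⁻¹ * (c.h 1 1 (t + s) - c.h 1 1 t) + 0)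
        (s⁻¹ * (c.h 0 1 (t + s) - c.h 0 1 t)) (c.F 0 ψ t) (c.F 1 ψ t) ≤ 4 / (s * δ) * N := by
      have hh : ∀ i j : Fin 2, |c.h i j (t + s) - c.h i j t| ≤ 2 := fun i j => by
        refine (abs_sub _ _).trans ?_
        linarith [c.h_abs i j t, c.h_abs i j (t + s)]
      set f := c.F 0 ψ t
      set k := c.F 1 ψ t
      have r1 : |((starRingEnd ℂ) f * k).re| ≤ ‖f‖ * ‖k‖ := by
        refine (Complex.abs_re_le_norm _).trans ?_
        rw [norm_mul, RCLike.norm_conj]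
      have q1 : (c.h 1 1 (t + s) - c.h 1 1 t) * ‖f‖ ^ 2 ≤ 2 * ‖f‖ ^ 2 := by
        gcongr; exact (le_abs_self _).trans (hh 1 1)
      have q2 : (c.h 0 0 (t + s) - c.h 0 0 t) * ‖k‖ ^ 2 ≤ 2 * ‖k‖ ^ 2 := by
        gcongr; exact (le_abs_self _).trans (hh 0 0)
      have q3 : -((c.h 0 1 (t + s) - c.h 0 1 t) * ((starRingEnd ℂ) f * k).re) ≤ 2 * (‖f‖ * ‖k‖) := by
        refine (neg_le_abs _).trans ?_
        rw [abs_mul]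
        exact mul_le_mul (hh 0 1) r1 (abs_nonneg _) zero_le_two
      have q4 := two_mul_le_sq ‖f‖ ‖k‖
      have q5 : qN (s⁻¹ * (c.h 0 0 (t + s) - c.h 0 0 t) + 0) (s⁻¹ * (c.h 1 1 (t + s) - c.h 1 1 t) + 0)
        (s⁻¹ * (c.h 0 1 (t + s) - c.h 0 1 t)) f k = s⁻¹ * ((c.h 1 1 (t + s) - c.h 1 1 t) * ‖f‖ ^ 2
          + 2 * -((c.h 0 1 (t + s) - c.h 0 1 t) * ((starRingEnd ℂ) f * k).re)
          + (c.h 0 0 (t + s) - c.h 0 0 t) * ‖k‖ ^ 2) := by unfold qN; ring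
      rw [q5]
      calc _ ≤ s⁻¹ * (4 * (‖f‖ ^ 2 + ‖k‖ ^ 2)) := mul_le_mul_of_nonneg_left (by linarith) (inv_pos.2 hs).le
        _ = 4 / (s * δ) * (δ * (‖f‖ ^ 2 + ‖k‖ ^ 2)) := by field_simp
        _ ≤ _ := by gcongr
    push_cast at key ⊢
    have e9 : (2 * Real.sqrt (c.h 0 0 t * c.h 1 1 t - c.h 0 1 t ^ 2) * |z.im| + ‖z‖ * (11 * Real.sqrt δ + 36 * c.eta s t / δ)
       + 12 * ‖φ t‖ / δ) * N + 4 / (s * δ) * N = (2 * |z.im| * c.dd t + ‖z‖ * (11 * Real.sqrt δ + 36 / δ * c.eta s t)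
       + 12 / δ * ‖φ t‖ + 4 / (s * δ)) * N := by unfold dd; ring
    linarith

end Coef
end PD5
end CS

namespace CS
section PD6
open Set Filter Topology ContinuousLinearMap

namespace Coef
variable (c : Coef)

theorem PV {x : ℝ} (hx : x ∈ Icc 0 c.L) (u : c.K) : c.P x (c.V (c.P x u)) = c.P x (c.V u) := by
  refine ext_inner_right ℂ fun w => ?_
  rw [P_sa, P_sa, ← adjoint_inner_right c.V, ← adjoint_inner_right c.V, P_sa, c.PT hx]

theorem R_sol (z : ℂ) (φ : c.K) : Ring.inverse (1 - z • c.V) φ = φ + z • c.V (Ring.inverse (1 - z • c.V) φ) := by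
  have := Ring.mul_inverse_cancel _ (isUnit_of_qn _ (c.qn z))
  have := congrArg (fun W : c.K →L[ℂ] c.K => W φ) this
  have h2 : Ring.inverse (1 - z • c.V) φ - z • c.V (Ring.inverse (1 - z • c.V) φ) = φ := by simpa using this
  rw [← sub_eq_iff_eq_add]; exact h2

theorem le_exp_mul {ε : ℝ} (hε : 0 < ε) (r : ℝ) : r ≤ ε⁻¹ * Real.exp (ε * r) := by
  rw [inv_mul_eq_div, le_div_iff₀ hε]
  linarith [Real.add_one_le_exp (ε * r)]

theorem upper_V {x : ℝ} (hx : x ∈ Icc 0 c.L) (φ : c.K) {ε : ℝ} (hε : 0 < ε) : ∃ C : ℝ, 0 ≤ C ∧ ∀ z : ℂ,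
    ∀ ψ : c.K, ψ = φ + z • c.V ψ → ∀ t ∈ Icc 0 x, ‖c.vf ψ t‖ ≤ C * Real.exp (ε * ‖z‖ + c.T x * |z.im|) := by
  obtain ⟨δ, hδ, hδ1, hδ2⟩ : ∃ δ : ℝ, 0 < δ ∧ δ ≤ 1 / 2 ∧ 11 * Real.sqrt δ * c.L ≤ ε := by
    refine ⟨min (1 / 2) ((ε / (11 * c.L)) ^ 2), ?_, min_le_left _ _, ?_⟩
    · have := c.hL
      positivity
    · have hL := c.hL
      have : Real.sqrt (min (1 / 2) ((ε / (11 * c.L)) ^ 2)) ≤ ε / (11 * c.L) := by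
        rw [Real.sqrt_le_left (by positivity)]; exact min_le_right _ _
      rw [le_div_iff₀ (by positivity)] at this
      linarith
  obtain ⟨s, hs, hs1⟩ : ∃ s : ℝ, 0 < s ∧ 36 / δ * ∫ t in (0:ℝ)..c.L, c.eta s t ≤ ε := by
    have := (c.eta_lim.const_mul (36 / δ)).eventually (ge_mem_nhds (a := ε) (by simpa using hε))
    obtain ⟨s, h1, h2⟩ := (this.and self_mem_nhdsWithin).exists
    exact ⟨s, h2, h1⟩
  set ρ := ∫ t in (0:ℝ)..c.L, ‖φ t‖ with hρ
  have hρ0 : 0 ≤ ρ := intervalIntegral.integral_nonneg c.hL.le fun t _ => norm_nonneg _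
  set C0 := 12 / δ * ρ + 4 / (s * δ) * c.L
  refine ⟨Real.sqrt (24 * ρ * Real.exp C0 / δ), Real.sqrt_nonneg _, fun z ψ h t ht => ?_⟩
  have htL : t ∈ Icc 0 c.L := ⟨ht.1, ht.2.trans hx.2⟩
  have hg := c.growth_F h htL hδ hδ1 hs
  have m1 : ∫ t in (0:ℝ)..t, ‖φ t‖ ≤ ρ :=
    intervalIntegral.integral_mono_interval le_rfl ht.1 htL.2 (Eventually.of_forall fun t => norm_nonneg _)
      (c.rho_ii φ le_rfl c.hL.le le_rfl)
  have m2 : ∫ t in (0:ℝ)..t, c.eta s t ≤ ∫ t in (0:ℝ)..c.L, c.eta s t :=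
    intervalIntegral.integral_mono_interval le_rfl ht.1 htL.2 (Eventually.of_forall fun t => c.eta_nonneg s t)
      (c.eta_ii hs 0 c.L)
  have m0 : 0 ≤ ∫ t in (0:ℝ)..t, ‖φ t‖ := intervalIntegral.integral_nonneg ht.1 fun t _ => norm_nonneg _
  have b1 : 36 / δ * ∫ t in (0:ℝ)..t, c.eta s t ≤ ε := le_trans (by gcongr) hs1
  have b2 : 11 * Real.sqrt δ * t ≤ ε := le_trans (by gcongr; exact htL.2) hδ2
  have b3 : 12 / δ * (∫ t in (0:ℝ)..t, ‖φ t‖) ≤ 12 / δ * ρ := by gcongr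
  have b4 : 4 / (s * δ) * t ≤ 4 / (s * δ) * c.L := by gcongr; exact htL.2
  have b5 : 2 * |z.im| * c.T t ≤ 2 * |z.im| * c.T x := by gcongr; exact c.T_mono ht.2
  have b6 : ‖z‖ * (11 * Real.sqrt δ * t + 36 / δ * ∫ t in (0:ℝ)..t, c.eta s t) ≤ ‖z‖ * (2 * ε) := by
    gcongr; linarith
  have hg2 : δ * (‖c.F 0 ψ t‖ ^ 2 + ‖c.F 1 ψ t‖ ^ 2) ≤ 12 * ρ * (Real.exp C0 * Real.exp (ε * ‖z‖ + c.T x * |z.im|) ^ 2) := by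
    refine hg.trans ?_
    rw [← Real.exp_nat_mul, ← Real.exp_add]
    have : (2 * |z.im| * c.T t +
      ‖z‖ * (11 * Real.sqrt δ * t + 36 / δ * ∫ t in (0:ℝ)..t, c.eta s t) + 12 / δ * (∫ t in (0:ℝ)..t, ‖φ t‖)
      + 4 / (s * δ) * t) ≤ C0 + ((2:ℕ):ℝ) * (ε * ‖z‖ + c.T x * |z.im|) := by
      push_cast
      linarith
    gcongr
  have hv := c.vf_le ψ t
  refine hv.trans (abs_le_of_sq_le_sq' ?_ (by positivity)).2
  rw [mul_pow, Real.sq_sqrt (by positivity)]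
  have : (‖c.F 1 ψ t‖ + ‖c.F 0 ψ t‖) ^ 2 ≤ 2 * (‖c.F 0 ψ t‖ ^ 2 + ‖c.F 1 ψ t‖ ^ 2) := by
    nlinarith [two_mul_le_sq ‖c.F 1 ψ t‖ ‖c.F 0 ψ t‖]
  refine this.trans ?_
  rw [← sub_nonneg]
  have e : 24 * ρ * Real.exp C0 / δ * Real.exp (ε * ‖z‖ + c.T x * |z.im|) ^ 2 - 2 * (‖c.F 0 ψ t‖ ^ 2 + ‖c.F 1 ψ t‖ ^ 2) =
    2 / δ * (12 * ρ * (Real.exp C0 * Real.exp (ε * ‖z‖ + c.T x * |z.im|) ^ 2) - δ * (‖c.F 0 ψ t‖ ^ 2 + ‖c.F 1 ψ t‖ ^ 2)) := by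
    field_simp
    ring
  rw [e]
  have := sub_nonneg.2 hg2
  positivity

theorem upper {x : ℝ} (hx : x ∈ Icc 0 c.L) (φ : c.K) {ε : ℝ} (hε : 0 < ε) : ∃ C : ℝ, ∀ z : ℂ,
    ‖c.P x (Ring.inverse (1 - z • c.V) φ)‖ ≤ C * Real.exp (ε * ‖z‖ + c.T x * |z.im|) := by
  obtain ⟨C, hC, h⟩ := c.upper_V hx φ (half_pos hε)
  set M := (measureUnivNNReal c.μ : ℝ) ^ (2:ℝ≥0∞).toReal⁻¹
  have hM : 0 ≤ M := by positivity
  refine ⟨‖φ‖ + (ε / 2)⁻¹ * (M * C), fun z => ?_⟩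
  have hs := c.R_sol z φ
  set ψ := Ring.inverse (1 - z • c.V) φ
  have h1 : ‖c.P x (c.V ψ)‖ ≤ M * (C * Real.exp (ε / 2 * ‖z‖ + c.T x * |z.im|)) := by
    refine Lp.norm_le_of_ae_bound (by positivity) ?_
    rw [ae_iff]
    filter_upwards [c.ae_iff.1 (c.P_ae x (c.V ψ)), c.ae_iff.1 (c.V_ae ψ)] with t h1 h2 ht
    rw [h1 ht]
    by_cases htx : t ∈ Iic x
    · rw [indicator_of_mem htx, h2 ht]
      exact h z ψ hs t ⟨ht.1.le, htx⟩
    · rw [indicator_of_notMem htx, norm_zero]; positivity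
  have h2 : c.P x ψ = c.P x φ + z • c.P x (c.V ψ) := by
    conv_lhs => rw [hs]
    simp
  have hT := c.T_nonneg hx.1
  have e1 : (1:ℝ) ≤ Real.exp (ε * ‖z‖ + c.T x * |z.im|) := Real.one_le_exp (by positivity)
  calc ‖c.P x ψ‖ ≤ ‖c.P x φ‖ + ‖z‖ * ‖c.P x (c.V ψ)‖ := by
        rw [h2]; refine (norm_add_le _ _).trans ?_; rw [norm_smul]
    _ ≤ ‖φ‖ * Real.exp (ε * ‖z‖ + c.T x * |z.im|) + ((ε / 2)⁻¹ * Real.exp (ε / 2 * ‖z‖)) *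
        (M * (C * Real.exp (ε / 2 * ‖z‖ + c.T x * |z.im|))) := by
        gcongr
        · exact (c.P_norm x φ).trans (le_mul_of_one_le_right (norm_nonneg _) e1)
        · exact le_exp_mul (half_pos hε) _
    _ = _ := by
        have : Real.exp (ε * ‖z‖ + c.T x * |z.im|) = Real.exp (ε / 2 * ‖z‖) * Real.exp (ε / 2 * ‖z‖ + c.T x * |z.im|) := by
          rw [← Real.exp_add]; congr 1; ring
        rw [this]; ring

/-- the energy -/
def en (y : ℝ) (ψ : c.K) (x : ℝ) : ℝ := (c.F 0 ψ x).re - y * ((starRingEnd ℂ) (c.F 0 ψ x) * c.F 1 ψ x).im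

theorem en_eq {y : ℝ} {ψ : c.K} (h : ψ = c.e 0 + (y * Complex.I) • c.V ψ) {x : ℝ} (hx : x ∈ Icc 0 c.L) :
    c.en y ψ x = ‖c.P x ψ‖ ^ 2 := by
  have h1 : c.P x ψ = c.P x (c.e 0) + ((y:ℂ) * Complex.I) • c.P x (c.V (c.P x ψ)) := by
    rw [c.PV hx]
    conv_lhs => rw [h]
    simp
  have hpp : ∀ u, c.P x (c.P x u) = c.P x u := fun u => (c.P_mul le_rfl u).1
  have h2 : inner ℂ (c.P x ψ) (c.P x ψ) = (starRingEnd ℂ) (c.F 0 ψ x) + (y * Complex.I) * inner ℂ (c.P x ψ) (c.V (c.P x ψ)) := by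
    have := congrArg (inner ℂ (c.P x ψ)) h1
    rw [inner_add_right, inner_smul_right, ← P_sa _ _ _ (c.e 0), ← P_sa _ _ _ (c.V _), hpp, ← inner_conj_symm _ (c.e 0), c.inner_eP 0 hx.1 ψ] at this
    exact this
  have h3 := c.green (c.P x ψ) (c.P x ψ)
  rw [c.F_P hx.1 hx.2, c.F_P hx.1 hx.2, ← inner_conj_symm (c.V (c.P x ψ))] at h3
  rw [inner_self_eq_norm_sq_to_K] at h2
  set q := inner ℂ (c.P x ψ) (c.V (c.P x ψ))
  have h4 := congrArg Complex.im h3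
  have h5 := congrArg Complex.re h2
  simp at h4 h5
  unfold en
  have h6 : (((‖(c.P x) ψ‖ : ℝ) : ℂ) ^ 2).re = ‖c.P x ψ‖ ^ 2 := by
    rw [← Complex.ofReal_pow, Complex.ofReal_re]
  have h7 : ‖c.P x ψ‖ ^ 2 = (c.F 0 ψ x).re + -(y * q.im) := h6.symm.trans h5
  have h8 : ((starRingEnd ℂ) (c.F 0 ψ x) * c.F 1 ψ x).im = q.im := by
    simp only [Complex.mul_im, Complex.conj_re, Complex.conj_im]
    linarith
  rw [h7, h8]; ring

theorem en_AD (y : ℝ) (ψ : c.K) (a b : ℝ) : AD (c.en y ψ) (fun t => (c.g 0 ψ t).re - y *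
    ((starRingEnd ℂ) (c.g 0 ψ t) * c.F 1 ψ t + (starRingEnd ℂ) (c.F 0 ψ t) * c.g 1 ψ t).im) a b := by
  have := (c.F_AD 0 ψ a b).re.sub ((((c.F_AD 0 ψ a b).conj.mul (c.F_AD 1 ψ a b)).clm Complex.imCLM).const_mul y)
  exact this

theorem e_g (i j : Fin 2) : ∀ᵐ t, t ∈ Ioc 0 c.L → c.g i (c.e j) t = (c.h i j t : ℂ) := by
  filter_upwards [c.ae_iff.1 (c.e_ae j)] with t h ht
  rw [g_of_mem _ _ _ ht, h ht, gram]

theorem en_alg {a b w y d : ℝ} (ha : 0 ≤ a) (hb : 0 ≤ b) (hd : d = Real.sqrt (a * b - w ^ 2)) (hdet : w ^ 2 ≤ a * b) (f0 f1 : ℂ) :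
    2 * |y| * d * (f0.re - y * ((starRingEnd ℂ) f0 * f1).im) ≤
      ((a:ℂ) + (y * Complex.I) * (f1 * a - f0 * w)).re - y * ((starRingEnd ℂ) ((a:ℂ) + (y * Complex.I) * (f1 * a - f0 * w)) * f1 +
        (starRingEnd ℂ) f0 * ((w:ℂ) + (y * Complex.I) * (f1 * w - f0 * b))).im := by
  set Y0 : ℂ := 1 + y * Complex.I * f1 with hY0
  set Y1 : ℂ := - (y * Complex.I * f0) with hY1
  have e1 : ((a:ℂ) + (y * Complex.I) * (f1 * a - f0 * w)).re - y * ((starRingEnd ℂ) ((a:ℂ) + (y * Complex.I) * (f1 * a - f0 * w)) * f1 +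
        (starRingEnd ℂ) f0 * ((w:ℂ) + (y * Complex.I) * (f1 * w - f0 * b))).im = qN a b w Y1 (-Y0) := by
    unfold qN
    rw [← Complex.normSq_eq_norm_sq, ← Complex.normSq_eq_norm_sq, Complex.normSq_apply, Complex.normSq_apply, hY0, hY1]
    simp
    ring
  have e2 : ((starRingEnd ℂ) Y1 * (-Y0)).im = - y * (f0.re - y * ((starRingEnd ℂ) f0 * f1).im) := by
    rw [hY0, hY1]; simp; ring
  rw [e1]
  rcases ha.eq_or_lt with h0 | h0
  · have hw : w = 0 := by
      rw [← h0, zero_mul] at hdet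
      exact pow_eq_zero_iff two_ne_zero |>.1 (le_antisymm hdet (sq_nonneg _))
    have : d = 0 := by rw [hd, ← h0, hw]; simp
    rw [this]; simpa using qN_nonneg ha hb hdet Y1 (-Y0)
  · have := qN_im h0 (sub_nonneg.2 hdet) Y1 (-Y0)
    rw [← hd, e2, abs_mul, abs_neg] at this
    refine le_trans ?_ this
    have hd0 : 0 ≤ d := hd ▸ Real.sqrt_nonneg _
    have := le_abs_self (f0.re - y * ((starRingEnd ℂ) f0 * f1).im)
    have := mul_le_mul_of_nonneg_left this (show 0 ≤ 2 * |y| * d by positivity)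
    linarith

theorem en_grow {y : ℝ} {ψ : c.K} (h : ψ = c.e 0 + (y * Complex.I) • c.V ψ) {x0 x : ℝ} (h0 : 0 ≤ x0) (hx : x0 ≤ x)
    (hL : x ≤ c.L) : c.en y ψ x0 * Real.exp (2 * |y| * (c.T x - c.T x0)) ≤ c.en y ψ x := by
  have := (c.en_AD y ψ x0 x).gronwall_lower hx ((c.dd_ii x0 x).const_mul (2 * |y|)) ?_
  · rw [intervalIntegral.integral_const_mul, ← intervalIntegral.integral_interval_sub_left (c.dd_ii 0 x) (c.dd_ii 0 x0)] at this
    exact this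
  · have hx0 := h0.trans hx
    filter_upwards [ae_Icc_of_Ioc hx0 hL (c.g_sol h 0), ae_Icc_of_Ioc hx0 hL (c.g_sol h 1),
      ae_Icc_of_Ioc hx0 hL (c.e_g 0 0), ae_Icc_of_Ioc hx0 hL (c.e_g 1 0)] with t g0 g1 e0 e1 ht
    have ht' : t ∈ uIcc 0 x := by
      rw [uIcc_of_le hx] at ht; rw [uIcc_of_le hx0]; exact ⟨h0.trans ht.1, ht.2⟩
    rw [g0 ht', g1 ht', e0 ht', e1 ht', c.h_symm 1 0]
    have hp : ∀ i, 0 ≤ c.h i i t := fun i => by rw [h_diag]; positivity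
    exact en_alg (hp 0) (hp 1) rfl (c.h_det t) _ _

theorem lower (h0 : ∀ x ∈ Ioc 0 c.L, c.P x (c.e 0) ≠ 0) {x : ℝ} (hx : x ∈ Ioc 0 c.L) {ε : ℝ} (hε : 0 < ε) :
    ∃ k : ℝ, 0 < k ∧ ∀ y : ℝ, k * Real.exp ((c.T x - ε) * |y|) ≤ ‖c.P x (Ring.inverse (1 - ((y:ℂ) * Complex.I) • c.V) (c.e 0))‖ := by
  set x0 := min x (ε / 2) with hx0d
  have hx0 : x0 ∈ Ioc 0 c.L := ⟨lt_min hx.1 (half_pos hε), (min_le_left _ _).trans hx.2⟩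
  have hx0' : x0 ∈ Icc 0 c.L := ⟨hx0.1.le, hx0.2⟩
  have hT : c.T x - ε / 2 ≤ c.T x - c.T x0 := by
    linarith [c.T_le hx0'.1, min_le_right x (ε / 2)]
  set C := 1 + (ε / 2)⁻¹ * ‖c.V‖
  have hC : 0 < C := by positivity
  refine ⟨‖c.P x0 (c.e 0)‖ / C, div_pos (norm_pos_iff.2 (h0 x0 hx0)) hC, fun y => ?_⟩
  have hs := c.R_sol ((y:ℂ) * Complex.I) (c.e 0)
  set ψ := Ring.inverse (1 - ((y:ℂ) * Complex.I) • c.V) (c.e 0)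
  have hg := c.en_grow hs hx0'.1 (min_le_left _ _) hx.2
  rw [c.en_eq hs hx0', c.en_eq hs ⟨hx.1.le, hx.2⟩] at hg
  have h1 : c.P x0 (c.e 0) = c.P x0 ψ - ((y:ℂ) * Complex.I) • c.P x0 (c.V (c.P x0 ψ)) := by
    rw [c.PV hx0']
    have := congrArg (c.P x0) hs
    rw [map_add, map_smul] at this
    rw [eq_sub_iff_add_eq]; exact this.symm
  have h2 : ‖c.P x0 (c.e 0)‖ ≤ C * Real.exp (ε / 2 * |y|) * ‖c.P x0 ψ‖ := by
    rw [h1]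
    refine (norm_sub_le _ _).trans ?_
    rw [norm_smul]
    have e1 : ‖(y:ℂ) * Complex.I‖ = |y| := by simp
    rw [e1]
    have e2 : ‖c.P x0 (c.V (c.P x0 ψ))‖ ≤ ‖c.V‖ * ‖c.P x0 ψ‖ := (c.P_norm _ _).trans (c.V.le_opNorm _)
    have e3 := le_exp_mul (half_pos hε) |y|
    have e4 : 1 ≤ Real.exp (ε / 2 * |y|) := Real.one_le_exp (by positivity)
    calc _ ≤ Real.exp (ε / 2 * |y|) * ‖c.P x0 ψ‖ + ((ε / 2)⁻¹ * Real.exp (ε / 2 * |y|)) * (‖c.V‖ * ‖c.P x0 ψ‖) := by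
          gcongr
          exact le_mul_of_one_le_left (norm_nonneg _) e4
      _ = _ := by ring
  have h3 : ‖c.P x0 ψ‖ * Real.exp (|y| * (c.T x - ε / 2)) ≤ ‖c.P x ψ‖ := by
    refine (abs_le_of_sq_le_sq' ?_ (norm_nonneg _)).2
    refine le_trans ?_ hg
    rw [mul_pow, ← Real.exp_nat_mul]
    refine mul_le_mul_of_nonneg_left (Real.exp_le_exp.2 ?_) (by positivity)
    push_cast
    have := mul_le_mul_of_nonneg_left hT (abs_nonneg y)
    linarith
  refine le_trans ?_ h3
  rw [div_mul_eq_mul_div, div_le_iff₀ hC]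
  calc _ ≤ C * Real.exp (ε / 2 * |y|) * ‖c.P x0 ψ‖ * Real.exp ((c.T x - ε) * |y|) := by gcongr
    _ = C * ‖c.P x0 ψ‖ * (Real.exp (ε / 2 * |y|) * Real.exp ((c.T x - ε) * |y|)) := by ring
    _ = _ := by
      rw [← Real.exp_add]
      have : ε / 2 * |y| + (c.T x - ε) * |y| = |y| * (c.T x - ε / 2) := by ring
      rw [this]; ring

/-- condition (L) -/
def cond : Prop := ∀ ε > 0, ¬ ∀ᵐ t, t ∈ Ioc 0 ε → t ≤ c.L → c.h 0 0 t = 0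

theorem h_nonneg (i : Fin 2) (t : ℝ) : 0 ≤ c.h i i t := by rw [h_diag]; positivity

theorem Pe_ne (hc : c.cond) {x : ℝ} (hx : x ∈ Ioc 0 c.L) : c.P x (c.e 0) ≠ 0 := by
  intro h
  have h1 := c.gramP 0 0 (x := x) ⟨hx.1.le, hx.2⟩
  rw [h, inner_zero_right, eq_comm, Complex.ofReal_eq_zero] at h1
  apply hc x hx.1
  unfold I at h1
  rw [intervalIntegral.integral_eq_zero_iff_of_le_of_nonneg_ae hx.1.le (Eventually.of_forall fun t => c.h_nonneg 0 t) (c.h_ii 0 0 0 x)] at h1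
  have := (ae_restrict_iff' measurableSet_Ioc).1 h1
  filter_upwards [this] with t ht ht1 _
  exact ht ht1

end Coef
end PD6
end CS

namespace CS
section PD7
open Set Filter Topology ContinuousLinearMap

theorem ratio {D0 D1 g0 g1 : ℝ → ℂ} {h00 h01 h11 : ℝ → ℝ} {p q : ℝ} (hD0 : AD D0 g0 p q) (hD1 : AD D1 g1 p q)
    (h : ∀ᵐ t, t ∈ uIcc p q → D0 t * h11 t = D1 t * h01 t ∧ D0 t * h01 t = D1 t * h00 t ∧
      (starRingEnd ℂ) (D0 t) * g1 t = (starRingEnd ℂ) (D1 t) * g0 t ∧ h00 t + h11 t = 1 ∧ h01 t ^ 2 ≤ h00 t * h11 t)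
    (hn : ∀ t ∈ uIcc p q, D1 t ≠ 0) : ∃ r : ℂ, ∀ t ∈ uIcc p q, D0 t = r * D1 t := by
  have hc : ContinuousOn D1 (uIcc p q) := hD1.ac.continuousOn
  obtain ⟨t0, ht0, hm⟩ := isCompact_uIcc.exists_isMinOn (nonempty_uIcc) hc.norm
  have hi := hD1.inv (m := ‖D1 t0‖) (norm_pos_iff.2 (hn t0 ht0)) fun x hx => hm hx
  have hr := (hD0.mul hi).const_of_zero (by
    filter_upwards [h] with t h ht
    obtain ⟨a1, a2, a3, a4, a5⟩ := h ht
    have h1 := hn t ht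
    have key : D0 t * g1 t = D1 t * g0 t := by
      have hnz : (h11 t : ℂ) ≠ 0 := by
        intro h0
        rw [Complex.ofReal_eq_zero] at h0
        rw [h0, mul_zero] at a5
        have hw : h01 t = 0 := pow_eq_zero_iff two_ne_zero |>.1 (le_antisymm a5 (sq_nonneg _))
        rw [h0, add_zero] at a4
        rw [hw, a4] at a2
        simp at a2
        exact h1 a2.symm
      have b1 := congrArg (starRingEnd ℂ) a1
      simp only [map_mul, Complex.conj_ofReal] at b1
      have hcj : (starRingEnd ℂ) (D1 t) ≠ 0 := by simpa using h1
      have b2 : (h01 t : ℂ) * g1 t = h11 t * g0 t := by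
        apply mul_left_cancel₀ hcj
        linear_combination (-(g1 t)) * b1 + (h11 t : ℂ) * a3
      apply mul_left_cancel₀ hnz
      linear_combination g1 t * a1 + D1 t * b2
    field_simp
    linear_combination -key)
  refine ⟨D0 p * (D1 p)⁻¹, fun t ht => ?_⟩
  rw [hr p left_mem_uIcc t ht]
  have h1 := hn t ht
  field_simp

namespace Coef
variable (c : Coef)

/-- remaining integral -/
def D (i : Fin 2) (b : c.K) (x : ℝ) : ℂ := c.F i b c.L - c.F i b x

theorem D_AD (i : Fin 2) (b : c.K) (p q : ℝ) : AD (c.D i b) (fun t => - c.g i b t) p q :=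
  ((AD.const (c.F i b c.L) p q).sub (c.F_AD i b p q)).congr (Eventually.of_forall fun x _ => by simp)

theorem D_cont (i : Fin 2) (b : c.K) : Continuous (c.D i b) := continuous_const.sub (c.F_cont i b)

theorem ker_ae {b : c.K} (hb : adjoint c.V b = 0) : ∀ᵐ t, t ∈ Ioc 0 c.L → c.D 0 b t • c.ev 1 t = c.D 1 b t • c.ev 0 t := by
  filter_upwards [c.T_ae b, c.ae_iff.1 (Lp.coeFn_zero W 2 c.μ)] with t h1 h2 ht
  have := h1 ht
  rw [hb, h2 ht, Pi.zero_apply, eq_comm, sub_eq_zero] at this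
  exact this

theorem ker_alg {b : c.K} (hb : adjoint c.V b = 0) {p q : ℝ} (hp : 0 ≤ p) (hpq : p ≤ q) (hq : q ≤ c.L) :
    ∀ᵐ t, t ∈ uIcc p q → (c.D 0 b t • c.ev 1 t = c.D 1 b t • c.ev 0 t) ∧
      c.D 0 b t * c.h 1 1 t = c.D 1 b t * c.h 0 1 t ∧ c.D 0 b t * c.h 0 1 t = c.D 1 b t * c.h 0 0 t ∧
      (starRingEnd ℂ) (c.D 0 b t) * -c.g 1 b t = (starRingEnd ℂ) (c.D 1 b t) * -c.g 0 b t := by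
  have h0 : ∀ᵐ x : ℝ, x ∉ ({0} : Set ℝ) := measure_eq_zero_iff_ae_notMem.1 (measure_singleton 0)
  filter_upwards [c.ker_ae hb, h0] with t h1 h2 ht
  rw [uIcc_of_le hpq] at ht
  have ht' : t ∈ Ioc 0 c.L := ⟨lt_of_le_of_ne (hp.trans ht.1) (Ne.symm h2), ht.2.trans hq⟩
  have h := h1 ht'
  refine ⟨h, ?_, ?_, ?_⟩
  · have := congrArg (inner ℂ (c.ev 1 t)) h
    rwa [inner_smul_right, inner_smul_right, gram, gram, c.h_symm 1 0] at this
  · have := congrArg (inner ℂ (c.ev 0 t)) h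
    rwa [inner_smul_right, inner_smul_right, gram, gram] at this
  · have := congrArg (fun u => inner ℂ u (b t)) h
    simp only [inner_smul_left] at this
    rw [g_of_mem _ _ _ ht', g_of_mem _ _ _ ht', mul_neg, mul_neg, this]

/-- constancy on an interval, case of nonvanishing second component -/
theorem loc1 {b : c.K} (hb : adjoint c.V b = 0) {p q : ℝ} (hp : 0 ≤ p) (hpq : p ≤ q) (hq : q ≤ c.L)
    (hn : ∀ t ∈ Icc p q, c.D 1 b t ≠ 0) : ∃ r : ℂ, (∀ t ∈ Icc p q, c.D 0 b t = r * c.D 1 b t) ∧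
      ∀ᵐ t, t ∈ Icc p q → c.ev 0 t = r • c.ev 1 t := by
  have ha := c.ker_alg hb hp hpq hq
  rw [← uIcc_of_le hpq] at hn ⊢
  obtain ⟨r, hr⟩ := ratio (c.D_AD 0 b p q) (c.D_AD 1 b p q) (h00 := c.h 0 0) (h01 := c.h 0 1) (h11 := c.h 1 1) (by
    filter_upwards [ha] with t h ht
    exact ⟨(h ht).2.1, (h ht).2.2.1, (h ht).2.2.2, c.tr t, c.h_det t⟩) hn
  refine ⟨r, hr, ?_⟩
  filter_upwards [ha] with t h ht
  have := (h ht).1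
  rw [hr t ht, mul_comm, mul_smul] at this
  exact (smul_right_injective _ (hn t ht) this).symm

theorem loc0 {b : c.K} (hb : adjoint c.V b = 0) {p q : ℝ} (hp : 0 ≤ p) (hpq : p ≤ q) (hq : q ≤ c.L)
    (hn : ∀ t ∈ Icc p q, c.D 0 b t ≠ 0) : ∃ r : ℂ, 
      ∀ᵐ t, t ∈ Icc p q → c.ev 1 t = r • c.ev 0 t := by
  have ha := c.ker_alg hb hp hpq hq
  rw [← uIcc_of_le hpq] at hn ⊢
  obtain ⟨r, hr⟩ := ratio (c.D_AD 1 b p q) (c.D_AD 0 b p q) (h00 := c.h 1 1) (h01 := c.h 0 1) (h11 := c.h 0 0) (by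
    filter_upwards [ha] with t h ht
    exact ⟨(h ht).2.2.1.symm, (h ht).2.1.symm, (h ht).2.2.2.symm, by linarith [c.tr t], by linarith [c.h_det t]⟩) hn
  refine ⟨r, ?_⟩
  filter_upwards [ha] with t h ht
  have := (h ht).1
  rw [hr t ht, mul_comm, mul_smul] at this
  exact smul_right_injective _ (hn t ht) this

/-- on a small interval where a continuous function does not vanish -/
theorem nonvan {f : ℝ → ℂ} (hf : Continuous f) {x : ℝ} (hx : f x ≠ 0) : ∃ δ > 0, ∀ t ∈ Icc (x - δ) (x + δ), f t ≠ 0 := by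
  have : ∀ᶠ t in 𝓝 x, f t ≠ 0 := hf.continuousAt.eventually_ne hx
  obtain ⟨ε, hε, h⟩ := Metric.eventually_nhds_iff.1 this
  refine ⟨ε / 2, half_pos hε, fun t ht => h ?_⟩
  rw [Real.dist_eq, abs_lt]; constructor <;> linarith [ht.1, ht.2]

theorem ker_f (hc : c.cond) {b : c.K} (hb : adjoint c.V b = 0) (h0 : inner ℂ (c.e 0) b = 0) : inner ℂ (c.e 1) b = 0 := by
  rw [inner_e] at *
  by_contra h1
  have hD1 : c.D 1 b 0 ≠ 0 := by simpa [D] using h1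
  have hD0 : c.D 0 b 0 = 0 := by simpa [D] using h0
  obtain ⟨δ, hδ, hn⟩ := nonvan (c.D_cont 1 b) hD1
  have hm : 0 < min δ c.L := lt_min hδ c.hL
  obtain ⟨r, hr, he⟩ := c.loc1 hb le_rfl hm.le (min_le_right _ _) fun t ht => hn t
    ⟨by linarith [ht.1], by linarith [ht.2, min_le_left δ c.L]⟩
  have : r = 0 := by
    have := hr 0 ⟨le_rfl, hm.le⟩
    rw [hD0, eq_comm, mul_eq_zero] at this
    exact this.resolve_right hD1
  apply hc _ hm
  filter_upwards [he] with t ht ht1 _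
  have := ht ⟨ht1.1.le, ht1.2⟩
  rw [h_diag, this]; simp [‹r = 0›]

theorem loc_h {b : c.K} (hb : adjoint c.V b = 0) {x : ℝ} (hx : x ∈ Ioo 0 c.L) (hne : c.D 0 b x ≠ 0 ∨ c.D 1 b x ≠ 0) :
    ∃ k : Fin 2 → Fin 2 → ℝ, k 0 0 * k 1 1 = k 0 1 ^ 2 ∧ ∃ p q, 0 ≤ p ∧ p < x ∧ x < q ∧ q ≤ c.L ∧
      ∀ᵐ t, t ∈ Icc p q → ∀ i j, c.h i j t = k i j := by
  obtain ⟨i0, hi0⟩ : ∃ i, c.D i b x ≠ 0 := by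
    rcases hne with h | h
    exacts [⟨_, h⟩, ⟨_, h⟩]
  obtain ⟨δ, hδ, hn⟩ := nonvan (c.D_cont i0 b) hi0
  set p := max 0 (x - δ)
  set q := min c.L (x + δ)
  have hp : 0 ≤ p := le_max_left _ _
  have hpx : p < x := max_lt hx.1 (by linarith)
  have hxq : x < q := lt_min hx.2 (by linarith)
  have hq : q ≤ c.L := min_le_left _ _
  have hn' : ∀ t ∈ Icc p q, c.D i0 b t ≠ 0 := fun t ht => hn t
    ⟨(le_max_right _ _).trans ht.1, ht.2.trans (min_le_right _ _)⟩
  have hex : ∃ i j : Fin 2, ∃ r : ℂ, ((i = 0 ∧ j = 1) ∨ (i = 1 ∧ j = 0)) ∧ ∀ᵐ t, t ∈ Icc p q → c.ev j t = r • c.ev i t := by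
    fin_cases i0
    · obtain ⟨r, he⟩ := c.loc0 hb hp (hpx.trans hxq).le hq hn'
      exact ⟨0, 1, r, Or.inl ⟨rfl, rfl⟩, he⟩
    · obtain ⟨r, -, he⟩ := c.loc1 hb hp (hpx.trans hxq).le hq hn'
      exact ⟨1, 0, r, Or.inr ⟨rfl, rfl⟩, he⟩
  obtain ⟨i, j, r, hij, he⟩ := hex
  have hsame : ∀ t, c.ev j t = r • c.ev i t → c.h i i t = 1 / (1 + ‖r‖ ^ 2) ∧ c.h j j t = ‖r‖ ^ 2 / (1 + ‖r‖ ^ 2) ∧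
      c.h i j t = r.re / (1 + ‖r‖ ^ 2) ∧ c.h j i t = r.re / (1 + ‖r‖ ^ 2) ∧ c.h i i t * c.h j j t = c.h i j t ^ 2 := by
    intro t ht
    have hN : 0 < 1 + ‖r‖ ^ 2 := by positivity
    have e1 : c.h j j t = ‖r‖ ^ 2 * c.h i i t := by
      rw [h_diag, h_diag, ht, norm_smul, mul_pow]
    have e2 : (c.h i j t : ℂ) = r * c.h i i t := by
      rw [← gram, ← gram, ht, inner_smul_right]
    have e3 : c.h i j t = r.re * c.h i i t := by
      have := congrArg Complex.re e2
      simpa using this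
    have e4 : c.h i j t ^ 2 = ‖r‖ ^ 2 * c.h i i t ^ 2 := by
      have := congrArg (fun z : ℂ => ‖z‖ ^ 2) e2
      simpa [mul_pow] using this
    have etr : c.h i i t + c.h j j t = 1 := by
      have := c.tr t
      rcases hij with ⟨rfl, rfl⟩ | ⟨rfl, rfl⟩ <;> linarith
    have e5 : c.h i i t = 1 / (1 + ‖r‖ ^ 2) := by
      rw [eq_div_iff hN.ne']; rw [e1] at etr; linarith
    refine ⟨e5, ?_, ?_, ?_, ?_⟩
    · rw [e1, e5]; ring
    · rw [e3, e5]; ring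
    · rw [c.h_symm, e3, e5]; ring
    · rw [e4, e1]; ring
  obtain ⟨t0, ht0⟩ : ∃ t0, c.ev j t0 = r • c.ev i t0 := by
    by_contra hno
    push Not at hno
    have : volume (Icc p q) = 0 := by
      rw [measure_eq_zero_iff_ae_notMem]
      filter_upwards [he] with t ht hm
      exact hno t (ht hm)
    rw [Real.volume_Icc, ENNReal.ofReal_eq_zero] at this
    linarith
  have s0 := hsame t0 ht0
  refine ⟨fun a b => c.h a b t0, ?_, p, q, hp, hpx, hxq, hq, ?_⟩
  · have := s0.2.2.2.2
    rcases hij with ⟨rfl, rfl⟩ | ⟨rfl, rfl⟩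
    · exact this
    · show c.h 0 0 t0 * c.h 1 1 t0 = c.h 0 1 t0 ^ 2
      rw [c.h_symm 0 1, ← this, mul_comm]
  · filter_upwards [he] with t ht hm
    have s1 := hsame t (ht hm)
    have all : ∀ a b, (a = i ∨ a = j) → (b = i ∨ b = j) → c.h a b t = c.h a b t0 := by
      rintro a b (rfl | rfl) (rfl | rfl)
      · rw [s1.1, s0.1]
      · rw [s1.2.2.1, s0.2.2.1]
      · rw [s1.2.2.2.1, s0.2.2.2.1]
      · rw [s1.2.1, s0.2.1]
    have cov : ∀ a : Fin 2, a = i ∨ a = j := by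
      rcases hij with ⟨rfl, rfl⟩ | ⟨rfl, rfl⟩ <;> decide
    exact fun a b => all a b (cov a) (cov b)

/-- regular points -/
def reg : Set ℝ := {x | x ∈ Icc 0 c.L ∧ ∀ b : c.K, adjoint c.V b = 0 → inner ℂ (c.e 0) b = 0 →
  inner ℂ (c.e 0) (c.P x b) = 0 ∧ inner ℂ (c.e 1) (c.P x b) = 0}

theorem reg_closed : IsClosed c.reg := by
  have : c.reg = Icc 0 c.L ∩ ⋂ b : c.K, ⋂ (_ : adjoint c.V b = 0), ⋂ (_ : inner ℂ (c.e 0) b = 0),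
      {x | c.F 0 b x = 0} ∩ {x | c.F 1 b x = 0} := by
    ext x
    simp only [reg, mem_inter_iff, mem_iInter]
    refine and_congr_right fun hx => ?_
    simp only [c.inner_eP _ hx.1]
    rfl
  rw [this]
  refine isClosed_Icc.inter (isClosed_iInter fun b => isClosed_iInter fun _ => isClosed_iInter fun _ => ?_)
  exact (isClosed_eq (c.F_cont 0 b) continuous_const).inter (isClosed_eq (c.F_cont 1 b) continuous_const)

theorem reg_zero : (0:ℝ) ∈ c.reg := ⟨⟨le_rfl, c.hL.le⟩, fun b _ _ => by simp [P_zero]⟩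
theorem reg_L (hc : c.cond) : c.L ∈ c.reg := ⟨⟨c.hL.le, le_rfl⟩, fun b h1 h2 => by
  rw [P_L]; exact ⟨h2, c.ker_f hc h1 h2⟩⟩

theorem irreg_loc (hc : c.cond) {x : ℝ} (hx : x ∈ Icc 0 c.L) (hr : x ∉ c.reg) :
    ∃ k : Fin 2 → Fin 2 → ℝ, k 0 0 * k 1 1 = k 0 1 ^ 2 ∧ ∃ p q, 0 ≤ p ∧ p < x ∧ x < q ∧ q ≤ c.L ∧
      ∀ᵐ t, t ∈ Icc p q → ∀ i j, c.h i j t = k i j := by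
  have hx' : x ∈ Ioo 0 c.L := by
    refine ⟨lt_of_le_of_ne hx.1 ?_, lt_of_le_of_ne hx.2 ?_⟩
    · rintro rfl; exact hr c.reg_zero
    · rintro rfl; exact hr (c.reg_L hc)
  have : ∃ b : c.K, adjoint c.V b = 0 ∧ inner ℂ (c.e 0) b = 0 ∧ ¬ (inner ℂ (c.e 0) (c.P x b) = 0 ∧ inner ℂ (c.e 1) (c.P x b) = 0) := by
    by_contra hno
    apply hr
    refine ⟨hx, fun b h1 h2 => ?_⟩
    by_contra h3
    exact hno ⟨b, h1, h2, h3⟩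
  obtain ⟨b, h1, h2, h3⟩ := this
  have h4 := c.ker_f hc h1 h2
  rw [c.inner_eP _ hx.1, c.inner_eP _ hx.1, not_and_or] at h3
  rw [inner_e] at h2 h4
  refine c.loc_h h1 hx' ?_
  simpa [D, h2, h4] using h3

theorem I_affine {p q : ℝ} (hpq : p ≤ q) {i j : Fin 2} {k : ℝ} (h : ∀ᵐ t, t ∈ Ioo p q → c.h i j t = k) {y : ℝ}
    (hy : y ∈ Icc p q) : c.I i j y = c.I i j p + (y - p) * k := by
  have h1 := AD.integral (f := fun _ : ℝ => k) (a := p) (b := q) (c := p) intervalIntegrable_const left_mem_uIcc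
  have hp : ∀ᵐ x : ℝ, x ∉ ({p} : Set ℝ) := measure_eq_zero_iff_ae_notMem.1 (measure_singleton p)
  have hq : ∀ᵐ x : ℝ, x ∉ ({q} : Set ℝ) := measure_eq_zero_iff_ae_notMem.1 (measure_singleton q)
  have := ((c.I_AD i j p q).sub h1).const_of_zero (by
    filter_upwards [h, hp, hq] with t h hp hq ht
    rw [uIcc_of_le hpq] at ht
    rw [h ⟨lt_of_le_of_ne ht.1 (Ne.symm hp), lt_of_le_of_ne ht.2 hq⟩, sub_self]) y (by rwa [uIcc_of_le hpq]) p left_mem_uIcc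
  simp only [intervalIntegral.integral_const, smul_eq_mul] at this
  linarith

theorem comp_const (hc : c.cond) {a d : ℝ} (had : a < d) (ha : 0 ≤ a) (hd : d ≤ c.L) (hr : ∀ y ∈ Ioo a d, y ∉ c.reg) :
    ∃ k : Fin 2 → Fin 2 → ℝ, k 0 0 * k 1 1 = k 0 1 ^ 2 ∧ ∀ᵐ t, t ∈ Ioo a d → ∀ i j, c.h i j t = k i j := by
  have hloc : ∀ x ∈ Ioo a d, ∃ k : Fin 2 → Fin 2 → ℝ, k 0 0 * k 1 1 = k 0 1 ^ 2 ∧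
      ∀ᶠ y in 𝓝 x, ∀ i j, HasDerivAt (c.I i j) (k i j) y := by
    intro x hx
    obtain ⟨k, hk, p, q, h0, hp, hq, hL, h⟩ := c.irreg_loc hc (x := x) ⟨ha.trans hx.1.le, hx.2.le.trans hd⟩ (hr x hx)
    refine ⟨k, hk, ?_⟩
    filter_upwards [Ioo_mem_nhds hp hq] with y hy i j
    have e : ∀ᶠ w in 𝓝 y, c.I i j w = c.I i j p + (w - p) * k i j := by
      filter_upwards [Ioo_mem_nhds hy.1 hy.2] with w hw
      refine c.I_affine (hp.trans hq).le ?_ ⟨hw.1.le, hw.2.le⟩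
      filter_upwards [h] with t ht hm
      exact ht ⟨hm.1.le, hm.2.le⟩ i j
    have hd : HasDerivAt (fun w => c.I i j p + (w - p) * k i j) (k i j) y := by
      simpa using (((hasDerivAt_id y).sub_const p).mul_const (k i j)).const_add (c.I i j p)
    exact hd.congr_of_eventuallyEq e
  set m := (a + d) / 2
  have hm : m ∈ Ioo a d := ⟨by simp only [m]; linarith, by simp only [m]; linarith⟩
  obtain ⟨k, hk, hkm⟩ := hloc m hm
  have hconst : ∀ i j, ∀ x ∈ Ioo a d, HasDerivAt (c.I i j) (k i j) x := by
    intro i j x hx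
    have hz : ∀ y ∈ Ioo a d, HasDerivAt (deriv (c.I i j)) 0 y := by
      intro y hy
      obtain ⟨k', -, h'⟩ := hloc y hy
      refine (hasDerivAt_const y (k' i j)).congr_of_eventuallyEq ?_
      filter_upwards [h'] with w hw
      exact (hw i j).deriv
    have := isOpen_Ioo.is_const_of_deriv_eq_zero isPreconnected_Ioo
      (fun y hy => (hz y hy).differentiableAt.differentiableWithinAt) (fun y hy => (hz y hy).deriv) hx hm
    obtain ⟨k', -, h'⟩ := hloc x hx
    have h2 := h'.self_of_nhds i j
    rw [h2.deriv, (hkm.self_of_nhds i j).deriv] at this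
    rwa [this] at h2
  refine ⟨k, hk, ?_⟩
  filter_upwards [(c.I_AD 0 0 a d).der, (c.I_AD 0 1 a d).der, (c.I_AD 1 0 a d).der, (c.I_AD 1 1 a d).der] with t h00 h01 h10 h11 ht
  have ht' : t ∈ uIcc a d := by rw [uIcc_of_le had.le]; exact ⟨ht.1.le, ht.2.le⟩
  intro i j
  refine HasDerivAt.unique ?_ (hconst i j t ht)
  fin_cases i <;> fin_cases j
  exacts [h00 ht', h01 ht', h10 ht', h11 ht']

theorem irreg (hc : c.cond) {x : ℝ} (hx : x ∈ Icc 0 c.L) (hr : x ∉ c.reg) : ∃ a d, a < x ∧ x < d ∧ a ∈ c.reg ∧ d ∈ c.reg ∧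
    (∀ y ∈ Ioo a d, y ∉ c.reg) := by
  have hc0 := c.reg_closed
  have hA : IsCompact (c.reg ∩ Icc 0 x) := isCompact_Icc.inter_left hc0
  have hB : IsCompact (c.reg ∩ Icc x c.L) := isCompact_Icc.inter_left hc0
  have nA : (c.reg ∩ Icc 0 x).Nonempty := ⟨0, c.reg_zero, le_rfl, hx.1⟩
  have nB : (c.reg ∩ Icc x c.L).Nonempty := ⟨c.L, c.reg_L hc, hx.2, le_rfl⟩
  have mA := hA.sSup_mem nA
  have mB := hB.sInf_mem nB
  refine ⟨sSup (c.reg ∩ Icc 0 x), sInf (c.reg ∩ Icc x c.L), ?_, ?_, mA.1, mB.1, ?_⟩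
  · exact lt_of_le_of_ne mA.2.2 fun h => hr (h ▸ mA.1)
  · exact lt_of_le_of_ne mB.2.1 fun h => hr (h ▸ mB.1)
  · intro y hy hyr
    rcases le_total y x with h | h
    · exact absurd (le_csSup hA.bddAbove ⟨hyr, hyr.1.1, h⟩) (not_le.2 hy.1)
    · exact absurd (csInf_le hB.bddBelow ⟨hyr, h, hyr.1.2⟩) (not_le.2 hy.2)

theorem comp_dir (hc : c.cond) {a d : ℝ} (had : a < d) (ha : 0 ≤ a) (hd : d ≤ c.L) (hr : ∀ y ∈ Ioo a d, y ∉ c.reg) :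
    ∃ α β : ℝ, (α ≠ 0 ∨ β ≠ 0) ∧ ∀ᵐ t, t ∈ Ioo a d → (β:ℂ) • c.ev 0 t = (α:ℂ) • c.ev 1 t := by
  obtain ⟨k, hk, h⟩ := c.comp_const hc had ha hd hr
  have nrm : ∀ (α β : ℝ) t, ‖(β:ℂ) • c.ev 0 t - (α:ℂ) • c.ev 1 t‖ ^ 2 = β ^ 2 * c.h 0 0 t - 2 * (α * β * c.h 0 1 t) + α ^ 2 * c.h 1 1 t := by
    intro α β t
    rw [@norm_sub_sq ℂ, norm_smul, norm_smul, mul_pow, mul_pow, ← h_diag, ← h_diag, inner_smul_left, inner_smul_right, gram]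
    simp only [Complex.norm_real, Real.norm_eq_abs, sq_abs, Complex.conj_ofReal]
    have : RCLike.re ((β:ℂ) * (α * (c.h 0 1 t : ℂ))) = α * β * c.h 0 1 t := by
      rw [show RCLike.re ((β:ℂ) * (α * (c.h 0 1 t : ℂ))) = Complex.re ((β:ℂ) * (α * (c.h 0 1 t : ℂ))) from rfl]
      rw [Complex.re_ofReal_mul, Complex.re_ofReal_mul, Complex.ofReal_re]; ring
    rw [this]
  have fin : ∀ α β : ℝ, β ^ 2 * k 0 0 - 2 * (α * β * k 0 1) + α ^ 2 * k 1 1 = 0 →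
      ∀ᵐ t, t ∈ Ioo a d → (β:ℂ) • c.ev 0 t = (α:ℂ) • c.ev 1 t := by
    intro α β h0
    filter_upwards [h] with t ht hm
    have := nrm α β t
    rw [ht hm, ht hm, ht hm, h0] at this
    rw [← sub_eq_zero, ← norm_eq_zero]
    exact pow_eq_zero_iff two_ne_zero |>.1 this
  by_cases h1 : k 1 1 = 0
  · refine ⟨1, 0, Or.inl one_ne_zero, fin _ _ ?_⟩
    rw [h1]; ring
  · refine ⟨k 0 1, k 1 1, Or.inr h1, fin _ _ ?_⟩
    linear_combination (k 1 1) * hk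

theorem P_congr {x : ℝ} {w : c.K} (h : c.P x w = 0) : ∀ᵐ t, t ∈ Ioc 0 c.L → t ≤ x → w t = 0 := by
  have := c.P_ae x w
  rw [h] at this
  filter_upwards [c.ae_iff.1 this, c.ae_iff.1 (Lp.coeFn_zero W 2 c.μ)] with t h1 h2 ht hx
  have := h1 ht
  rw [h2 ht, indicator_of_mem (show t ∈ Iic x from hx)] at this
  exact this.symm

theorem comp_w (hc : c.cond) {a d : ℝ} (had : a < d) (ha : 0 ≤ a) (hd : d ≤ c.L) (hr : ∀ y ∈ Ioo a d, y ∉ c.reg) :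
    ∃ u1 u2 : ℂ, (u1 ≠ 0 ∨ u2 ≠ 0) ∧ ∀ w : c.K, c.P a w = 0 → c.P d w = w →
      u1 * inner ℂ (c.e 0) w + u2 * inner ℂ (c.e 1) w = 0 ∧
      (inner ℂ (c.e 0) w = 0 → inner ℂ (c.e 1) w = 0 → adjoint c.V w = 0) := by
  obtain ⟨α, β, hne, h⟩ := c.comp_dir hc had ha hd hr
  refine ⟨β, -α, ?_, fun w hw1 hw2 => ?_⟩
  · rw [neg_ne_zero, Complex.ofReal_ne_zero, Complex.ofReal_ne_zero]; exact hne.symm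
  have F0 : ∀ i, ∀ t, t ≤ a → 0 ≤ t → c.F i w t = 0 := by
    intro i t hta ht0
    rw [← c.inner_eP i ht0, ← (c.P_mul hta w).1, hw1]; simp
  have F1 : ∀ i, ∀ t, d ≤ t → c.F i w t = c.F i w c.L := by
    intro i t hdt
    rw [← hw2, c.F_P (ha.trans had.le) hdt, c.F_P (ha.trans had.le) hd]
  have hlin : ∀ t ∈ Icc a d, (β:ℂ) * c.F 0 w t - α * c.F 1 w t = 0 := by
    intro t ht
    have hp : ∀ᵐ x : ℝ, x ∉ ({d} : Set ℝ) := measure_eq_zero_iff_ae_notMem.1 (measure_singleton d)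
    have hq : ∀ᵐ x : ℝ, x ∉ ({a} : Set ℝ) := measure_eq_zero_iff_ae_notMem.1 (measure_singleton a)
    have := (((c.F_AD 0 w a d).const_mul (β:ℂ)).sub ((c.F_AD 1 w a d).const_mul (α:ℂ))).const_of_zero (by
      filter_upwards [h, hp, hq] with t h hp hq ht
      rw [uIcc_of_le had.le] at ht
      have hm : t ∈ Ioo a d := ⟨lt_of_le_of_ne ht.1 (Ne.symm hq), lt_of_le_of_ne ht.2 hp⟩
      have hm' : t ∈ Ioc 0 c.L := ⟨ha.trans_lt hm.1, hm.2.le.trans hd⟩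
      have := congrArg (fun u => inner ℂ u (w t)) (h hm)
      simp only [inner_smul_left, Complex.conj_ofReal] at this
      rw [g_of_mem _ _ _ hm', g_of_mem _ _ _ hm', this, sub_self]) t (by rwa [uIcc_of_le had.le]) a left_mem_uIcc
    rw [this, F0 0 a le_rfl ha, F0 1 a le_rfl ha]; simp
  refine ⟨?_, fun z0 z1 => ?_⟩
  · rw [inner_e, inner_e, ← F1 0 d le_rfl, ← F1 1 d le_rfl]
    linear_combination hlin d ⟨had.le, le_rfl⟩
  · rw [inner_e] at z0 z1
    apply Lp.ext
    have hp : ∀ᵐ x : ℝ, x ∉ ({d} : Set ℝ) := measure_eq_zero_iff_ae_notMem.1 (measure_singleton d)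
    show ∀ᵐ t ∂c.μ, _
    rw [ae_iff]
    filter_upwards [c.T_ae w, c.ae_iff.1 (Lp.coeFn_zero W 2 c.μ), h, hp] with t h1 h2 h3 hp ht
    rw [h1 ht, h2 ht, z0, z1, Pi.zero_apply, zero_sub, zero_sub]
    rcases le_or_gt t a with hta | hta
    · rw [F0 0 t hta ht.1.le, F0 1 t hta ht.1.le]; simp
    rcases lt_or_ge t d with htd | htd
    · have e1 := h3 ⟨hta, htd⟩
      have e2 := hlin t ⟨hta.le, htd.le⟩
      rcases hne with hα | hβ
      · have hα' : (α:ℂ) ≠ 0 := by exact_mod_cast hα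
        apply smul_right_injective _ hα'
        show (α:ℂ) • _ = (α:ℂ) • (0:W)
        rw [smul_zero, smul_sub, smul_smul, smul_smul, mul_comm (α:ℂ), mul_smul, ← e1, smul_smul, ← sub_smul]
        have : -c.F 0 w t * β - α * -c.F 1 w t = 0 := by linear_combination -e2
        rw [this, zero_smul]
      · have hβ' : (β:ℂ) ≠ 0 := by exact_mod_cast hβ
        apply smul_right_injective _ hβ'
        show (β:ℂ) • _ = (β:ℂ) • (0:W)
        rw [smul_zero, smul_sub, smul_smul, smul_smul, mul_comm (β:ℂ) (-c.F 1 w t), mul_smul (-c.F 1 w t), e1, smul_smul, ← sub_smul]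
        have : β * -c.F 0 w t - -c.F 1 w t * α = 0 := by linear_combination -e2
        rw [this, zero_smul]
    · rw [F1 0 t htd, F1 1 t htd, z0, z1]; simp

end Coef
end PD7
end CS

namespace CS
section PE1
open Set Filter Topology ContinuousLinearMap

variable {E : Type*} [NormedAddCommGroup E] [InnerProductSpace ℂ E] [CompleteSpace E]
variable {E' : Type*} [NormedAddCommGroup E'] [InnerProductSpace ℂ E'] [CompleteSpace E']

structure QSys (V : E →L[ℂ] E) (e1 e2 : E) : Prop where
  adj : ∀ x, adjoint V x = V x - inner ℂ e2 x • e1 + inner ℂ e1 x • e2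
  qn : ∀ z : ℂ, Tendsto (fun n : ℕ => ‖(z • V) ^ n‖) atTop (𝓝 0)

theorem pow_succ_apply (V : E →L[ℂ] E) (n : ℕ) (x : E) : (V ^ (n + 1)) x = V ((V ^ n) x) := by
  rw [pow_succ']; rfl

theorem pow_succ_apply_right (V : E →L[ℂ] E) (n : ℕ) (x : E) : (V ^ (n + 1)) x = (V ^ n) (V x) := by
  rw [pow_succ]; rfl

theorem orth_of_ker {V : E →L[ℂ] E} {e1 w : E} (h : adjoint V w = 0) (h1 : inner ℂ e1 w = 0) (n : ℕ) :
    inner ℂ ((V ^ n) e1) w = 0 := by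
  cases n with
  | zero => simpa using h1
  | succ n => rw [pow_succ_apply, ← adjoint_inner_right, h, inner_zero_right]

theorem logconvex {a : ℕ → ℝ} (h0 : ∀ n, 0 ≤ a n) (h : ∀ n, a (n + 1) ^ 2 ≤ a n * a (n + 2)) (h1 : 0 < a 1) (ha0 : 0 < a 0) :
    ∀ n, 0 < a n ∧ a 1 / a 0 * a n ≤ a (n + 1) := by
  have hρ : 0 < a 1 / a 0 := div_pos h1 ha0
  intro n
  induction n with
  | zero => exact ⟨ha0, by rw [div_mul_cancel₀ _ ha0.ne']⟩
  | succ n ih =>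
    obtain ⟨i1, i2⟩ := ih
    have hp : 0 < a (n + 1) := lt_of_lt_of_le (mul_pos hρ i1) i2
    refine ⟨hp, ?_⟩
    have := h n
    have h2 : a (n+1) * (a 1 / a 0 * a n) ≤ a (n+1) * a (n+1) := mul_le_mul_of_nonneg_left i2 hp.le
    refine le_of_mul_le_mul_left ?_ i1
    nlinarith

theorem ker_of_orth {V : E →L[ℂ] E} {e1 e2 : E} (hs : QSys V e1 e2) {w : E} (h : ∀ n : ℕ, inner ℂ ((V ^ n) e1) w = 0) :
    adjoint V w = 0 := by
  set T := adjoint V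
  have hT : ∀ k n : ℕ, inner ℂ ((V ^ n) e1) ((T ^ k) w) = 0 := by
    intro k
    induction k with
    | zero => simpa using h
    | succ k ih =>
      intro n
      rw [pow_succ_apply, adjoint_inner_right, ← pow_succ_apply]
      exact ih (n + 1)
  have h1 : ∀ k, inner ℂ e1 ((T ^ k) w) = 0 := fun k => by simpa using hT k 0
  have sym : ∀ k l, inner ℂ (T ((T ^ k) w)) ((T ^ l) w) = inner ℂ ((T ^ k) w) (T ((T ^ l) w)) := by
    intro k l
    conv_rhs => rw [adjoint_inner_right]
    rw [hs.adj, h1, inner_add_left, inner_sub_left, inner_smul_left, h1]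
    simp
  by_contra hne
  have hne' : 0 < ‖T w‖ := norm_pos_iff.2 hne
  have hw : 0 < ‖w‖ := by
    rw [norm_pos_iff]; rintro rfl; exact hne (map_zero _)
  have lc := logconvex (a := fun n => ‖(T ^ n) w‖) (fun n => norm_nonneg _) (fun n => by
    have e : (‖(T ^ (n + 1)) w‖ ^ 2 : ℂ) = inner ℂ ((T ^ n) w) ((T ^ (n + 2)) w) := by
      have := sym n (n+1)
      rw [← pow_succ_apply, ← pow_succ_apply] at this
      rw [← this]
      exact (inner_self_eq_norm_sq_to_K (𝕜 := ℂ) ((T ^ (n + 1)) w)).symm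
    have := congrArg norm e
    rw [norm_pow, Complex.norm_real, norm_norm] at this
    show ‖(T ^ (n + 1)) w‖ ^ 2 ≤ _
    rw [this]
    exact norm_inner_le_norm (𝕜 := ℂ) ((T ^ n) w) ((T ^ (n + 2)) w)) (by simpa using hne') (by simpa using hw)
  simp only [pow_one, pow_zero] at lc
  set ρ := ‖T w‖ / ‖(1 : E →L[ℂ] E) w‖ with hρ
  have hρ0 : 0 < ρ := div_pos hne' (by simpa using hw)
  have low : ∀ n : ℕ, ρ ^ n * ‖w‖ ≤ ‖(T ^ n) w‖ := by
    intro n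
    induction n with
    | zero => simp
    | succ n ih =>
      calc _ = ρ * (ρ ^ n * ‖w‖) := by ring
        _ ≤ ρ * ‖(T ^ n) w‖ := by gcongr
        _ ≤ _ := (lc n).2
  have nT : ∀ n : ℕ, ρ ^ n ≤ ‖V ^ n‖ := by
    intro n
    have e : ‖T ^ n‖ = ‖V ^ n‖ := by
      have : T ^ n = star (V ^ n) := by rw [star_pow]; rfl
      rw [this, norm_star]
    rw [← e]
    have := (low n).trans ((T ^ n).le_opNorm w)
    exact le_of_mul_le_mul_right this hw
  have hq := hs.qn ((ρ⁻¹ : ℝ) : ℂ)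
  have : ∀ n : ℕ, (1:ℝ) ≤ ‖((ρ⁻¹ : ℝ) : ℂ) • V‖ ^ 0 * ‖(((ρ⁻¹ : ℝ) : ℂ) • V) ^ n‖ := by
    intro n
    rw [pow_zero, one_mul, smul_pow, norm_smul, norm_pow, Complex.norm_real, Real.norm_eq_abs, abs_of_pos (inv_pos.2 hρ0)]
    calc (1:ℝ) = (ρ⁻¹) ^ n * ρ ^ n := by rw [← mul_pow, inv_mul_cancel₀ hρ0.ne', one_pow]
      _ ≤ _ := by gcongr; exact nT n
  have := ge_of_tendsto' hq (b := 1) (fun n => by simpa using this n)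
  linarith

theorem thv_eq {V : E →L[ℂ] E} {e1 e2 : E} (hs : QSys V e1 e2) (z : ℂ) (x : E) :
    Ring.inverse (1 - z • V) x = x + z • V (Ring.inverse (1 - z • V) x) := by
  have := Ring.mul_inverse_cancel _ (isUnit_of_qn _ (hs.qn z))
  have := congrArg (fun W : E →L[ℂ] E => W x) this
  have h2 : Ring.inverse (1 - z • V) x - z • V (Ring.inverse (1 - z • V) x) = x := by simpa using this
  rw [← sub_eq_iff_eq_add]; exact h2

theorem thv_unique {V : E →L[ℂ] E} {e1 e2 : E} (hs : QSys V e1 e2) {z : ℂ} {x y : E} (h : y = x + z • V y) :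
    y = Ring.inverse (1 - z • V) x := by
  have := Ring.inverse_mul_cancel _ (isUnit_of_qn _ (hs.qn z))
  have := congrArg (fun W : E →L[ℂ] E => W y) this
  have h1 : (1 - z • V) y = x := by
    rw [ContinuousLinearMap.sub_apply]; simp only [one_apply_eq_self, smul_apply]
    rw [sub_eq_iff_eq_add]; exact h
  have h2 : Ring.inverse (1 - z • V) ((1 - z • V) y) = y := this
  rw [h1] at h2; exact h2.symm

theorem thv_cont {V : E →L[ℂ] E} {e1 e2 : E} (hs : QSys V e1 e2) (x : E) :
    Continuous fun z : ℂ => Ring.inverse (1 - z • V) x := by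
  rw [continuous_iff_continuousAt]
  intro z
  obtain ⟨u, hu⟩ := isUnit_of_qn _ (hs.qn z)
  have h1 : ContinuousAt (Ring.inverse : (E →L[ℂ] E) → _) (1 - z • V) := by
    rw [← hu]; exact NormedRing.inverse_continuousAt u
  have h2 : ContinuousAt (fun z : ℂ => (1 - z • V : E →L[ℂ] E)) z := by fun_prop
  have h3 : ContinuousAt (fun z : ℂ => Ring.inverse (1 - z • V : E →L[ℂ] E)) z :=
    ContinuousAt.comp (f := fun z : ℂ => (1 - z • V : E →L[ℂ] E)) (g := Ring.inverse) h1 h2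
  exact h3.clm_apply continuousAt_const

theorem moments_aux {V : E →L[ℂ] E} {V' : E' →L[ℂ] E'} {e1 e2 : E} {e1' e2' : E'} (hs : QSys V e1 e2) (hs' : QSys V' e1' e2')
    (f : E) (f' : E') (h : ∀ z : ℂ, z * inner ℂ f (Ring.inverse (1 - z • V) e1) = z * inner ℂ f' (Ring.inverse (1 - z • V') e1')) (n : ℕ) :
    inner ℂ f ((V ^ n) e1) = inner ℂ f' ((V' ^ n) e1') := by
  have ext0 : ∀ n : ℕ, (∀ z : ℂ, z ≠ 0 → inner ℂ f ((V ^ n) (Ring.inverse (1 - z • V) e1)) = inner ℂ f' ((V' ^ n) (Ring.inverse (1 - z • V') e1'))) →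
      inner ℂ f ((V ^ n) e1) = inner ℂ f' ((V' ^ n) e1') := by
    intro n hn
    have c1 : Continuous fun z : ℂ => inner ℂ f ((V ^ n) (Ring.inverse (1 - z • V) e1)) :=
      continuous_const.inner ((V ^ n).continuous.comp (thv_cont hs e1))
    have c2 : Continuous fun z : ℂ => inner ℂ f' ((V' ^ n) (Ring.inverse (1 - z • V') e1')) :=
      continuous_const.inner ((V' ^ n).continuous.comp (thv_cont hs' e1'))
    have heq := Continuous.ext_on (dense_compl_singleton (0:ℂ)) c1 c2 (fun z hz => hn z hz)
    have := congrFun heq 0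
    simpa using this
  have all : ∀ n : ℕ, ∀ z : ℂ, z ≠ 0 → inner ℂ f ((V ^ n) (Ring.inverse (1 - z • V) e1)) = inner ℂ f' ((V' ^ n) (Ring.inverse (1 - z • V') e1')) := by
    intro n
    induction n with
    | zero => intro z hz; simpa using mul_left_cancel₀ hz (h z)
    | succ n ih =>
      intro z hz
      have i0 := ext0 n ih
      have i1 := ih z hz
      rw [thv_eq hs, thv_eq hs', map_add, map_add, inner_add_right, inner_add_right, i0, map_smul, map_smul, inner_smul_right,
        inner_smul_right] at i1
      rw [pow_succ_apply_right, pow_succ_apply_right]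
      exact mul_left_cancel₀ hz (add_left_cancel i1)
  exact ext0 n (all n)

theorem gram_moments {V : E →L[ℂ] E} {V' : E' →L[ℂ] E'} {e1 e2 : E} {e1' e2' : E'} (hs : QSys V e1 e2) (hs' : QSys V' e1' e2')
    (h1 : ∀ n : ℕ, inner ℂ e1 ((V ^ n) e1) = inner ℂ e1' ((V' ^ n) e1')) (h2 : ∀ n : ℕ, inner ℂ e2 ((V ^ n) e1) = inner ℂ e2' ((V' ^ n) e1'))
    (m : ℕ) : ∀ n : ℕ, inner ℂ ((V ^ m) e1) ((V ^ n) e1) = inner ℂ ((V' ^ m) e1') ((V' ^ n) e1') := by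
  induction m with
  | zero => intro n; simpa using h1 n
  | succ m ih =>
    intro n
    have g1 : inner ℂ ((V ^ m) e1) e1 = inner ℂ ((V' ^ m) e1') e1' := by
      rw [← inner_conj_symm, h1, inner_conj_symm]
    have g2 : inner ℂ ((V ^ m) e1) e2 = inner ℂ ((V' ^ m) e1') e2' := by
      rw [← inner_conj_symm, h2, inner_conj_symm]
    rw [pow_succ_apply V m, pow_succ_apply V' m, ← adjoint_inner_right V, ← adjoint_inner_right V', hs.adj, hs'.adj, inner_add_right,
      inner_sub_right, inner_add_right, inner_sub_right, inner_smul_right, inner_smul_right, inner_smul_right, inner_smul_right,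
      ← pow_succ_apply, ← pow_succ_apply, ih, h1, h2, g1, g2]

end PE1
end CS

namespace CS
section PE2
open Set Filter Topology ContinuousLinearMap

theorem Coef.qsys (c : Coef) : QSys c.V (c.e 0) (c.e 1) := ⟨c.adj, c.qn⟩

variable {E : Type*} [NormedAddCommGroup E] [InnerProductSpace ℂ E] [CompleteSpace E]

/-- an isometric copy of the cyclic part of a system -/
structure Emb (c : Coef) (V : E →L[ℂ] E) (e : Fin 2 → E) (ι : E →ₗᵢ[ℂ] c.K) : Prop where
  range : ∀ w, (∃ x, ι x = w) ↔ ∀ b, adjoint c.V b = 0 → inner ℂ (c.e 0) b = 0 → inner ℂ b w = 0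
  int : ∀ x, ι (V x) = c.V (ι x)
  he : ∀ i, ι (e i) = c.e i

namespace Emb
variable {c : Coef} {V : E →L[ℂ] E} {e : Fin 2 → E} {ι : E →ₗᵢ[ℂ] c.K}

theorem adj' (h : Emb c V e ι) (x : E) : adjoint V x = V x - inner ℂ (e 1) x • e 0 + inner ℂ (e 0) x • e 1 := by
  apply ext_inner_right ℂ
  intro v
  rw [adjoint_inner_left, ← ι.inner_map_map, h.int, ← adjoint_inner_left, c.adj, ← ι.inner_map_map _ v, map_add, map_sub, map_smul,
    map_smul, h.int, h.he, h.he, ← h.he, ← h.he, ι.inner_map_map, ι.inner_map_map]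

theorem intT (h : Emb c V e ι) (x : E) : ι (adjoint V x) = adjoint c.V (ι x) := by
  rw [h.adj', c.adj, map_add, map_sub, map_smul, map_smul, h.int, ← h.he, ← h.he, ι.inner_map_map, ι.inner_map_map]

theorem int_pow (h : Emb c V e ι) (n : ℕ) (x : E) : ι ((V ^ n) x) = (c.V ^ n) (ι x) := by
  induction n with
  | zero => simp
  | succ n ih => rw [pow_succ_apply, pow_succ_apply, h.int, ih]

theorem zero_of (h : Emb c V e ι) {x : E} (h1 : adjoint V x = 0) (h2 : inner ℂ (e 0) x = 0) : x = 0 := by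
  have := (h.range (ι x)).1 ⟨x, rfl⟩ (ι x) (by rw [← h.intT, h1, map_zero]) (by rw [← h.he, ι.inner_map_map, h2])
  rw [inner_self_eq_zero] at this
  exact (map_eq_zero_iff ι ι.injective).1 this

theorem qn' (h : Emb c V e ι) (z : ℂ) : Tendsto (fun n : ℕ => ‖(z • V) ^ n‖) atTop (𝓝 0) := by
  refine squeeze_zero (fun n => norm_nonneg _) (fun n => ?_) (c.qn z)
  refine opNorm_le_bound _ (norm_nonneg _) fun x => ?_
  have e1 : ι (((z • V) ^ n) x) = ((z • c.V) ^ n) (ι x) := by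
    rw [smul_pow, smul_pow, smul_apply, smul_apply, map_smul, h.int_pow]
  rw [← ι.norm_map, e1, ← ι.norm_map x]
  exact le_opNorm _ _

theorem qsys (h : Emb c V e ι) : QSys V (e 0) (e 1) := ⟨h.adj', h.qn'⟩

theorem intR (h : Emb c V e ι) (z : ℂ) (x : E) : ι (Ring.inverse (1 - z • V) x) = Ring.inverse (1 - z • c.V) (ι x) := by
  apply thv_unique c.qsys
  conv_lhs => rw [thv_eq h.qsys]
  rw [map_add, map_smul, h.int]

theorem csys (h : Emb c V e ι) : CSys V (e 0) (e 1) where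
  adj := h.adj'
  qn := h.qn'
  cyc := fun w hw => h.zero_of (ker_of_orth h.qsys hw) (by simpa using hw 0)
  gro := by
    refine ⟨c.T c.L, fun g ε hε => ?_⟩
    obtain ⟨C, hC⟩ := c.upper (x := c.L) ⟨c.hL.le, le_rfl⟩ (ι g) hε
    refine ⟨C, fun z => ?_⟩
    have := hC z
    rwa [c.P_L, ← h.intR, ι.norm_map] at this

end Emb

/-- the subspaces coming from the truncations -/
def subA (c : Coef) (ι : E →ₗᵢ[ℂ] c.K) (x : ℝ) : Submodule ℂ E where
  carrier := {u | c.P x (ι u) = ι u}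
  add_mem' := by
    intro a b ha hb
    have ha' : c.P x (ι a) = ι a := ha
    have hb' : c.P x (ι b) = ι b := hb
    show c.P x (ι (a + b)) = ι (a + b)
    rw [map_add, map_add, ha', hb']
  zero_mem' := by
    show c.P x (ι 0) = ι 0
    rw [map_zero, map_zero]
  smul_mem' := by
    intro r a ha
    have ha' : c.P x (ι a) = ι a := ha
    show c.P x (ι (r • a)) = ι (r • a)
    rw [map_smul, map_smul, ha']

theorem mem_subA {c : Coef} {ι : E →ₗᵢ[ℂ] c.K} {x : ℝ} {u : E} : u ∈ subA c ι x ↔ c.P x (ι u) = ι u := Iff.rfl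

instance subA_complete (c : Coef) (ι : E →ₗᵢ[ℂ] c.K) (x : ℝ) : CompleteSpace (subA c ι x) := by
  have : IsClosed (subA c ι x : Set E) := isClosed_eq ((c.P x).continuous.comp ι.continuous) ι.continuous
  exact this.completeSpace_coe

theorem Coef.PM (c : Coef) {x : ℝ} (hx : x ∈ c.reg) (hc : c.cond) {b : c.K} (h1 : adjoint c.V b = 0) (h2 : inner ℂ (c.e 0) b = 0) :
    adjoint c.V (c.P x b) = 0 := by
  have h3 := c.ker_f hc h1 h2
  have hV : c.V b = 0 := by
    have := c.adj b
    rw [h1, h2, h3] at this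
    simpa using this.symm
  obtain ⟨h4, h5⟩ := hx.2 b h1 h2
  rw [← c.PT hx.1, c.adj, h4, h5]
  simp only [zero_smul, sub_zero, add_zero]
  rw [c.PV hx.1, hV, map_zero]

namespace Emb
variable {c : Coef} {V : E →L[ℂ] E} {e : Fin 2 → E} {ι : E →ₗᵢ[ℂ] c.K}

theorem proj (h : Emb c V e ι) (hc : c.cond) {x : ℝ} (hx : x ∈ c.reg) (u : E) :
    ι ((subA c ι x).starProjection u) = c.P x (ι u) := by
  obtain ⟨v, hv⟩ := (h.range (c.P x (ι u))).2 (fun b h1 h2 => by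
    rw [← c.P_sa]
    exact (h.range (ι u)).1 ⟨u, rfl⟩ _ (c.PM hx hc h1 h2) (hx.2 b h1 h2).1)
  rw [← hv]
  congr 1
  apply Submodule.eq_starProjection_of_mem_of_inner_eq_zero
  · rw [mem_subA, hv]; exact (c.P_mul le_rfl _).1
  · intro w hw
    rw [← ι.inner_map_map, ← mem_subA.1 hw, ← c.P_sa, map_sub, hv, map_sub, (c.P_mul le_rfl _).1, sub_self, inner_zero_left]

theorem csub (h : Emb c V e ι) (hc : c.cond) {x : ℝ} (hx : x ∈ c.reg) (h0 : 0 < x) : CSub V (e 0) (subA c ι x) where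
  inv := by
    intro u hu
    rw [mem_subA, h.intT, ← mem_subA.1 hu]
    exact c.PT hx.1 _
  ne := by
    intro h1
    have := h.proj hc hx (e 0)
    rw [h1, map_zero, h.he] at this
    exact c.Pe_ne hc ⟨h0, hx.1.2⟩ this.symm

theorem kf_eq (h : Emb c V e ι) (hc : c.cond) {x : ℝ} (hx : x ∈ c.reg) (z : ℂ) :
    kf V (e 0) (subA c ι x) z = ‖c.P x (Ring.inverse (1 - z • c.V) (c.e 0))‖ := by
  rw [kf, thv, ← ι.norm_map, h.proj hc hx, h.intR, h.he]

theorem axb (h : Emb c V e ι) (hc : c.cond) {x : ℝ} (hx : x ∈ c.reg) (h0 : 0 < x) : AxB V (e 0) (subA c ι x) (c.T x) := by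
  intro ε hε
  obtain ⟨C, hC⟩ := c.upper hx.1 (c.e 0) hε
  obtain ⟨k, hk, hk'⟩ := c.lower (fun x hx => c.Pe_ne hc hx) ⟨h0, hx.1.2⟩ hε
  refine ⟨C, k, hk, fun y => ?_⟩
  rw [h.kf_eq hc hx]
  refine ⟨(hC _).trans_eq ?_, hk' y⟩
  simp only [norm_mul, Complex.norm_real, Complex.norm_I, mul_one, Real.norm_eq_abs, Complex.mul_im, Complex.ofReal_re, Complex.I_im,
    Complex.ofReal_im, Complex.I_re, mul_zero, add_zero]
  ring_nf

end Emb

/-- the chain of invariant subspaces attached to a system -/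
structure Chain (V : E →L[ℂ] E) (e : Fin 2 → E) (L : ℝ) (reg : Set ℝ) (A : ℝ → Submodule ℂ E) [∀ x, (A x).HasOrthogonalProjection]
    (I : Fin 2 → Fin 2 → ℝ → ℝ) : Prop where
  sub : reg ⊆ Icc 0 L
  pos : 0 < L
  mem0 : 0 ∈ reg
  memL : L ∈ reg
  cs : ∀ x ∈ reg, 0 < x → CSub V (e 0) (A x)
  ax : ∀ x ∈ reg, 0 < x → ∃ τ, AxB V (e 0) (A x) τ
  gram : ∀ x ∈ reg, ∀ i j, inner ℂ (e i) ((A x).starProjection (e j)) = (I i j x : ℂ)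
  tr : ∀ x, I 0 0 x + I 1 1 x = x
  top : A L = ⊤
  bot : A 0 = ⊥
  gap : ∀ x ∈ Icc 0 L, x ∉ reg → ∃ a d, a < x ∧ x < d ∧ a ∈ reg ∧ d ∈ reg ∧ (∀ y ∈ Ioo a d, y ∉ reg) ∧
    (∃ q : E, ∀ w ∈ A d, (∀ v ∈ A a, inner ℂ v w = 0) → inner ℂ q w = 0 → w = 0) ∧
    ∃ k : Fin 2 → Fin 2 → ℝ, ∀ i j, ∀ y ∈ Icc a d, I i j y = I i j a + (y - a) * k i j

theorem Emb.chain {c : Coef} {V : E →L[ℂ] E} {e : Fin 2 → E} {ι : E →ₗᵢ[ℂ] c.K} (h : Emb c V e ι) (hc : c.cond) :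
    Chain V e c.L c.reg (subA c ι) c.I where
  sub := fun x hx => hx.1
  pos := c.hL
  mem0 := c.reg_zero
  memL := c.reg_L hc
  cs := fun x hx h0 => h.csub hc hx h0
  ax := fun x hx h0 => ⟨_, h.axb hc hx h0⟩
  gram := by
    intro x hx i j
    rw [← ι.inner_map_map, h.proj hc hx, h.he, h.he, c.gramP i j hx.1]
  tr := c.I_tr
  top := by
    rw [eq_top_iff]
    intro u _
    rw [mem_subA, c.P_L]
  bot := by
    rw [eq_bot_iff]
    intro u hu
    rw [mem_subA, c.P_zero] at hu
    exact (map_eq_zero_iff ι ι.injective).1 hu.symm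
  gap := by
    intro x hx hr
    obtain ⟨a, d, hax, hxd, ha, hd, hn⟩ := c.irreg hc hx hr
    refine ⟨a, d, hax, hxd, ha, hd, hn, ?_, ?_⟩
    · obtain ⟨u1, u2, hu, hw⟩ := c.comp_w hc (hax.trans hxd) ha.1.1 hd.1.2 hn
      have key : ∀ w ∈ subA c ι d, (∀ v ∈ subA c ι a, inner ℂ v w = 0) →
          u1 * inner ℂ (e 0) w + u2 * inner ℂ (e 1) w = 0 ∧ (inner ℂ (e 0) w = 0 → inner ℂ (e 1) w = 0 → w = 0) := by
        intro w hw1 hw2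
        have hP : c.P a (ι w) = 0 := by
          rw [← h.proj hc ha, (Submodule.starProjection_apply_eq_zero_iff _).2, map_zero]
          exact (Submodule.mem_orthogonal _ _).2 hw2
        obtain ⟨k1, k2⟩ := hw (ι w) hP hw1
        rw [← h.he, ← h.he, ι.inner_map_map, ι.inner_map_map] at k1 k2
        refine ⟨k1, fun h0 h1 => h.zero_of ?_ h0⟩
        have := k2 h0 h1
        rw [← h.intT] at this
        exact (map_eq_zero_iff ι ι.injective).1 this
      rcases hu with hu | hu
      · refine ⟨e 1, fun w h1 h2 h3 => ?_⟩
        obtain ⟨k1, k2⟩ := key w h1 h2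
        rw [h3, mul_zero, add_zero] at k1
        exact k2 ((mul_eq_zero.1 k1).resolve_left hu) h3
      · refine ⟨e 0, fun w h1 h2 h3 => ?_⟩
        obtain ⟨k1, k2⟩ := key w h1 h2
        rw [h3, mul_zero, zero_add] at k1
        exact k2 h3 ((mul_eq_zero.1 k1).resolve_left hu)
    · obtain ⟨k, _, hk⟩ := c.comp_const hc (hax.trans hxd) ha.1.1 hd.1.2 hn
      refine ⟨k, fun i j y hy => c.I_affine (hax.trans hxd).le ?_ hy⟩
      filter_upwards [hk] with t ht hm
      exact ht hm i j

end PE2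
end CS

namespace CS
section PE4
open Set Filter Topology ContinuousLinearMap

variable {E : Type*} [NormedAddCommGroup E] [InnerProductSpace ℂ E] [CompleteSpace E]

theorem inner_proj (A : Submodule ℂ E) [A.HasOrthogonalProjection] (u : E) : inner ℂ u (A.starProjection u) = ((‖A.starProjection u‖ ^ 2 : ℝ) : ℂ) := by
  have h : A.starProjection (A.starProjection u) = A.starProjection u :=
    Submodule.starProjection_eq_self_iff.2 (A.starProjection_apply_mem u)
  have h1 : inner ℂ u (A.starProjection u) = inner ℂ (A.starProjection u) (A.starProjection u) := by
    conv_lhs => rw [← h]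
    rw [Submodule.inner_starProjection_left_eq_right]
  rw [h1]
  exact_mod_cast inner_self_eq_norm_sq_to_K (𝕜 := ℂ) (A.starProjection u)

theorem proj_comp {A B : Submodule ℂ E} [A.HasOrthogonalProjection] [B.HasOrthogonalProjection] (h : A ≤ B) (u : E) :
    A.starProjection (B.starProjection u) = A.starProjection u := by
  rw [← sub_eq_zero, ← map_sub, Submodule.starProjection_apply_eq_zero_iff]
  have h1 : u - B.starProjection u ∈ Bᗮ := Submodule.sub_starProjection_mem_orthogonal u
  have := Submodule.orthogonal_le h h1
  rw [← neg_sub]; exact Submodule.neg_mem _ this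

theorem proj_le {A B : Submodule ℂ E} [A.HasOrthogonalProjection] [B.HasOrthogonalProjection] (h : A ≤ B) (u : E) :
    ‖B.starProjection u‖ ^ 2 = ‖A.starProjection u‖ ^ 2 + ‖B.starProjection u - A.starProjection u‖ ^ 2 := by
  have h1 : inner ℂ (A.starProjection u) (B.starProjection u - A.starProjection u) = 0 := by
    rw [← proj_comp h u]
    exact (Submodule.mem_orthogonal _ _).1 (Submodule.sub_starProjection_mem_orthogonal (K := A) (B.starProjection u)) _ (A.starProjection_apply_mem _)
  have := norm_add_sq_eq_norm_sq_add_norm_sq_of_inner_eq_zero _ _ h1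
  rw [add_sub_cancel] at this
  rw [sq, sq, sq]; exact this

theorem one_gap {A B C : Submodule ℂ E} [A.HasOrthogonalProjection] [B.HasOrthogonalProjection]
    (hab : A ≤ B) (hbc : B ≤ C) {q : E} (hq : ∀ w ∈ C, (∀ v ∈ A, inner ℂ v w = 0) → inner ℂ q w = 0 → w = 0) : B ≤ A ∨ C ≤ B := by
  by_contra hcon
  rw [not_or, SetLike.not_le_iff_exists, SetLike.not_le_iff_exists] at hcon
  obtain ⟨⟨u, hu, hu'⟩, v, hv, hv'⟩ := hcon
  set w0 := u - A.starProjection u with hw0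
  set w1 := v - B.starProjection v with hw1
  have m0 : w0 ∈ B := B.sub_mem hu (hab (A.starProjection_apply_mem u))
  have m1 : w1 ∈ C := C.sub_mem hv (hbc (B.starProjection_apply_mem v))
  have n0 : w0 ≠ 0 := fun h => hu' (Submodule.starProjection_eq_self_iff.1 (sub_eq_zero.1 h).symm)
  have n1 : w1 ≠ 0 := fun h => hv' (Submodule.starProjection_eq_self_iff.1 (sub_eq_zero.1 h).symm)
  have o0 : ∀ a ∈ A, inner ℂ a w0 = 0 := (Submodule.mem_orthogonal _ _).1 (Submodule.sub_starProjection_mem_orthogonal u)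
  have o1 : ∀ a ∈ B, inner ℂ a w1 = 0 := (Submodule.mem_orthogonal _ _).1 (Submodule.sub_starProjection_mem_orthogonal v)
  have q1 : inner ℂ q w1 ≠ 0 := fun h => n1 (hq w1 m1 (fun a ha => o1 a (hab ha)) h)
  have := hq (inner ℂ q w1 • w0 - inner ℂ q w0 • w1) (C.sub_mem (C.smul_mem _ (hbc m0)) (C.smul_mem _ m1)) (fun a ha => by
    rw [inner_sub_right, inner_smul_right, inner_smul_right, o0 a ha, o1 a (hab ha)]; simp) (by
    rw [inner_sub_right, inner_smul_right, inner_smul_right]; ring)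
  have h2 := congrArg (inner ℂ w0) this
  rw [inner_sub_right, inner_smul_right, inner_smul_right, o1 w0 m0, mul_zero, sub_zero, inner_zero_right] at h2
  exact (mul_ne_zero q1 (inner_self_ne_zero.2 n0)) h2

namespace Chain
variable {V : E →L[ℂ] E} {e : Fin 2 → E} {L L₁ : ℝ} {reg reg₁ : Set ℝ} {A B : ℝ → Submodule ℂ E}
  [∀ x, (A x).HasOrthogonalProjection] [∀ x, (B x).HasOrthogonalProjection] {I I₁ : Fin 2 → Fin 2 → ℝ → ℝ}

theorem diag (C : Chain V e L reg A I) {x : ℝ} (hx : x ∈ reg) (i : Fin 2) : I i i x = ‖(A x).starProjection (e i)‖ ^ 2 := by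
  have := C.gram x hx i i
  rw [inner_proj] at this
  exact (Complex.ofReal_injective this).symm

theorem comp (C : Chain V e L reg A I) (C₁ : Chain V e L₁ reg₁ B I₁) {x t : ℝ} (hx : x ∈ reg) (ht : t ∈ reg₁) (h : A x ≤ B t) :
    x ≤ t ∧ (x = t → ∀ i j, I i j x = I₁ i j x) := by
  have h0 := proj_le h (e 0)
  have h1 := proj_le h (e 1)
  rw [← C.diag hx, ← C₁.diag ht] at h0 h1
  have t1 := C.tr x
  have t2 := C₁.tr t
  have p0 := sq_nonneg ‖(B t).starProjection (e 0) - (A x).starProjection (e 0)‖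
  have p1 := sq_nonneg ‖(B t).starProjection (e 1) - (A x).starProjection (e 1)‖
  refine ⟨by linarith, ?_⟩
  rintro rfl
  have z : ∀ j, (B x).starProjection (e j) = (A x).starProjection (e j) := by
    intro j
    rw [← sub_eq_zero, ← norm_eq_zero, ← sq_eq_zero_iff]
    fin_cases j
    · simp only [Fin.zero_eta]; linarith
    · simp only [Fin.mk_one]; linarith
  intro i j
  apply Complex.ofReal_injective
  rw [← C.gram x hx, ← C₁.gram x ht, z]

theorem ord (hs : CSys V (e 0) (e 1)) (C : Chain V e L reg A I) (C₁ : Chain V e L₁ reg₁ B I₁) {x t : ℝ} (hx : x ∈ reg) (ht : t ∈ reg₁) :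
    A x ≤ B t ∨ B t ≤ A x := by
  rcases (C.sub hx).1.eq_or_lt with h | h
  · left; rw [← h, C.bot]; exact bot_le
  rcases (C₁.sub ht).1.eq_or_lt with h' | h'
  · right; rw [← h', C₁.bot]; exact bot_le
  obtain ⟨τ, hτ⟩ := C.ax x hx h
  obtain ⟨τ', hτ'⟩ := C₁.ax t ht h'
  exact ordering hs _ _ (C.cs x hx h) (C₁.cs t ht h') _ _ hτ hτ'

theorem len (C : Chain V e L reg A I) (C₁ : Chain V e L₁ reg₁ B I₁) : L = L₁ := by
  apply le_antisymm
  · exact (C.comp C₁ C.memL C₁.memL (by rw [C₁.top]; exact le_top)).1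
  · exact (C₁.comp C C₁.memL C.memL (by rw [C.top]; exact le_top)).1

theorem lt_le (hs : CSys V (e 0) (e 1)) (C : Chain V e L reg A I) (C₁ : Chain V e L₁ reg₁ B I₁) {x t : ℝ} (hx : x ∈ reg) (ht : t ∈ reg₁)
    (h : x < t) : A x ≤ B t := by
  rcases ord hs C C₁ hx ht with h' | h'
  · exact h'
  · exact absurd (C₁.comp C ht hx h').1 (not_le.2 h)

theorem eq_reg (hs : CSys V (e 0) (e 1)) (C : Chain V e L reg A I) (C₁ : Chain V e L₁ reg₁ B I₁) {x : ℝ} (hx : x ∈ reg) (ht : x ∈ reg₁)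
    (i j : Fin 2) : I i j x = I₁ i j x := by
  rcases ord hs C C₁ hx ht with h' | h'
  · exact (C.comp C₁ hx ht h').2 rfl i j
  · exact ((C₁.comp C ht hx h').2 rfl i j).symm

theorem reg_sub (hs : CSys V (e 0) (e 1)) (C : Chain V e L reg A I) (C₁ : Chain V e L₁ reg₁ B I₁) : reg ⊆ reg₁ := by
  intro x hx
  by_contra hn
  have hx' := C.sub hx
  rw [C.len C₁] at hx'
  obtain ⟨a, d, hax, hxd, ha, hd, -, ⟨q, hq⟩, -⟩ := C₁.gap x hx' hn
  rcases one_gap (lt_le hs C₁ C ha hx hax) (lt_le hs C C₁ hx hd hxd) hq with h | h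
  · exact absurd (C.comp C₁ hx ha h).1 (not_le.2 hax)
  · exact absurd (C₁.comp C hd hx h).1 (not_le.2 hxd)

theorem unique (hs : CSys V (e 0) (e 1)) (C : Chain V e L reg A I) (C₁ : Chain V e L₁ reg₁ B I₁) :
    L = L₁ ∧ ∀ x ∈ Icc 0 L, ∀ i j, I i j x = I₁ i j x := by
  have hr : reg = reg₁ := (reg_sub hs C C₁).antisymm (reg_sub hs C₁ C)
  have hL := C.len C₁
  refine ⟨hL, fun x hx i j => ?_⟩
  by_cases hm : x ∈ reg
  · exact eq_reg hs C C₁ hm (hr ▸ hm) i j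
  obtain ⟨a, d, hax, hxd, ha, hd, hn, -, k, hk⟩ := C.gap x hx hm
  obtain ⟨a', d', hax', hxd', ha', hd', hn', -, k', hk'⟩ := C₁.gap x (hL ▸ hx) (hr ▸ hm)
  have haa : a = a' := by
    apply le_antisymm
    · by_contra hh; exact hn' a ⟨not_le.1 hh, hax.trans hxd'⟩ (hr ▸ ha)
    · by_contra hh; exact hn a' ⟨not_le.1 hh, hax'.trans hxd⟩ (hr ▸ ha')
  have hdd : d = d' := by
    apply le_antisymm
    · by_contra hh; exact hn d' ⟨hax.trans hxd', not_le.1 hh⟩ (hr ▸ hd')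
    · by_contra hh; exact hn' d ⟨hax'.trans hxd, not_le.1 hh⟩ (hr ▸ hd)
  subst haa hdd
  have had := hax.trans hxd
  have ea := eq_reg hs C C₁ ha ha' i j
  have ed := eq_reg hs C C₁ hd hd' i j
  rw [hk i j d ⟨had.le, le_rfl⟩, hk' i j d ⟨had.le, le_rfl⟩, ea] at ed
  have : k i j = k' i j := mul_left_cancel₀ (sub_ne_zero.2 had.ne') (add_left_cancel ed)
  rw [hk i j x ⟨hax.le, hxd.le⟩, hk' i j x ⟨hax.le, hxd.le⟩, ea, this]

end Chain
end PE4
end CS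

namespace CS
section PE3
open Set Filter Topology ContinuousLinearMap

namespace Coef
variable (c : Coef)

/-- span of the cyclic vectors -/
def S : Submodule ℂ c.K := Submodule.span ℂ (range fun n : ℕ => (c.V ^ n) (c.e 0))
def Ec : Submodule ℂ c.K := c.S.topologicalClosure

instance : CompleteSpace c.Ec := by
  have : IsClosed (c.Ec : Set c.K) := Submodule.isClosed_topologicalClosure _
  exact this.completeSpace_coe

theorem mem_Sperp (b : c.K) : b ∈ c.Sᗮ ↔ adjoint c.V b = 0 ∧ inner ℂ (c.e 0) b = 0 := by
  constructor
  · intro h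
    have h1 : ∀ n : ℕ, inner ℂ ((c.V ^ n) (c.e 0)) b = 0 := fun n =>
      (Submodule.mem_orthogonal _ _).1 h _ (Submodule.subset_span ⟨n, rfl⟩)
    exact ⟨ker_of_orth c.qsys h1, by simpa using h1 0⟩
  · rintro ⟨h1, h2⟩
    rw [S, Submodule.mem_orthogonal]
    intro u hu
    induction hu using Submodule.span_induction with
    | mem x hx => obtain ⟨n, rfl⟩ := hx; exact orth_of_ker h1 h2 n
    | zero => simp
    | add x y _ _ hx hy => rw [inner_add_left, hx, hy, add_zero]
    | smul r x _ hx => rw [inner_smul_left, hx, mul_zero]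

theorem mem_Ec (w : c.K) : w ∈ c.Ec ↔ ∀ b, adjoint c.V b = 0 → inner ℂ (c.e 0) b = 0 → inner ℂ b w = 0 := by
  rw [Ec, ← Submodule.orthogonal_orthogonal_eq_closure, Submodule.mem_orthogonal]
  simp only [mem_Sperp, and_imp]

theorem V_mem {w : c.K} (hw : w ∈ c.Ec) : c.V w ∈ c.Ec := by
  rw [mem_Ec] at hw ⊢
  intro b h1 h2
  rw [← adjoint_inner_left, h1, inner_zero_left]

theorem e0_mem : c.e 0 ∈ c.Ec := by
  rw [mem_Ec]
  intro b h1 h2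
  rw [← inner_conj_symm, h2, map_zero]

theorem e_mem (hc : c.cond) (i : Fin 2) : c.e i ∈ c.Ec := by
  fin_cases i
  · exact c.e0_mem
  · rw [mem_Ec]
    intro b h1 h2
    have := c.ker_f hc h1 h2
    simp only [Fin.mk_one]
    rw [← inner_conj_symm, this, map_zero]

def VE : c.Ec →L[ℂ] c.Ec := (c.V.comp c.Ec.subtypeL).codRestrict c.Ec (fun w => c.V_mem w.2)

theorem VE_apply (x : c.Ec) : ((c.VE x : c.Ec) : c.K) = c.V x := rfl

def eE (hc : c.cond) (i : Fin 2) : c.Ec := ⟨c.e i, c.e_mem hc i⟩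

theorem emb (hc : c.cond) : Emb c c.VE (c.eE hc) c.Ec.subtypeₗᵢ where
  range := by
    intro w
    rw [← mem_Ec]
    exact ⟨fun ⟨x, hx⟩ => hx ▸ x.2, fun h => ⟨⟨w, h⟩, rfl⟩⟩
  int := fun x => rfl
  he := fun i => rfl

def fE (hc : c.cond) : (ℕ →₀ ℂ) →ₗ[ℂ] c.Ec := Finsupp.linearCombination ℂ fun n : ℕ => (c.VE ^ n) (c.eE hc 0)

theorem fE_single (hc : c.cond) (n : ℕ) : c.fE hc (Finsupp.single n 1) = (c.VE ^ n) (c.eE hc 0) := by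
  rw [fE, Finsupp.linearCombination_single, one_smul]

theorem fE_dense (hc : c.cond) : DenseRange (c.fE hc) := by
  have h1 : (LinearMap.range (c.fE hc)).topologicalClosure = ⊤ := by
    rw [Submodule.topologicalClosure_eq_top_iff, eq_bot_iff]
    intro b hb
    rw [Submodule.mem_orthogonal] at hb
    exact (c.emb hc).csys.cyc b (fun n => hb _ ⟨_, c.fE_single hc n⟩)
  have h2 := (Submodule.dense_iff_topologicalClosure_eq_top (s := LinearMap.range (c.fE hc))).2 h1
  exact h2

end Coef

section
theorem fE_inner (c c₁ : Coef) (hc : c.cond) (hc₁ : c₁.cond) (p q : ℕ →₀ ℂ)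
  (hm : ∀ (i : Fin 2) (n : ℕ), inner ℂ (c.e i) ((c.V ^ n) (c.e 0)) = inner ℂ (c₁.e i) ((c₁.V ^ n) (c₁.e 0))) :
    inner ℂ (c.fE hc p) (c.fE hc q) = inner ℂ (c₁.fE hc₁ p) (c₁.fE hc₁ q) := by
  have hg : ∀ m n : ℕ, inner ℂ ((c.VE ^ m) (c.eE hc 0)) ((c.VE ^ n) (c.eE hc 0)) =
      inner ℂ ((c₁.VE ^ m) (c₁.eE hc₁ 0)) ((c₁.VE ^ n) (c₁.eE hc₁ 0)) := by
    intro m n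
    rw [← LinearIsometry.inner_map_map c.Ec.subtypeₗᵢ, ← LinearIsometry.inner_map_map c₁.Ec.subtypeₗᵢ, (c.emb hc).int_pow,
      (c.emb hc).int_pow, (c₁.emb hc₁).int_pow, (c₁.emb hc₁).int_pow, (c.emb hc).he, (c₁.emb hc₁).he]
    exact gram_moments c.qsys c₁.qsys (hm 0) (hm 1) m n
  unfold Coef.fE
  rw [Finsupp.linearCombination_apply, Finsupp.linearCombination_apply, Finsupp.linearCombination_apply, Finsupp.linearCombination_apply,
    Finsupp.sum_inner, Finsupp.sum_inner]
  unfold Finsupp.sum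
  refine Finset.sum_congr rfl fun m _ => ?_
  dsimp only
  rw [inner_sum, inner_sum]
  refine Finset.sum_congr rfl fun n _ => ?_
  rw [inner_smul_right, inner_smul_right, inner_smul_left, inner_smul_left, hg]

theorem transfer (c c₁ : Coef) (hc : c.cond) (hc₁ : c₁.cond) 
    (hm : ∀ (i : Fin 2) (n : ℕ), inner ℂ (c.e i) ((c.V ^ n) (c.e 0)) = inner ℂ (c₁.e i) ((c₁.V ^ n) (c₁.e 0))) :
    ∃ ι : c.Ec →ₗᵢ[ℂ] c₁.K, Emb c₁ c.VE (c.eE hc) ι := by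
  have hn : ∀ p, ‖c₁.fE hc₁ (LinearEquiv.refl ℂ (ℕ →₀ ℂ) p)‖ = ‖c.fE hc p‖ := by
    intro p
    have := fE_inner c c₁ hc hc₁ p p hm
    have h2 : ‖c.fE hc p‖ ^ 2 = ‖c₁.fE hc₁ p‖ ^ 2 := by
      have a1 := inner_self_eq_norm_sq (𝕜 := ℂ) (c.fE hc p)
      have a2 := inner_self_eq_norm_sq (𝕜 := ℂ) (c₁.fE hc₁ p)
      rw [this] at a1
      exact a1.symm.trans a2
    exact ((pow_left_inj₀ (norm_nonneg _) (norm_nonneg _) two_ne_zero).1 h2).symm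
  set U := (LinearEquiv.refl ℂ (ℕ →₀ ℂ)).extendOfIsometry (c.fE hc) (c₁.fE hc₁) (c.fE_dense hc) (c₁.fE_dense hc₁) hn with hU
  have hUf : ∀ p, U (c.fE hc p) = c₁.fE hc₁ p := fun p => LinearEquiv.extendOfIsometry_eq _ _ _ (c.fE_dense hc) (c₁.fE_dense hc₁) hn p
  have hUp : ∀ n : ℕ, U ((c.VE ^ n) (c.eE hc 0)) = (c₁.VE ^ n) (c₁.eE hc₁ 0) := by
    intro n; rw [← c.fE_single, hUf, c₁.fE_single]
  have hintg : ∀ x, U (c.VE x) = c₁.VE (U x) := by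
    have : (U.toContinuousLinearEquiv.toContinuousLinearMap.comp c.VE) = c₁.VE.comp U.toContinuousLinearEquiv.toContinuousLinearMap := by
      apply ContinuousLinearMap.coeFn_injective
      apply (c.fE_dense hc).equalizer (ContinuousLinearMap.continuous _) (ContinuousLinearMap.continuous _)
      have : ((U.toContinuousLinearEquiv.toContinuousLinearMap.comp c.VE).toLinearMap.comp (c.fE hc)) =
          (c₁.VE.comp U.toContinuousLinearEquiv.toContinuousLinearMap).toLinearMap.comp (c.fE hc) := by
        apply Finsupp.lhom_ext'
        intro n
        apply LinearMap.ext_ring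
        show U (c.VE (c.fE hc (Finsupp.single n 1))) = c₁.VE (U (c.fE hc (Finsupp.single n 1)))
        rw [c.fE_single, hUp, ← pow_succ_apply, ← pow_succ_apply, hUp]
      funext p
      exact LinearMap.congr_fun this p
    intro x
    exact DFunLike.congr_fun this x
  have hUe : ∀ i, U (c.eE hc i) = c₁.eE hc₁ i := by
    intro i
    rw [← sub_eq_zero]
    apply (c₁.emb hc₁).csys.cyc
    intro n
    rw [← hUp, inner_sub_right, U.inner_map_map, hUp, sub_eq_zero, ← inner_conj_symm, ← inner_conj_symm _ (c₁.eE hc₁ i)]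
    congr 1
    rw [← LinearIsometry.inner_map_map c.Ec.subtypeₗᵢ, ← LinearIsometry.inner_map_map c₁.Ec.subtypeₗᵢ, (c.emb hc).int_pow,
      (c₁.emb hc₁).int_pow, (c.emb hc).he, (c₁.emb hc₁).he, (c.emb hc).he, (c₁.emb hc₁).he]
    exact hm i n
  refine ⟨c₁.Ec.subtypeₗᵢ.comp U.toLinearIsometry, ⟨fun w => ?_, fun x => ?_, fun i => ?_⟩⟩
  · rw [← (c₁.emb hc₁).range w]
    constructor
    · rintro ⟨x, hx⟩; exact ⟨U x, hx⟩
    · rintro ⟨y, hy⟩; exact ⟨U.symm y, by rw [← hy]; simp⟩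
  · show ((U (c.VE x) : c₁.Ec) : c₁.K) = c₁.V (U x : c₁.Ec)
    rw [hintg]; rfl
  · show ((U (c.eE hc i) : c₁.Ec) : c₁.K) = _
    rw [hUe]; rfl

theorem coef_unique (c c₁ : Coef) (hc : c.cond) (hc₁ : c₁.cond) 
    (hm : ∀ (i : Fin 2) (n : ℕ), inner ℂ (c.e i) ((c.V ^ n) (c.e 0)) = inner ℂ (c₁.e i) ((c₁.V ^ n) (c₁.e 0))) :
    c.L = c₁.L ∧ ∀ x ∈ Icc 0 c.L, ∀ i j, c.I i j x = c₁.I i j x := by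
  obtain ⟨ι, hι⟩ := transfer c c₁ hc hc₁ hm
  exact Chain.unique (c.emb hc).csys ((c.emb hc).chain hc) (hι.chain hc₁)

end
end PE3
end CS

namespace CS
section PE5
open Set Filter Topology ContinuousLinearMap

theorem exists_coef_aux {L : ℝ} (hL : 0 < L) {a b d : ℝ → ℝ} (ma : Measurable a) (mb : Measurable b) (md : Measurable d)
    (h0 : ∀ t, 0 ≤ a t) (hdet : ∀ t, b t ^ 2 ≤ a t * d t) (htr : ∀ t, a t + d t = 1) :
    ∃ c : Coef, c.L = L ∧ c.h 0 0 = a ∧ c.h 0 1 = b ∧ c.h 1 0 = b ∧ c.h 1 1 = d := by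
  have hb : ∀ t, a t = 0 → b t = 0 := by
    intro t ht
    have := hdet t
    rw [ht, zero_mul] at this
    exact pow_eq_zero_iff two_ne_zero |>.1 (le_antisymm this (sq_nonneg _))
  have hq : ∀ t, 0 ≤ d t - b t ^ 2 / a t := by
    intro t
    rcases (h0 t).eq_or_lt with h | h
    · rw [← h, div_zero, sub_zero]; have := htr t; rw [← h] at this; linarith
    · rw [sub_nonneg, div_le_iff₀ h, mul_comm]; exact hdet t
  let w0 : ℝ → W := fun t => !₂[((Real.sqrt (a t) : ℝ) : ℂ), 0]
  let w1 : ℝ → W := fun t => !₂[((b t / Real.sqrt (a t) : ℝ) : ℂ), ((Real.sqrt (d t - b t ^ 2 / a t) : ℝ) : ℂ)]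
  have meas2 : ∀ p q : ℝ → ℂ, Measurable p → Measurable q → Measurable fun t => (!₂[p t, q t] : W) := by
    intro p q hp hq
    refine (WithLp.measurable_toLp 2 (Fin 2 → ℂ)).comp ?_
    rw [measurable_pi_iff]
    intro i
    fin_cases i
    · exact hp
    · exact hq
  have m0 : Measurable w0 := meas2 _ _ (by fun_prop) (by fun_prop)
  have m1 : Measurable w1 := meas2 _ _ (by fun_prop) (by fun_prop)
  have g00 : ∀ t, inner ℂ (w0 t) (w0 t) = (a t : ℂ) := by
    intro t
    simp only [w0, PiLp.inner_apply, Fin.sum_univ_two]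
    simp
    rw [← Complex.ofReal_pow, sq_abs, Real.sq_sqrt (h0 t)]
  have r01 : ∀ t, Real.sqrt (a t) * (b t / Real.sqrt (a t)) = b t := by
    intro t
    rcases (h0 t).eq_or_lt with h | h
    · rw [hb t h.symm, zero_div, mul_zero]
    · have := (Real.sqrt_pos.2 h).ne'
      field_simp
  have g01 : ∀ t, inner ℂ (w0 t) (w1 t) = (b t : ℂ) := by
    intro t
    simp only [w0, w1, PiLp.inner_apply, Fin.sum_univ_two]
    have := congrArg (fun r : ℝ => (r : ℂ)) (r01 t)
    simp at this ⊢
    rw [mul_comm]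
    exact this
  have g10 : ∀ t, inner ℂ (w1 t) (w0 t) = (b t : ℂ) := by
    intro t
    rw [← inner_conj_symm, g01, Complex.conj_ofReal]
  have r11 : ∀ t, (b t / Real.sqrt (a t)) * (b t / Real.sqrt (a t)) + Real.sqrt (d t - b t ^ 2 / a t) * Real.sqrt (d t - b t ^ 2 / a t) = d t := by
    intro t
    rw [Real.mul_self_sqrt (hq t), div_mul_div_comm, Real.mul_self_sqrt (h0 t)]; ring
  have g11 : ∀ t, inner ℂ (w1 t) (w1 t) = (d t : ℂ) := by
    intro t
    have := congrArg (fun r : ℝ => (r : ℂ)) (r11 t)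
    simp only [w1, PiLp.inner_apply, Fin.sum_univ_two]
    simp only [Complex.ofReal_add, Complex.ofReal_mul] at this
    simp only [Matrix.cons_val_zero, Matrix.cons_val_one, RCLike.inner_apply, Complex.conj_ofReal]
    exact this
  refine ⟨⟨L, hL, ![w0, w1], ?_, ![![a, b], ![b, d]], ?_, ?_, ?_⟩, rfl, rfl, rfl, rfl, rfl⟩
  · intro i; fin_cases i
    · exact m0
    · exact m1
  · intro i j; fin_cases i <;> fin_cases j
    · exact ma
    · exact mb
    · exact mb
    · exact md
  · intro i j t; fin_cases i <;> fin_cases j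
    · exact g00 t
    · exact g01 t
    · exact g10 t
    · exact g11 t
  · exact htr

theorem exists_coef {L : ℝ} (hL : 0 < L) {H : ℝ → Matrix (Fin 2) (Fin 2) ℝ} (hH : IsHamiltonian H L) :
    ∃ c : Coef, c.L = L ∧ ∀ᵐ t, t ∈ Icc 0 L → ∀ i j, H t i j = c.h i j t := by
  obtain ⟨hm, hae, -⟩ := hH
  set G : Set ℝ := {t | 0 ≤ H t 0 0} ∩ {t | H t 0 1 ^ 2 ≤ H t 0 0 * H t 1 1} ∩ {t | H t 0 0 + H t 1 1 = 1} with hG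
  have mG : MeasurableSet G := by
    refine MeasurableSet.inter (MeasurableSet.inter ?_ ?_) ?_
    · exact measurableSet_le measurable_const (hm 0 0)
    · exact measurableSet_le ((hm 0 1).pow_const 2) ((hm 0 0).mul (hm 1 1))
    · exact measurableSet_eq_fun ((hm 0 0).add (hm 1 1)) measurable_const
  classical
  obtain ⟨c, h1, h00, h01, h10, h11⟩ := exists_coef_aux hL (a := G.piecewise (fun t => H t 0 0) (fun _ => 1))
    (b := G.piecewise (fun t => H t 0 1) (fun _ => 0)) (d := G.piecewise (fun t => H t 1 1) (fun _ => 0))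
    ((hm 0 0).piecewise mG measurable_const) ((hm 0 1).piecewise mG measurable_const) ((hm 1 1).piecewise mG measurable_const)
    (fun t => by
      by_cases ht : t ∈ G
      · rw [piecewise_eq_of_mem _ _ _ ht]; exact ht.1.1
      · rw [piecewise_eq_of_notMem _ _ _ ht]; exact zero_le_one)
    (fun t => by
      by_cases ht : t ∈ G
      · simp only [piecewise_eq_of_mem _ _ _ ht]; exact ht.1.2
      · simp only [piecewise_eq_of_notMem _ _ _ ht]; norm_num)
    (fun t => by
      by_cases ht : t ∈ G
      · simp only [piecewise_eq_of_mem _ _ _ ht]; exact ht.2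
      · simp only [piecewise_eq_of_notMem _ _ _ ht]; norm_num)
  refine ⟨c, h1, ?_⟩
  rw [ae_restrict_iff' measurableSet_Icc] at hae
  filter_upwards [hae] with t ht hI
  obtain ⟨hp, htr⟩ := ht hI
  have sym : H t 1 0 = H t 0 1 := by
    have := hp.1.apply 0 1
    simpa using this
  have hd : H t 0 1 ^ 2 ≤ H t 0 0 * H t 1 1 := by
    have := hp.det_nonneg
    rw [Matrix.det_fin_two, sym] at this
    nlinarith
  have hg : t ∈ G := ⟨⟨hp.diag_nonneg, hd⟩, by rw [Matrix.trace_fin_two] at htr; exact htr⟩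
  intro i j
  fin_cases i <;> fin_cases j
  · show _ = c.h 0 0 t
    rw [h00, piecewise_eq_of_mem _ _ _ hg]; rfl
  · show _ = c.h 0 1 t
    rw [h01, piecewise_eq_of_mem _ _ _ hg]; rfl
  · show _ = c.h 1 0 t
    rw [h10, piecewise_eq_of_mem _ _ _ hg]; exact sym
  · show _ = c.h 1 1 t
    rw [h11, piecewise_eq_of_mem _ _ _ hg]; rfl

theorem cond_of {L : ℝ} {H : ℝ → Matrix (Fin 2) (Fin 2) ℝ} {c : Coef} (hcL : c.L = L)
    (hc : ∀ᵐ t, t ∈ Icc 0 L → ∀ i j, H t i j = c.h i j t)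
    (hcond : ¬ ∃ ε > 0, ∀ᵐ x ∂(volume.restrict (Set.Ioo 0 ε)), H x = !![0, 0; 0, 1]) : c.cond := by
  intro ε hε h
  apply hcond
  have hL : 0 < L := hcL ▸ c.hL
  refine ⟨min ε L, lt_min hε hL, ?_⟩
  rw [ae_restrict_iff' measurableSet_Ioo]
  filter_upwards [h, hc] with t h1 h2 ht
  have tε : t < ε := ht.2.trans_le (min_le_left _ _)
  have tL : t < L := ht.2.trans_le (min_le_right _ _)
  have k0 := h1 ⟨ht.1, tε.le⟩ (hcL ▸ tL.le)
  have k := h2 ⟨ht.1.le, tL.le⟩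
  have k1 := c.tr t
  have k2 := c.h_det t
  rw [k0, zero_mul] at k2
  have k3 : c.h 0 1 t = 0 := pow_eq_zero_iff two_ne_zero |>.1 (le_antisymm k2 (sq_nonneg _))
  ext i j
  rw [k]
  fin_cases i <;> fin_cases j
  · exact k0
  · exact k3
  · show c.h 1 0 t = 0
    rw [c.h_symm]; exact k3
  · show c.h 1 1 t = 1
    linarith

end PE5
end CS

namespace CS
section PE6
open Set Filter Topology ContinuousLinearMap

theorem sol_comp {L : ℝ} {H : ℝ → Matrix (Fin 2) (Fin 2) ℝ} {c : Coef} (hcL : c.L = L)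
    (hc : ∀ᵐ t, t ∈ Icc 0 L → ∀ i j, H t i j = c.h i j t) {z : ℂ} {Y : ℝ → Fin 2 → ℂ}
    (hY : IsCanSol H (Icc 0 L) z ![1, 0] Y) {x : ℝ} (hx : x ∈ Icc 0 L) :
    Y x 1 = - (z * ∫ t in (0:ℝ)..x, ((c.h 0 0 t : ℂ) * Y t 0 + (c.h 0 1 t : ℂ) * Y t 1)) ∧
    Y x 0 = 1 + z * ∫ t in (0:ℝ)..x, ((c.h 1 0 t : ℂ) * Y t 0 + (c.h 1 1 t : ℂ) * Y t 1) := by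
  obtain ⟨hcont, hs⟩ := hY
  have hu : uIcc 0 x = Icc 0 x := uIcc_of_le hx.1
  have hYc : ∀ j, ContinuousOn (fun t => Y t j) (uIcc 0 x) := by
    intro j
    rw [hu]
    exact ((continuous_apply j).comp_continuousOn hcont).mono (Icc_subset_Icc_right hx.2)
  have hintg : ∀ i j, IntervalIntegrable (fun t => (c.h i j t : ℂ) * Y t j) volume 0 x := fun i j =>
    IntervalIntegrable.mul_continuousOn (f := fun t => (c.h i j t : ℂ)) ⟨(c.h_ii i j 0 x).1.ofReal, (c.h_ii i j 0 x).2.ofReal⟩ (hYc j)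
  have h1 := hs x hx
  have e1 : (∫ t in (0:ℝ)..x, (cplx (H t)).mulVec (Y t)) = ∫ t in (0:ℝ)..x, fun i => ((c.h i 0 t : ℂ) * Y t 0 + (c.h i 1 t : ℂ) * Y t 1) := by
    apply intervalIntegral.integral_congr_ae
    filter_upwards [hc] with t ht hm
    rw [uIoc_of_le hx.1] at hm
    have := ht ⟨hm.1.le, hm.2.trans hx.2⟩
    funext i
    simp only [cplx, Matrix.mulVec, dotProduct, Fin.sum_univ_two, Matrix.map_apply, this]
  have hvec : IntervalIntegrable (fun t => (fun i => ((c.h i 0 t : ℂ) * Y t 0 + (c.h i 1 t : ℂ) * Y t 1) : Fin 2 → ℂ)) volume 0 x := by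
    have : ∀ i, IntervalIntegrable (fun t => (c.h i 0 t : ℂ) * Y t 0 + (c.h i 1 t : ℂ) * Y t 1) volume 0 x := fun i =>
      (hintg i 0).add (hintg i 1)
    refine ⟨Integrable.of_eval fun i => (this i).1, Integrable.of_eval fun i => (this i).2⟩
  have e2 : ∀ i, (∫ t in (0:ℝ)..x, fun i => ((c.h i 0 t : ℂ) * Y t 0 + (c.h i 1 t : ℂ) * Y t 1)) i =
      ∫ t in (0:ℝ)..x, ((c.h i 0 t : ℂ) * Y t 0 + (c.h i 1 t : ℂ) * Y t 1) := by
    intro i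
    have := (ContinuousLinearMap.proj (R := ℂ) (φ := fun _ : Fin 2 => ℂ) i).intervalIntegral_comp_comm hvec
    exact this.symm
  rw [e1] at h1
  have c0 := congrFun h1 0
  have c1 := congrFun h1 1
  rw [Pi.smul_apply, e2, smul_eq_mul] at c0 c1
  simp [Jc, Matrix.mulVec, dotProduct, Fin.sum_univ_two] at c0 c1
  constructor
  · rw [← c0]; ring
  · rw [← c1]; ring

theorem link {L : ℝ} {H : ℝ → Matrix (Fin 2) (Fin 2) ℝ} {c : Coef} (hcL : c.L = L)
    (hc : ∀ᵐ t, t ∈ Icc 0 L → ∀ i j, H t i j = c.h i j t) {z : ℂ} {Y : ℝ → Fin 2 → ℂ}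
    (hY : IsCanSol H (Icc 0 L) z ![1, 0] Y) :
    z * inner ℂ (c.e 0) (Ring.inverse (1 - z • c.V) (c.e 0)) = - Y L 1 ∧
    z * inner ℂ (c.e 1) (Ring.inverse (1 - z • c.V) (c.e 0)) = Y L 0 - 1 := by
  have hL : 0 < L := hcL ▸ c.hL
  have hmeas : ∀ j, AEStronglyMeasurable (fun t => Y t j) c.μ := by
    intro j
    have : ContinuousOn (fun t => Y t j) (Ioc 0 L) := ((continuous_apply j).comp_continuousOn hY.1).mono Ioc_subset_Icc_self
    rw [Coef.μ, hcL]
    exact this.aestronglyMeasurable measurableSet_Ioc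
  obtain ⟨C, hC⟩ := isCompact_Icc.exists_bound_of_continuousOn hY.1
  have hmem : MemLp (fun t => Y t 0 • c.ev 0 t + Y t 1 • c.ev 1 t) 2 c.μ := by
    refine MemLp.of_bound (((hmeas 0).smul (c.mev 0).aestronglyMeasurable).add ((hmeas 1).smul (c.mev 1).aestronglyMeasurable)) (C + C) ?_
    rw [Coef.ae_iff]
    refine Eventually.of_forall fun t ht => ?_
    have ht' : t ∈ Icc 0 L := ⟨ht.1.le, hcL ▸ ht.2⟩
    have b : ∀ j, ‖Y t j • c.ev j t‖ ≤ C := by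
      intro j
      rw [norm_smul]
      calc _ ≤ ‖Y t j‖ * 1 := by gcongr; exact c.ev_le j t
        _ = ‖Y t j‖ := mul_one _
        _ ≤ ‖Y t‖ := norm_le_pi_norm _ _
        _ ≤ C := hC t ht'
    exact (norm_add_le _ _).trans (add_le_add (b 0) (b 1))
  set θ : c.K := hmem.toLp _ with hθ
  have hθae : θ =ᵐ[c.μ] fun t => Y t 0 • c.ev 0 t + Y t 1 • c.ev 1 t := hmem.coeFn_toLp
  have hF : ∀ i, ∀ x ∈ Icc 0 L, c.F i θ x = ∫ t in (0:ℝ)..x, ((c.h i 0 t : ℂ) * Y t 0 + (c.h i 1 t : ℂ) * Y t 1) := by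
    intro i x hx
    unfold Coef.F
    apply intervalIntegral.integral_congr_ae
    filter_upwards [c.ae_iff.1 hθae] with t ht hm
    rw [uIoc_of_le hx.1] at hm
    have hm' : t ∈ Ioc 0 c.L := ⟨hm.1, hcL ▸ hm.2.trans hx.2⟩
    rw [c.g_of_mem _ _ hm', ht hm', inner_add_right, inner_smul_right, inner_smul_right, c.gram, c.gram]
    ring
  have hY1 : ∀ x ∈ Icc 0 L, Y x 1 = - (z * c.F 0 θ x) := fun x hx => by
    rw [hF 0 x hx]; exact (sol_comp hcL hc hY hx).1
  have hY0 : ∀ x ∈ Icc 0 L, Y x 0 = 1 + z * c.F 1 θ x := fun x hx => by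
    rw [hF 1 x hx]; exact (sol_comp hcL hc hY hx).2
  have heq : θ = c.e 0 + z • c.V θ := by
    apply Lp.ext
    have hm : ∀ᵐ t ∂c.μ, t ∈ Ioc 0 c.L := ae_restrict_mem measurableSet_Ioc
    filter_upwards [hθae, Lp.coeFn_add (c.e 0) (z • c.V θ), Lp.coeFn_smul z (c.V θ), c.V_ae θ, c.e_ae 0, hm] with t h1 h2 h3 h4 h5 h6
    have ht : t ∈ Icc 0 L := ⟨h6.1.le, hcL ▸ h6.2⟩
    rw [h1, h2, Pi.add_apply, h3, Pi.smul_apply, h4, h5, Coef.vf, hY0 t ht, hY1 t ht]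
    module
  have hR := thv_unique c.qsys heq
  rw [← hR, c.inner_e, c.inner_e, hcL]
  have hLm : L ∈ Icc 0 L := ⟨hL.le, le_rfl⟩
  rw [hY1 L hLm, hY0 L hLm]
  constructor <;> ring

end PE6
end CS

theorem stmt8 (L L₁ : ℝ) (hL : 0 < L) (hL₁ : 0 < L₁)
    (H H₁ : ℝ → Matrix (Fin 2) (Fin 2) ℝ)
    (hH : IsHamiltonian H L) (hH₁ : IsHamiltonian H₁ L₁)
    (hcond : ¬ ∃ ε > 0, ∀ᵐ x ∂(volume.restrict (Set.Ioo 0 ε)), H x = !![0, 0; 0, 1])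
    (hcond₁ : ¬ ∃ ε > 0, ∀ᵐ x ∂(volume.restrict (Set.Ioo 0 ε)), H₁ x = !![0, 0; 0, 1])
    (Θ Θ₁ : ℂ → ℝ → Fin 2 → ℂ)
    (hΘ : ∀ z : ℂ, IsCanSol H (Set.Icc 0 L) z ![1, 0] (Θ z))
    (hΘ₁ : ∀ z : ℂ, IsCanSol H₁ (Set.Icc 0 L₁) z ![1, 0] (Θ₁ z))
    (heq : ∀ lam : ℂ, Θ lam L = Θ₁ lam L₁) :
    L = L₁ ∧ ∀ᵐ x ∂(volume.restrict (Set.Ioo 0 L)), H x = H₁ x := by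
  obtain ⟨c, hcL, hc⟩ := CS.exists_coef hL hH
  obtain ⟨c₁, hcL₁, hc₁⟩ := CS.exists_coef hL₁ hH₁
  have hcc := CS.cond_of hcL hc hcond
  have hcc₁ := CS.cond_of hcL₁ hc₁ hcond₁
  have hm : ∀ (i : Fin 2) (n : ℕ), inner ℂ (c.e i) ((c.V ^ n) (c.e 0)) = inner ℂ (c₁.e i) ((c₁.V ^ n) (c₁.e 0)) := by
    intro i n
    apply CS.moments_aux c.qsys c₁.qsys
    intro z
    obtain ⟨a0, a1⟩ := CS.link hcL hc (hΘ z)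
    obtain ⟨b0, b1⟩ := CS.link hcL₁ hc₁ (hΘ₁ z)
    rw [← heq z] at b0 b1
    fin_cases i
    · exact a0.trans b0.symm
    · exact a1.trans b1.symm
  obtain ⟨h1, h2⟩ := CS.coef_unique c c₁ hcc hcc₁ hm
  rw [hcL, hcL₁] at h1
  rw [hcL] at h2
  refine ⟨h1, ?_⟩
  rw [ae_restrict_iff' measurableSet_Ioo]
  have hd : ∀ᵐ t, ∀ i j, t ∈ Set.uIcc 0 L → HasDerivAt (c.I i j) (c.h i j t) t := by
    rw [ae_all_iff]; intro i; rw [ae_all_iff]; intro j; exact (c.I_AD i j 0 L).der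
  have hd₁ : ∀ᵐ t, ∀ i j, t ∈ Set.uIcc 0 L → HasDerivAt (c₁.I i j) (c₁.h i j t) t := by
    rw [ae_all_iff]; intro i; rw [ae_all_iff]; intro j; exact (c₁.I_AD i j 0 L).der
  filter_upwards [hc, hc₁, hd, hd₁] with t k k₁ d d₁ ht
  have hI : t ∈ Set.Icc 0 L := ⟨ht.1.le, ht.2.le⟩
  have hu : t ∈ Set.uIcc 0 L := by rw [Set.uIcc_of_le hL.le]; exact hI
  ext i j
  rw [k hI, k₁ (h1 ▸ hI)]
  refine (d i j hu).unique ((d₁ i j hu).congr_of_eventuallyEq ?_)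
  filter_upwards [Ioo_mem_nhds ht.1 ht.2] with s hs
  exact h2 s ⟨hs.1.le, hs.2.le⟩ i j

end
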